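/- Let T and U be computable consistent extensions of PA and n ≥ 1. The following are equivalent: (1) there is a Σ_n sentence φ such that φ ∈ HCons(Π_n,T) and ¬φ ∈ HCons(Σ_n,U); (2) Th_{Π_n}(T) ⊆ HCons(Σ_n,U) and Th_{Σ_n}(U) ⊆ HCons(Π_n,T). -/

import Mathlib

open FirstOrder Language
open scoped FirstOrder

namespace Guaspari

/-- The first-order language of arithmetic: a constant `0`, a unary function `S`,
binary functions `+` (coded `false`) and `·` (coded `true`), and a binary relation `≤`. -/
def LA : FirstOrder.Language :=
  ⟨fun n => match n with | 0 => Unit | 1 => Unit | 2 => Bool | _ => Empty,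
   fun n => match n with | 2 => Unit | _ => Empty⟩

/-- Sentences of the language of arithmetic. -/
abbrev Snt : Type := LA.Sentence

/-- Theories (sets of sentences) in the language of arithmetic. -/
abbrev Thy : Type := LA.Theory

/-- The term `0`. -/
def zeroT {α : Type} {n : ℕ} : LA.Term (α ⊕ Fin n) :=
  Constants.term (show LA.Constants from Unit.unit)

/-- The term `S t`. -/
def succT {α : Type} {n : ℕ} (t : LA.Term (α ⊕ Fin n)) : LA.Term (α ⊕ Fin n) :=
  Functions.apply₁ (show LA.Functions 1 from Unit.unit) t

/-- The term `t + u`. -/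
def addT {α : Type} {n : ℕ} (t u : LA.Term (α ⊕ Fin n)) : LA.Term (α ⊕ Fin n) :=
  Functions.apply₂ (show LA.Functions 2 from false) t u

/-- The term `t * u`. -/
def mulT {α : Type} {n : ℕ} (t u : LA.Term (α ⊕ Fin n)) : LA.Term (α ⊕ Fin n) :=
  Functions.apply₂ (show LA.Functions 2 from true) t u

/-- The atomic formula `t ≤ u`. -/
def leF {α : Type} {n : ℕ} (t u : LA.Term (α ⊕ Fin n)) : LA.BoundedFormula α n :=
  Relations.boundedFormula₂ (show LA.Relations 2 from Unit.unit) t u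

/-- The `i`-th (de Bruijn-indexed) bound variable as a term. -/
def vT {m : ℕ} (i : Fin m) : LA.Term (Empty ⊕ Fin m) := Term.var (Sum.inr i)

/-- The induction axiom for the formula `φ(x₀,…,x_{k-1}, x_k)` with induction on `x_k`,
universally closed over the parameters `x₀,…,x_{k-1}`. -/
def indAxiom {k : ℕ} (φ : LA.BoundedFormula Empty (k + 1)) : Snt :=
  let base := ∀' ((vT (Fin.last k) =' zeroT) ⟹ φ)
  let step := ∀' (φ ⟹
    ∀' ((vT (Fin.last (k + 1)) =' succT (vT (Fin.castSucc (Fin.last k)))) ⟹ φ.liftAt 1 k))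
  ((base ⊓ step) ⟹ ∀' φ).alls

/-- The axioms of Peano arithmetic `PA`: the basic axioms for `0`, `S`, `+`, `·`, `≤`,
together with the full induction scheme. -/
def PAAx : Thy :=
  {∀' ∼(succT (vT 0) =' zeroT),
   ∀' ∀' ((succT (vT 0) =' succT (vT 1)) ⟹ (vT 0 =' vT 1)),
   ∀' (addT (vT 0) zeroT =' vT 0),
   ∀' ∀' (addT (vT 0) (succT (vT 1)) =' succT (addT (vT 0) (vT 1))),
   ∀' (mulT (vT 0) zeroT =' zeroT),
   ∀' ∀' (mulT (vT 0) (succT (vT 1)) =' addT (mulT (vT 0) (vT 1)) (vT 0)),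
   ∀' ∀' (leF (vT 0) (vT 1) ⇔ ∃' (addT (vT 2) (vT 0) =' vT 1))} ∪
  {φ | ∃ (k : ℕ) (ψ : LA.BoundedFormula Empty (k + 1)), φ = indAxiom ψ}

/-- `Prv T φ`: the sentence `φ` is provable from the theory `T` (equivalently, by the
Gödel completeness theorem, `φ` holds in every model of `T`). -/
def Prv (T : Thy) (φ : Snt) : Prop := T ⊨ᵇ φ

/-- `Th T`: the set of sentences provable from `T`. -/
def Th (T : Thy) : Set Snt := {φ | Prv T φ}

/-- `Con T`: the theory `T` is consistent. -/
def Con (T : Thy) : Prop := ¬ Prv T ⊥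

/-- The theory `T + φ`. -/
def add (T : Thy) (φ : Snt) : Thy := insert φ T

/-- `T` is an extension of `PA`. -/
def ExtPA (T : Thy) : Prop := ∀ φ ∈ PAAx, Prv T φ

/-- `V` is a subtheory of `T` (containing `PA`, as assumed throughout the paper). -/
def SubThy (V T : Thy) : Prop := ExtPA V ∧ ∀ φ, Prv V φ → Prv T φ

/-- Δ₀ (bounded) formulas. -/
inductive IsDelta0 : ∀ {m : ℕ}, LA.BoundedFormula Empty m → Prop
  | falsum {m : ℕ} : IsDelta0 (⊥ : LA.BoundedFormula Empty m)
  | equal {m : ℕ} (t u : LA.Term (Empty ⊕ Fin m)) : IsDelta0 (t =' u)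
  | le {m : ℕ} (t u : LA.Term (Empty ⊕ Fin m)) : IsDelta0 (leF t u)
  | imp {m : ℕ} {φ ψ : LA.BoundedFormula Empty m} :
      IsDelta0 φ → IsDelta0 ψ → IsDelta0 (φ ⟹ ψ)
  | ball {m : ℕ} (t : LA.Term (Empty ⊕ Fin m)) {φ : LA.BoundedFormula Empty (m + 1)} :
      IsDelta0 φ →
      IsDelta0 (∀' (leF (vT (Fin.last m)) (t.relabel (Sum.map id Fin.castSucc)) ⟹ φ))
  | bex {m : ℕ} (t : LA.Term (Empty ⊕ Fin m)) {φ : LA.BoundedFormula Empty (m + 1)} :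
      IsDelta0 φ →
      IsDelta0 (∃' (leF (vT (Fin.last m)) (t.relabel (Sum.map id Fin.castSucc)) ⊓ φ))

mutual
  /-- `Σ_k` formulas (cumulatively: every `Π_k` formula is `Σ_{k+1}`). -/
  inductive IsSigmaFml : ℕ → ∀ {m : ℕ}, LA.BoundedFormula Empty m → Prop
    | ofDelta0 {m : ℕ} {φ : LA.BoundedFormula Empty m} : IsDelta0 φ → IsSigmaFml 0 φ
    | ofPi {k : ℕ} {m : ℕ} {φ : LA.BoundedFormula Empty m} :
        IsPiFml k φ → IsSigmaFml (k + 1) φ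
    | ex {k : ℕ} {m : ℕ} {φ : LA.BoundedFormula Empty (m + 1)} :
        IsSigmaFml (k + 1) φ → IsSigmaFml (k + 1) (∃' φ)
  /-- `Π_k` formulas (cumulatively: every `Σ_k` formula is `Π_{k+1}`). -/
  inductive IsPiFml : ℕ → ∀ {m : ℕ}, LA.BoundedFormula Empty m → Prop
    | ofDelta0 {m : ℕ} {φ : LA.BoundedFormula Empty m} : IsDelta0 φ → IsPiFml 0 φ
    | ofSigma {k : ℕ} {m : ℕ} {φ : LA.BoundedFormula Empty m} :
        IsSigmaFml k φ → IsPiFml (k + 1) φ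
    | all {k : ℕ} {m : ℕ} {φ : LA.BoundedFormula Empty (m + 1)} :
        IsPiFml (k + 1) φ → IsPiFml (k + 1) (∀' φ)
end

/-- The set of `Σ_k` sentences. -/
def SigmaS (k : ℕ) : Set Snt := {φ | IsSigmaFml k φ}

/-- The set of `Π_k` sentences. -/
def PiS (k : ℕ) : Set Snt := {φ | IsPiFml k φ}

/-- The set of `Σ_k ∧ Π_k` sentences, i.e. sentences of the form `σ ∧ π` with
`σ` a `Σ_k` sentence and `π` a `Π_k` sentence. -/
def SigAndPiS (k : ℕ) : Set Snt :=
  {φ | ∃ σ ∈ SigmaS k, ∃ π ∈ PiS k, φ = σ ⊓ π}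

/-- `B(Σ_k)` sentences: Boolean combinations of `Σ_k` sentences. -/
inductive IsBoolSigma (k : ℕ) : Snt → Prop
  | base {φ : Snt} : φ ∈ SigmaS k → IsBoolSigma k φ
  | not {φ : Snt} : IsBoolSigma k φ → IsBoolSigma k (∼φ)
  | imp {φ ψ : Snt} : IsBoolSigma k φ → IsBoolSigma k ψ → IsBoolSigma k (φ ⟹ ψ)
  | inf {φ ψ : Snt} : IsBoolSigma k φ → IsBoolSigma k ψ → IsBoolSigma k (φ ⊓ ψ)
  | sup {φ ψ : Snt} : IsBoolSigma k φ → IsBoolSigma k ψ → IsBoolSigma k (φ ⊔ ψ)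

/-- The set of `B(Σ_k)` sentences. -/
def BSigmaS (k : ℕ) : Set Snt := {φ | IsBoolSigma k φ}

/-- The set of `Γ` sentences provable in `T`, `Th_Γ(T)`. -/
def ThIn (Γ : Set Snt) (T : Thy) : Set Snt := Γ ∩ Th T

instance (i : ℕ) : Encodable (LA.Functions i) :=
  match i with
  | 0 => inferInstanceAs (Encodable Unit)
  | 1 => inferInstanceAs (Encodable Unit)
  | 2 => inferInstanceAs (Encodable Bool)
  | (_ + 3) => inferInstanceAs (Encodable Empty)

instance (i : ℕ) : Encodable (LA.Relations i) :=
  match i with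
  | 0 => inferInstanceAs (Encodable Empty)
  | 1 => inferInstanceAs (Encodable Empty)
  | 2 => inferInstanceAs (Encodable Unit)
  | (_ + 3) => inferInstanceAs (Encodable Empty)

/-- A Gödel numbering of sentences, via Mathlib's encoding of bounded formulas. -/
def gnum (φ : Snt) : ℕ :=
  Encodable.encode
    (show List ((Σ k, LA.Term (Empty ⊕ Fin k)) ⊕ ((Σ n, LA.Relations n) ⊕ ℕ)) from
      BoundedFormula.encoding.encode (⟨0, φ⟩ : Σ n, LA.BoundedFormula Empty n))

/-- The (axiom set of the) theory `T` is computable. -/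
def CompThy (T : Thy) : Prop :=
  ComputablePred (fun m : ℕ => ∃ φ ∈ T, gnum φ = m)

/-- `T` is a computable consistent extension of `PA`. -/
def GoodThy (T : Thy) : Prop := CompThy T ∧ Con T ∧ ExtPA T

/-- `φ` is `Γ`-conservative over `T` for a class of sentences `Γ`:
every `Γ` sentence provable in `T + φ` is provable in `T`. -/
def ConsIn (Γ : Set Snt) (T : Thy) (φ : Snt) : Prop :=
  ∀ γ ∈ Γ, Prv (add T φ) γ → Prv T γ

/-- `φ` is hereditarily `Γ`-conservative over `T`: `Γ`-conservative over every
subtheory of `T` (containing `PA`). -/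
def HConsIn (Γ : Set Snt) (T : Thy) (φ : Snt) : Prop :=
  ∀ V : Thy, SubThy V T → ConsIn Γ V φ

/-- `φ` is `Σ_k↓Π_k`-conservative over `V`. -/
def SPCons (k : ℕ) (V : Thy) (φ : Snt) : Prop :=
  ∀ σ ∈ SigmaS k, ∀ π ∈ PiS k, Prv (add V φ) (σ ⊓ π) → Prv V (σ ⊔ π)

/-- `φ` is hereditarily `Σ_k↓Π_k`-conservative over `T`. -/
def HSPCons (k : ℕ) (T : Thy) (φ : Snt) : Prop :=
  ∀ V : Thy, SubThy V T → SPCons k V φ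

/-- The theory `S` is `Σ_k↓Π_k`-conservative over `PA`. -/
def ThySPConsPA (k : ℕ) (S : Thy) : Prop :=
  ∀ σ ∈ SigmaS k, ∀ π ∈ PiS k, Prv S (σ ⊓ π) → Prv PAAx (σ ⊔ π)

/-- `δ` is a `Δ_k(S)` sentence: `S`-provably equivalent to both a `Σ_k` sentence
and a `Π_k` sentence. -/
def IsDeltaIn (k : ℕ) (S : Thy) (δ : Snt) : Prop :=
  (∃ σ ∈ SigmaS k, Prv S (δ ⇔ σ)) ∧ ∃ π ∈ PiS k, Prv S (δ ⇔ π)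

/-- `φ` is `Δ_k(S)`-conservative over `V`. -/
def DeltaConsRel (k : ℕ) (S V : Thy) (φ : Snt) : Prop :=
  ∀ δ : Snt, IsDeltaIn k S δ → Prv (add V φ) δ → Prv V δ

/-- `φ` is `Δ_k`-conservative over `T`, i.e. `Δ_k(Th(T))`-conservative over `T`. -/
def DeltaCons (k : ℕ) (T : Thy) (φ : Snt) : Prop := DeltaConsRel k (Th T) T φ

/-- `φ` is hereditarily `Δ_k`-conservative over `T`. -/
def HDeltaCons (k : ℕ) (T : Thy) (φ : Snt) : Prop :=
  ∀ V : Thy, SubThy V T → DeltaConsRel k (Th V) V φ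

/-- `φ` is doubly `Π_k`-conservative over `T`: `φ` is `Π_k`-conservative and `¬φ` is
`Σ_k`-conservative over `T`. -/
def DCons (k : ℕ) (T : Thy) (φ : Snt) : Prop :=
  ConsIn (PiS k) T φ ∧ ConsIn (SigmaS k) T (∼φ)

/-- `φ` is hereditarily doubly `Π_k`-conservative over `T`. -/
def HDCons (k : ℕ) (T : Thy) (φ : Snt) : Prop :=
  ∀ V : Thy, SubThy V T → DCons k V φ

/-- `(T,U)` is a `B_n`-pair. -/
def Bpair (n : ℕ) (T U : Thy) : Prop :=
  (¬ ThIn (PiS n) T ⊆ Th U ∨ Con (T ∪ ThIn (PiS n) U)) ∧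
  (¬ ThIn (PiS n) U ⊆ Th T ∨ Con (U ∪ ThIn (PiS n) T))

/-- `(T,U)` is a `C_n`-pair. -/
def Cpair (n : ℕ) (T U : Thy) : Prop :=
  Con (T ∪ ThIn (PiS n) U) ∧ Con (U ∪ ThIn (PiS n) T)

/-- `(T,U)` is a `C⁻_n`-pair. -/
def Cmpair (n : ℕ) (T U : Thy) : Prop :=
  Con (T ∪ ThIn (PiS n) U) ∨ Con (U ∪ ThIn (PiS n) T)

/-- `(T,U)` is a `C^∧_n`-pair. -/
def Capair (n : ℕ) (T U : Thy) : Prop :=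
  Con (T ∪ ThIn (SigAndPiS n) U) ∧ Con (U ∪ ThIn (SigAndPiS n) T)

/-- `(T,U)` is a `C^B_n`-pair. -/
def CBpair (n : ℕ) (T U : Thy) : Prop :=
  Con (T ∪ ThIn (BSigmaS n) U)




/-- Bundled models of `PA`. -/
abbrev PM := Theory.ModelType.{0, 0, 0} PAAx

/-- Uniform predicates on the models of `PA`. -/
abbrev UP (m : ℕ) := ∀ M : PM, (Fin m → M) → Prop

section ops
variable {M : Type} [LA.Structure M]
def mzero (M : Type) [LA.Structure M] : M :=
  Structure.funMap (L := LA) (show LA.Functions 0 from Unit.unit) ![]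
def msucc (x : M) : M := Structure.funMap (L := LA) (show LA.Functions 1 from Unit.unit) ![x]
def madd (x y : M) : M := Structure.funMap (L := LA) (show LA.Functions 2 from false) ![x, y]
def mmul (x y : M) : M := Structure.funMap (L := LA) (show LA.Functions 2 from true) ![x, y]
def mle (x y : M) : Prop := Structure.RelMap (L := LA) (show LA.Relations 2 from Unit.unit) ![x, y]

variable {α : Type} {n : ℕ}
@[simp] theorem r_zeroT (v : α ⊕ Fin n → M) : (zeroT : LA.Term (α ⊕ Fin n)).realize v = mzero M := by
  unfold zeroT mzero
  rw [Term.realize_constants]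
  simp only [constantMap]
  congr 1
@[simp] theorem r_succT (v : α ⊕ Fin n → M) (t : LA.Term (α ⊕ Fin n)) :
    (succT t).realize v = msucc (t.realize v) := by
  exact Term.realize_functions_apply₁ (L := LA)
@[simp] theorem r_addT (v : α ⊕ Fin n → M) (t u : LA.Term (α ⊕ Fin n)) :
    (addT t u).realize v = madd (t.realize v) (u.realize v) := by
  exact Term.realize_functions_apply₂ (L := LA)
@[simp] theorem r_mulT (v : α ⊕ Fin n → M) (t u : LA.Term (α ⊕ Fin n)) :
    (mulT t u).realize v = mmul (t.realize v) (u.realize v) := by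
  exact Term.realize_functions_apply₂ (L := LA)
@[simp] theorem r_leF (v : α → M) (xs : Fin n → M) (t u : LA.Term (α ⊕ Fin n)) :
    (leF t u).Realize v xs ↔ mle (t.realize (Sum.elim v xs)) (u.realize (Sum.elim v xs)) := by
  exact BoundedFormula.realize_rel₂ (L := LA)
@[simp] theorem r_vT (v : Empty → M) (xs : Fin n → M) (i : Fin n) :
    (vT i).realize (Sum.elim v xs) = xs i := rfl
end ops

instance (M : PM) : Zero M := ⟨mzero M⟩
instance (M : PM) : Add M := ⟨madd⟩
instance (M : PM) : Mul M := ⟨mmul⟩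
instance (M : PM) : LE M := ⟨mle⟩
instance (M : PM) : One M := ⟨msucc 0⟩

/-- Uniformly term-definable functions. -/
def Tmf {m : ℕ} (f : ∀ M : PM, (Fin m → M) → M) : Prop :=
  ∃ t : LA.Term (Empty ⊕ Fin m), ∀ (M : PM) v, t.realize (Sum.elim default v) = f M v

/-- Uniformly definable predicates. -/
def DF {m : ℕ} (P : UP m) : Prop :=
  ∃ φ : LA.BoundedFormula Empty m, ∀ M v, φ.Realize default v ↔ P M v

theorem Tmf.var {m : ℕ} (i : Fin m) : Tmf (fun _ v => v i) := ⟨vT i, fun _ _ => rfl⟩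
theorem Tmf.zero {m : ℕ} : Tmf (m := m) (fun _ _ => 0) := ⟨zeroT, fun _ _ => r_zeroT _⟩
theorem Tmf.succ {m : ℕ} {f : ∀ M : PM, (Fin m → M) → M} (hf : Tmf f) :
    Tmf (fun M v => msucc (f M v)) := by
  obtain ⟨t, ht⟩ := hf
  exact ⟨succT t, fun M v => by rw [r_succT, ht]⟩
theorem Tmf.one {m : ℕ} : Tmf (m := m) (fun _ _ => 1) := Tmf.succ Tmf.zero
theorem Tmf.add {m : ℕ} {f g : ∀ M : PM, (Fin m → M) → M} (hf : Tmf f) (hg : Tmf g) :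
    Tmf (fun M v => f M v + g M v) := by
  obtain ⟨t, ht⟩ := hf
  obtain ⟨u, hu⟩ := hg
  exact ⟨addT t u, fun M v => by rw [r_addT, ht, hu]; rfl⟩
theorem Tmf.mul {m : ℕ} {f g : ∀ M : PM, (Fin m → M) → M} (hf : Tmf f) (hg : Tmf g) :
    Tmf (fun M v => f M v * g M v) := by
  obtain ⟨t, ht⟩ := hf
  obtain ⟨u, hu⟩ := hg
  exact ⟨mulT t u, fun M v => by rw [r_mulT, ht, hu]; rfl⟩
theorem Tmf.subst {m k : ℕ} {f : ∀ M : PM, (Fin m → M) → M} (hf : Tmf f)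
    {s : Fin m → ∀ M : PM, (Fin k → M) → M} (hs : ∀ i, Tmf (s i)) :
    Tmf (fun M v => f M (fun i => s i M v)) := by
  obtain ⟨t, ht⟩ := hf
  choose u hu using hs
  refine ⟨t.subst (Sum.elim Empty.elim u), fun M v => ?_⟩
  rw [Term.realize_subst]
  beta_reduce
  rw [← ht]
  congr 1
  funext i
  rcases i with i | i
  · exact i.elim
  · exact hu i M v

theorem DF.eq {m : ℕ} {f g : ∀ M : PM, (Fin m → M) → M} (hf : Tmf f) (hg : Tmf g) :
    DF (fun M v => f M v = g M v) := by
  obtain ⟨t, ht⟩ := hf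
  obtain ⟨u, hu⟩ := hg
  exact ⟨t =' u, fun M v => by rw [BoundedFormula.realize_bdEqual, ht, hu]⟩
theorem DF.le {m : ℕ} {f g : ∀ M : PM, (Fin m → M) → M} (hf : Tmf f) (hg : Tmf g) :
    DF (fun M v => f M v ≤ g M v) := by
  obtain ⟨t, ht⟩ := hf
  obtain ⟨u, hu⟩ := hg
  exact ⟨leF t u, fun M v => by rw [r_leF, ht, hu]; rfl⟩
theorem DF.not {m : ℕ} {P : UP m} (hP : DF P) : DF (fun M v => ¬ P M v) := by
  obtain ⟨t, ht⟩ := hP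
  exact ⟨∼t, fun M v => by rw [BoundedFormula.realize_not, ht]⟩
theorem DF.imp {m : ℕ} {P Q : UP m} (hP : DF P) (hQ : DF Q) : DF (fun M v => P M v → Q M v) := by
  obtain ⟨t, ht⟩ := hP
  obtain ⟨u, hu⟩ := hQ
  exact ⟨t.imp u, fun M v => by rw [BoundedFormula.realize_imp, ht, hu]⟩
theorem DF.and {m : ℕ} {P Q : UP m} (hP : DF P) (hQ : DF Q) : DF (fun M v => P M v ∧ Q M v) := by
  obtain ⟨t, ht⟩ := hP
  obtain ⟨u, hu⟩ := hQ
  exact ⟨t ⊓ u, fun M v => by rw [BoundedFormula.realize_inf, ht, hu]⟩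
theorem DF.or {m : ℕ} {P Q : UP m} (hP : DF P) (hQ : DF Q) : DF (fun M v => P M v ∨ Q M v) := by
  obtain ⟨t, ht⟩ := hP
  obtain ⟨u, hu⟩ := hQ
  exact ⟨t ⊔ u, fun M v => by rw [BoundedFormula.realize_sup, ht, hu]⟩
theorem DF.iff {m : ℕ} {P Q : UP m} (hP : DF P) (hQ : DF Q) : DF (fun M v => P M v ↔ Q M v) := by
  obtain ⟨t, ht⟩ := hP
  obtain ⟨u, hu⟩ := hQ
  exact ⟨t.iff u, fun M v => by rw [BoundedFormula.realize_iff, ht, hu]⟩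
theorem snoc_castSucc' {M : Type} {m : ℕ} (v : Fin m → M) (x : M) :
    (fun i : Fin m => (Fin.snoc v x : Fin (m+1) → M) (Fin.castSucc i)) = v := by
  funext i
  simp
theorem DF.all {m : ℕ} {Q : ∀ M : PM, (Fin m → M) → M → Prop}
    (hQ : DF (m := m + 1) (fun M w => Q M (fun i => w i.castSucc) (w (Fin.last m)))) :
    DF (fun M v => ∀ x, Q M v x) := by
  obtain ⟨t, ht⟩ := hQ
  refine ⟨∀' t, fun M v => ?_⟩
  rw [BoundedFormula.realize_all]
  refine forall_congr' fun x => ?_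
  rw [ht]
  beta_reduce
  rw [snoc_castSucc', Fin.snoc_last]
theorem DF.ex {m : ℕ} {Q : ∀ M : PM, (Fin m → M) → M → Prop}
    (hQ : DF (m := m + 1) (fun M w => Q M (fun i => w i.castSucc) (w (Fin.last m)))) :
    DF (fun M v => ∃ x, Q M v x) := by
  obtain ⟨t, ht⟩ := hQ
  refine ⟨∃' t, fun M v => ?_⟩
  rw [BoundedFormula.realize_ex]
  refine exists_congr fun x => ?_
  rw [ht]
  beta_reduce
  rw [snoc_castSucc', Fin.snoc_last]

theorem ind {k : ℕ} {P : UP (k + 1)} (hP : DF P) (M : PM) (v : Fin k → M)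
    (h0 : P M (Fin.snoc v 0)) (hs : ∀ x, P M (Fin.snoc v x) → P M (Fin.snoc v (msucc x))) :
    ∀ x, P M (Fin.snoc v x) := by
  obtain ⟨φ, hφ⟩ := hP
  have h : M ⊨ indAxiom φ := M.is_model.realize_of_mem _ (Or.inr ⟨k, φ, rfl⟩)
  have h' := (BoundedFormula.realize_alls (v := (default : Empty → M))).1 h v
  rw [BoundedFormula.realize_imp, BoundedFormula.realize_inf] at h'
  simp only [BoundedFormula.realize_all, BoundedFormula.realize_imp,
    BoundedFormula.realize_bdEqual, r_vT, r_zeroT, r_succT, hφ, Fin.snoc_last] at h'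
  apply h'
  refine ⟨fun a ha => ha ▸ h0, fun a ha b hb => ?_⟩
  rw [BoundedFormula.realize_liftAt_one (Nat.le_succ k), hφ]
  have e := hs a ha
  rw [Fin.snoc_castSucc, Fin.snoc_last] at hb
  convert e using 1
  funext i
  refine Fin.lastCases ?_ (fun j => ?_) i
  · simp [hb]
  · simp [Function.comp]

theorem ax_mem {M : PM} {φ : Snt} (h : φ ∈ PAAx) : BoundedFormula.Realize (M := M) φ default default :=
  M.is_model.realize_of_mem _ h

section axioms
variable {M : PM}
theorem succ_ne (x : M) : msucc x ≠ 0 := by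
  have h := ax_mem (M := M) (φ := ∀' ∼(succT (vT 0) =' zeroT)) (Or.inl (by simp))
  have := h x
  rw [BoundedFormula.realize_not, BoundedFormula.realize_bdEqual, r_succT, r_zeroT] at this
  exact this
theorem succ_inj (x y : M) : msucc x = msucc y → x = y := by
  have h := ax_mem (M := M) (φ := ∀' ∀' ((succT (vT 0) =' succT (vT 1)) ⟹ (vT 0 =' vT 1)))
    (Or.inl (by simp))
  have := h x y
  rw [BoundedFormula.realize_imp, BoundedFormula.realize_bdEqual, r_succT, r_succT] at this
  exact this
theorem add_zero' (x : M) : x + 0 = x := by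
  have h := ax_mem (M := M) (φ := ∀' (addT (vT 0) zeroT =' vT 0)) (Or.inl (by simp))
  have := h x
  rwa [BoundedFormula.realize_bdEqual, r_addT, r_zeroT] at this
theorem add_succ' (x y : M) : x + msucc y = msucc (x + y) := by
  have h := ax_mem (M := M) (φ := ∀' ∀' (addT (vT 0) (succT (vT 1)) =' succT (addT (vT 0) (vT 1))))
    (Or.inl (by simp))
  have := h x y
  rwa [BoundedFormula.realize_bdEqual, r_addT, r_succT, r_succT, r_addT] at this
theorem mul_zero' (x : M) : x * 0 = 0 := by
  have h := ax_mem (M := M) (φ := ∀' (mulT (vT 0) zeroT =' zeroT)) (Or.inl (by simp))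
  have := h x
  rwa [BoundedFormula.realize_bdEqual, r_mulT, r_zeroT] at this
theorem mul_succ' (x y : M) : x * msucc y = x * y + x := by
  have h := ax_mem (M := M)
    (φ := ∀' ∀' (mulT (vT 0) (succT (vT 1)) =' addT (mulT (vT 0) (vT 1)) (vT 0))) (Or.inl (by simp))
  have := h x y
  rwa [BoundedFormula.realize_bdEqual, r_mulT, r_succT, r_addT, r_mulT] at this
theorem le_def' (x y : M) : x ≤ y ↔ ∃ z, z + x = y := by
  have h := ax_mem (M := M)
    (φ := ∀' ∀' (leF (vT 0) (vT 1) ⇔ ∃' (addT (vT 2) (vT 0) =' vT 1))) (Or.inl (by simp))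
  have := h x y
  rw [BoundedFormula.realize_iff, BoundedFormula.realize_ex, r_leF] at this
  refine this.trans (exists_congr fun z => ?_)
  rw [BoundedFormula.realize_bdEqual, r_addT]
  rfl
end axioms


theorem ind1 {P : UP 1} (hP : DF P) (M : PM)
    (h0 : P M ![0]) (hs : ∀ x, P M ![x] → P M ![msucc x]) (x : M) : P M ![x] := by
  have e : ∀ x : M, (Fin.snoc ![] x : Fin 1 → M) = ![x] := by
    intro x; funext i; fin_cases i; rfl
  have := ind hP M ![] (by rw [e]; exact h0) (by intro x; rw [e, e]; exact hs x) x
  rwa [e] at this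
theorem ind2 {P : UP 2} (hP : DF P) (M : PM) (a : M)
    (h0 : P M ![a, 0]) (hs : ∀ x, P M ![a, x] → P M ![a, msucc x]) (x : M) : P M ![a, x] := by
  have e : ∀ x : M, (Fin.snoc ![a] x : Fin 2 → M) = ![a, x] := by
    intro x; funext i; fin_cases i <;> rfl
  have := ind hP M ![a] (by rw [e]; exact h0) (by intro x; rw [e, e]; exact hs x) x
  rwa [e] at this
theorem ind3 {P : UP 3} (hP : DF P) (M : PM) (a b : M)
    (h0 : P M ![a, b, 0]) (hs : ∀ x, P M ![a, b, x] → P M ![a, b, msucc x]) (x : M) :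
    P M ![a, b, x] := by
  have e : ∀ x : M, (Fin.snoc ![a, b] x : Fin 3 → M) = ![a, b, x] := by
    intro x; funext i; fin_cases i <;> rfl
  have := ind hP M ![a, b] (by rw [e]; exact h0) (by intro x; rw [e, e]; exact hs x) x
  rwa [e] at this

section alg
variable {M : PM}

theorem cases0 (x : M) : x = 0 ∨ ∃ y, x = msucc y := by
  refine ind1 (P := fun M w => w 0 = 0 ∨ ∃ y, w 0 = msucc y) ?_ M (Or.inl rfl)
    (fun x _ => Or.inr ⟨x, rfl⟩) x
  repeat' first | apply Tmf.var | apply Tmf.zero | apply Tmf.succ | apply DF.eq | apply DF.or | apply DF.ex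
theorem zero_add' (x : M) : 0 + x = x := by
  refine ind1 (P := fun M w => 0 + w 0 = w 0) ?_ M (add_zero' _) (fun x ih => ?_) x
  · repeat' first | apply Tmf.var | apply Tmf.zero | apply Tmf.add | apply DF.eq
  · change 0 + msucc x = msucc x
    rw [add_succ']
    exact congrArg _ ih
theorem succ_add' (a x : M) : msucc a + x = msucc (a + x) := by
  refine ind2 (P := fun M w => msucc (w 0) + w 1 = msucc (w 0 + w 1)) ?_ M a ?_ (fun x ih => ?_) x
  · repeat' first | apply Tmf.var | apply Tmf.succ | apply Tmf.add | apply DF.eq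
  · change msucc a + 0 = msucc (a + 0)
    rw [add_zero', add_zero']
  · change msucc a + msucc x = msucc (a + msucc x)
    rw [add_succ', add_succ']
    exact congrArg _ ih
theorem add_comm' (a x : M) : a + x = x + a := by
  refine ind2 (P := fun M w => w 0 + w 1 = w 1 + w 0) ?_ M a ?_ (fun x ih => ?_) x
  · repeat' first | apply Tmf.var | apply Tmf.succ | apply Tmf.add | apply DF.eq
  · change a + 0 = 0 + a
    rw [add_zero', zero_add']
  · change a + msucc x = msucc x + a
    rw [add_succ', succ_add']
    exact congrArg _ ih
theorem add_assoc' (a b x : M) : a + b + x = a + (b + x) := by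
  refine ind3 (P := fun M w => w 0 + w 1 + w 2 = w 0 + (w 1 + w 2)) ?_ M a b ?_ (fun x ih => ?_) x
  · repeat' first | apply Tmf.var | apply Tmf.succ | apply Tmf.add | apply DF.eq
  · change a + b + 0 = a + (b + 0)
    rw [add_zero', add_zero']
  · change a + b + msucc x = a + (b + msucc x)
    rw [add_succ', add_succ', add_succ']
    exact congrArg _ ih
theorem add_cancel' (a b x : M) : a + x = b + x → a = b := by
  refine ind3 (P := fun M w => w 0 + w 2 = w 1 + w 2 → w 0 = w 1) ?_ M a b ?_ (fun x ih => ?_) x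
  · repeat' first | apply Tmf.var | apply Tmf.succ | apply Tmf.add | apply DF.eq | apply DF.imp
  · change a + 0 = b + 0 → a = b
    rw [add_zero', add_zero']
    exact id
  · change a + msucc x = b + msucc x → a = b
    rw [add_succ', add_succ']
    exact fun h => ih (succ_inj _ _ h)
theorem add_eq_zero' (a b : M) (h : a + b = 0) : b = 0 := by
  rcases cases0 b with h' | ⟨y, rfl⟩
  · exact h'
  · rw [add_succ'] at h
    exact absurd h (succ_ne _)
theorem zero_mul' (x : M) : 0 * x = 0 := by
  refine ind1 (P := fun M w => 0 * w 0 = 0) ?_ M (mul_zero' _) (fun x ih => ?_) x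
  · repeat' first | apply Tmf.var | apply Tmf.zero | apply Tmf.mul | apply DF.eq
  · change 0 * msucc x = 0
    rw [mul_succ', add_zero']
    exact ih
theorem succ_mul' (a x : M) : msucc a * x = a * x + x := by
  refine ind2 (P := fun M w => msucc (w 0) * w 1 = w 0 * w 1 + w 1) ?_ M a ?_ (fun x ih => ?_) x
  · repeat' first | apply Tmf.var | apply Tmf.succ | apply Tmf.add | apply Tmf.mul | apply DF.eq
  · change msucc a * 0 = a * 0 + 0
    rw [mul_zero', mul_zero', add_zero']
  · change msucc a * msucc x = a * msucc x + msucc x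
    have ih' : msucc a * x = a * x + x := ih
    rw [mul_succ', ih', mul_succ', add_succ', add_succ', add_assoc', add_comm' x a, ← add_assoc']
theorem mul_comm' (a x : M) : a * x = x * a := by
  refine ind2 (P := fun M w => w 0 * w 1 = w 1 * w 0) ?_ M a ?_ (fun x ih => ?_) x
  · repeat' first | apply Tmf.var | apply Tmf.mul | apply DF.eq
  · change a * 0 = 0 * a
    rw [mul_zero', zero_mul']
  · change a * msucc x = msucc x * a
    have ih' : a * x = x * a := ih
    rw [mul_succ', succ_mul', ih']
theorem mul_add' (a b x : M) : a * (b + x) = a * b + a * x := by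
  refine ind3 (P := fun M w => w 0 * (w 1 + w 2) = w 0 * w 1 + w 0 * w 2) ?_ M a b ?_
    (fun x ih => ?_) x
  · repeat' first | apply Tmf.var | apply Tmf.mul | apply Tmf.add | apply DF.eq
  · change a * (b + 0) = a * b + a * 0
    rw [add_zero', mul_zero', add_zero']
  · change a * (b + msucc x) = a * b + a * msucc x
    have ih' : a * (b + x) = a * b + a * x := ih
    rw [add_succ', mul_succ', mul_succ', ih', add_assoc']
theorem mul_assoc' (a b x : M) : a * b * x = a * (b * x) := by
  refine ind3 (P := fun M w => w 0 * w 1 * w 2 = w 0 * (w 1 * w 2)) ?_ M a b ?_ (fun x ih => ?_) x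
  · repeat' first | apply Tmf.var | apply Tmf.mul | apply DF.eq
  · change a * b * 0 = a * (b * 0)
    rw [mul_zero', mul_zero', mul_zero']
  · change a * b * msucc x = a * (b * msucc x)
    have ih' : a * b * x = a * (b * x) := ih
    rw [mul_succ', mul_succ', mul_add', ih']
theorem mul_one' (a : M) : a * 1 = a := by
  change a * msucc 0 = a
  rw [mul_succ', mul_zero', zero_add']

instance : CommSemiring M where
  add_assoc := add_assoc'
  zero_add := zero_add'
  add_zero := add_zero'
  add_comm := add_comm'
  left_distrib := mul_add'
  right_distrib a b c := by rw [mul_comm', mul_add', mul_comm' c, mul_comm' c]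
  zero_mul := zero_mul'
  mul_zero := mul_zero'
  mul_assoc := mul_assoc'
  one_mul a := by rw [mul_comm', mul_one']
  mul_one := mul_one'
  mul_comm := mul_comm'
  nsmul := nsmulRec
  npow := npowRec

theorem msucc_eq (x : M) : msucc x = x + 1 := by
  change msucc x = x + msucc 0
  rw [add_succ', add_zero]

theorem total' (a x : M) : a ≤ x ∨ x ≤ a := by
  refine ind2 (P := fun M w => w 0 ≤ w 1 ∨ w 1 ≤ w 0) ?_ M a ?_ (fun x ih => ?_) x
  · repeat' first | apply Tmf.var | apply DF.le | apply DF.or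
  · exact Or.inr ((le_def' _ _).2 ⟨a, add_zero a⟩)
  · change a ≤ msucc x ∨ msucc x ≤ a
    have ih' : a ≤ x ∨ x ≤ a := ih
    simp only [le_def', msucc_eq] at *
    rcases ih' with ⟨z, hz⟩ | ⟨z, hz⟩
    · exact Or.inl ⟨z + 1, by rw [← hz]; ring⟩
    · rcases cases0 z with rfl | ⟨y, rfl⟩
      · exact Or.inl ⟨1, by rw [← hz]; ring⟩
      · exact Or.inr ⟨y, by rw [← hz, msucc_eq]; ring⟩

noncomputable instance : LinearOrder M where
  le_refl a := (le_def' _ _).2 ⟨0, zero_add a⟩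
  le_trans a b c := by
    simp only [le_def']
    rintro ⟨x, rfl⟩ ⟨y, rfl⟩
    exact ⟨y + x, by ring⟩
  le_antisymm a b := by
    simp only [le_def']
    rintro ⟨x, hx⟩ ⟨y, hy⟩
    have : (y + x) + a = 0 + a := by rw [zero_add, add_assoc, hx, hy]
    have := add_eq_zero' _ _ (add_cancel' _ _ _ this)
    rw [← hx, this, zero_add]
  le_total := total'
  toDecidableLE := Classical.decRel _

instance : IsOrderedAddMonoid M where
  add_le_add_left a b h c := by
    rw [le_def'] at *
    obtain ⟨x, rfl⟩ := h
    exact ⟨x, by ring⟩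
instance : IsOrderedCancelAddMonoid M where
  le_of_add_le_add_left a b c h := by
    rw [le_def'] at *
    obtain ⟨x, hx⟩ := h
    refine ⟨x, add_cancel' _ _ a ?_⟩
    rw [add_assoc, add_comm b a, hx, add_comm]
instance : CanonicallyOrderedAdd M where
  exists_add_of_le {a b} h := by
    obtain ⟨x, hx⟩ := (le_def' _ _).1 h
    exact ⟨x, by rw [← hx, add_comm]⟩
  le_self_add a b := (le_def' _ _).2 ⟨b, add_comm _ _⟩
  le_add_self a b := (le_def' _ _).2 ⟨b, rfl⟩

theorem zero_ne_one' : (0 : M) ≠ 1 := fun h => succ_ne (0 : M) h.symm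
instance : Nontrivial M := ⟨0, 1, zero_ne_one'⟩

theorem lt_succ_iff' (a b : M) : a < b + 1 ↔ a ≤ b := by
  constructor
  · intro h
    by_contra h'
    push Not at h'
    obtain ⟨x, hx⟩ := (le_def' _ _).1 h'.le
    rcases cases0 x with rfl | ⟨y, rfl⟩
    · rw [zero_add] at hx
      exact h'.ne hx
    · apply h.not_ge
      rw [← hx, msucc_eq]
      calc b + 1 ≤ y + (b + 1) := le_add_self
        _ = _ := by ring
  · intro h
    have : b < b + 1 := by
      refine lt_of_le_of_ne le_self_add fun h => ?_
      have : (0 : M) + b = 1 + b := by rw [zero_add, add_comm, ← h]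
      exact zero_ne_one' (add_cancel' _ _ _ this)
    exact h.trans_lt this

theorem pos_iff_succ (a : M) : 0 < a ↔ ∃ b, a = b + 1 := by
  constructor
  · intro h
    rcases cases0 a with rfl | ⟨y, rfl⟩
    · exact absurd h (lt_irrefl _)
    · exact ⟨y, msucc_eq y⟩
  · rintro ⟨b, rfl⟩
    exact (lt_succ_iff' _ _).2 (zero_le)

theorem mul_pos' {a b : M} (ha : 0 < a) (hb : 0 < b) : 0 < a * b := by
  obtain ⟨a, rfl⟩ := (pos_iff_succ _).1 ha
  obtain ⟨b, rfl⟩ := (pos_iff_succ _).1 hb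
  exact (pos_iff_succ _).2 ⟨a * b + a + b, by ring⟩
theorem mul_lt_mul_left' {a b c : M} (hc : 0 < c) (h : a < b) : c * a < c * b := by
  obtain ⟨x, rfl⟩ := (le_def' _ _).1 h.le
  have hx : 0 < x := by
    rcases cases0 x with rfl | ⟨y, rfl⟩
    · rw [zero_add] at h
      exact absurd h (lt_irrefl _)
    · exact (pos_iff_succ _).2 ⟨y, msucc_eq y⟩
  rw [mul_add]
  exact lt_add_of_pos_left _ (mul_pos' hc hx)
instance : IsStrictOrderedRing M where
  zero_le_one := zero_le
  mul_lt_mul_of_pos_left := fun _ hc _ _ h => mul_lt_mul_left' hc h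
  mul_lt_mul_of_pos_right := fun _ hc _ _ h => by
    simpa only [mul_comm] using mul_lt_mul_left' hc h

end alg


/-- Uniformly Δ₀-definable predicates. -/
def D0 {m : ℕ} (P : UP m) : Prop :=
  ∃ φ : LA.BoundedFormula Empty m, IsDelta0 φ ∧ ∀ M v, φ.Realize default v ↔ P M v

theorem lift_realize {M : Type} [LA.Structure M] {m : ℕ} (t : LA.Term (Empty ⊕ Fin m))
    (v : Fin m → M) (x : M) :
    (t.relabel (Sum.map id Fin.castSucc)).realize
      (Sum.elim (default : Empty → M) (Fin.snoc v x : Fin (m + 1) → M)) =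
    t.realize (Sum.elim default v) := by
  rw [Term.realize_relabel]
  congr 1
  funext i
  rcases i with i | i
  · exact i.elim
  · simp

theorem ball_realize {M : PM} {m : ℕ} (t : LA.Term (Empty ⊕ Fin m))
    (φ : LA.BoundedFormula Empty (m + 1)) (v : Fin m → M) :
    (∀' (leF (vT (Fin.last m)) (t.relabel (Sum.map id Fin.castSucc)) ⟹ φ)).Realize default v ↔
      ∀ x : M, x ≤ t.realize (Sum.elim default v) → φ.Realize default (Fin.snoc v x) := by
  rw [BoundedFormula.realize_all]
  refine forall_congr' fun x => ?_
  rw [BoundedFormula.realize_imp, r_leF, lift_realize, r_vT, Fin.snoc_last]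
  rfl
theorem bex_realize {M : PM} {m : ℕ} (t : LA.Term (Empty ⊕ Fin m))
    (φ : LA.BoundedFormula Empty (m + 1)) (v : Fin m → M) :
    (∃' (leF (vT (Fin.last m)) (t.relabel (Sum.map id Fin.castSucc)) ⊓ φ)).Realize default v ↔
      ∃ x : M, x ≤ t.realize (Sum.elim default v) ∧ φ.Realize default (Fin.snoc v x) := by
  rw [BoundedFormula.realize_ex]
  refine exists_congr fun x => ?_
  rw [BoundedFormula.realize_inf, r_leF, lift_realize, r_vT, Fin.snoc_last]
  rfl

theorem snoc_subst {M : Type} [LA.Structure M] {m k : ℕ} (s : Fin m → LA.Term (Empty ⊕ Fin k))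
    (v : Fin k → M) (x : M) :
    (fun i => ((Fin.snoc (fun j => (s j).relabel (Sum.map id Fin.castSucc)) (vT (Fin.last k)) :
      Fin (m + 1) → LA.Term (Empty ⊕ Fin (k + 1))) i).realize
      (Sum.elim (default : Empty → M) (Fin.snoc v x : Fin (k + 1) → M))) =
    (Fin.snoc (fun j => (s j).realize (Sum.elim (default : Empty → M) v)) x : Fin (m + 1) → M) := by
  funext i
  refine Fin.lastCases ?_ (fun j => ?_) i
  · simp
  · rw [Fin.snoc_castSucc, Fin.snoc_castSucc, lift_realize]

theorem subst_term {M : Type} [LA.Structure M] {m k : ℕ} (s : Fin m → LA.Term (Empty ⊕ Fin k))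
    (t : LA.Term (Empty ⊕ Fin m)) (v : Fin k → M) :
    (t.subst (Sum.elim Empty.elim s)).realize (Sum.elim (default : Empty → M) v) =
    t.realize (Sum.elim (default : Empty → M)
      (fun j => (s j).realize (Sum.elim (default : Empty → M) v))) := by
  rw [Term.realize_subst]
  congr 1
  funext i
  rcases i with i | i
  · exact i.elim
  · rfl

theorem IsDelta0.substE {m : ℕ} {φ : LA.BoundedFormula Empty m} (h : IsDelta0 φ) :
    ∀ {k : ℕ} (s : Fin m → LA.Term (Empty ⊕ Fin k)), ∃ ψ : LA.BoundedFormula Empty k,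
      IsDelta0 ψ ∧ ∀ (M : PM) (v : Fin k → M), ψ.Realize default v ↔
        φ.Realize default (fun i => (s i).realize (Sum.elim default v)) := by
  induction h with
  | falsum => exact fun s => ⟨⊥, .falsum, fun M v => Iff.rfl⟩
  | equal t u =>
    intro k s
    refine ⟨_, .equal (t.subst (Sum.elim Empty.elim s)) (u.subst (Sum.elim Empty.elim s)), ?_⟩
    intro M v
    rw [BoundedFormula.realize_bdEqual, BoundedFormula.realize_bdEqual, subst_term, subst_term]
  | le t u =>
    intro k s
    refine ⟨_, .le (t.subst (Sum.elim Empty.elim s)) (u.subst (Sum.elim Empty.elim s)), ?_⟩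
    intro M v
    rw [r_leF, r_leF, subst_term, subst_term]
  | imp h1 h2 ih1 ih2 =>
    intro k s
    obtain ⟨a, ha, ha'⟩ := ih1 s
    obtain ⟨b, hb, hb'⟩ := ih2 s
    refine ⟨_, .imp ha hb, fun M v => ?_⟩
    rw [BoundedFormula.realize_imp, BoundedFormula.realize_imp, ha', hb']
  | ball t h ih =>
    intro k s
    obtain ⟨a, ha, ha'⟩ := ih (Fin.snoc (fun j => (s j).relabel (Sum.map id Fin.castSucc))
      (vT (Fin.last k)))
    refine ⟨_, .ball (t.subst (Sum.elim Empty.elim s)) ha, fun M v => ?_⟩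
    rw [ball_realize, ball_realize, subst_term]
    refine forall_congr' fun x => imp_congr_right fun _ => ?_
    rw [ha', snoc_subst]
  | bex t h ih =>
    intro k s
    obtain ⟨a, ha, ha'⟩ := ih (Fin.snoc (fun j => (s j).relabel (Sum.map id Fin.castSucc))
      (vT (Fin.last k)))
    refine ⟨_, .bex (t.subst (Sum.elim Empty.elim s)) ha, fun M v => ?_⟩
    rw [bex_realize, bex_realize, subst_term]
    refine exists_congr fun x => and_congr_right fun _ => ?_
    rw [ha', snoc_subst]

theorem DF.substE {m : ℕ} (φ : LA.BoundedFormula Empty m) :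
    ∀ {k : ℕ} (s : Fin m → LA.Term (Empty ⊕ Fin k)), ∃ ψ : LA.BoundedFormula Empty k,
      ∀ (M : PM) (v : Fin k → M), ψ.Realize default v ↔
        φ.Realize default (fun i => (s i).realize (Sum.elim default v)) := by
  induction φ with
  | falsum => exact fun s => ⟨⊥, fun M v => Iff.rfl⟩
  | equal t u =>
    intro k s
    refine ⟨(t.subst (Sum.elim Empty.elim s)) =' (u.subst (Sum.elim Empty.elim s)), ?_⟩
    intro M v
    rw [BoundedFormula.realize_bdEqual, subst_term, subst_term]
    rfl
  | rel R ts =>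
    intro k s
    refine ⟨.rel R (fun i => (ts i).subst (Sum.elim Empty.elim s)), fun M v => ?_⟩
    simp only [BoundedFormula.Realize, subst_term]
  | imp _ _ ih1 ih2 =>
    intro k s
    obtain ⟨a, ha'⟩ := ih1 s
    obtain ⟨b, hb'⟩ := ih2 s
    refine ⟨a.imp b, fun M v => ?_⟩
    rw [BoundedFormula.realize_imp, BoundedFormula.realize_imp, ha', hb']
  | all _ ih =>
    intro k s
    obtain ⟨a, ha'⟩ := ih (Fin.snoc (fun j => (s j).relabel (Sum.map id Fin.castSucc))
      (vT (Fin.last k)))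
    refine ⟨∀' a, fun M v => ?_⟩
    rw [BoundedFormula.realize_all, BoundedFormula.realize_all]
    refine forall_congr' fun x => ?_
    rw [ha', snoc_subst]
theorem DF.subst {m k : ℕ} {P : UP m} (hP : DF P) {s : Fin m → ∀ M : PM, (Fin k → M) → M}
    (hs : ∀ i, Tmf (s i)) : DF (fun M v => P M (fun i => s i M v)) := by
  obtain ⟨φ, hφ⟩ := hP
  choose u hu using hs
  obtain ⟨ψ, hψ⟩ := DF.substE φ u
  refine ⟨ψ, fun M v => ?_⟩
  rw [hψ, hφ]
  simp only [hu]

theorem D0.df {m : ℕ} {P : UP m} (h : D0 P) : DF P := by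
  obtain ⟨φ, _, h⟩ := h
  exact ⟨φ, h⟩
theorem D0.eq {m : ℕ} {f g : ∀ M : PM, (Fin m → M) → M} (hf : Tmf f) (hg : Tmf g) :
    D0 (fun M v => f M v = g M v) := by
  obtain ⟨t, ht⟩ := hf
  obtain ⟨u, hu⟩ := hg
  exact ⟨t =' u, .equal _ _, fun M v => by rw [BoundedFormula.realize_bdEqual, ht, hu]⟩
theorem D0.le {m : ℕ} {f g : ∀ M : PM, (Fin m → M) → M} (hf : Tmf f) (hg : Tmf g) :
    D0 (fun M v => f M v ≤ g M v) := by
  obtain ⟨t, ht⟩ := hf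
  obtain ⟨u, hu⟩ := hg
  exact ⟨leF t u, .le _ _, fun M v => by rw [r_leF, ht, hu]; rfl⟩
theorem D0.false {m : ℕ} : D0 (m := m) (fun _ _ => False) := ⟨⊥, .falsum, fun _ _ => Iff.rfl⟩
theorem D0.imp {m : ℕ} {P Q : UP m} (hP : D0 P) (hQ : D0 Q) : D0 (fun M v => P M v → Q M v) := by
  obtain ⟨t, h1, ht⟩ := hP
  obtain ⟨u, h2, hu⟩ := hQ
  exact ⟨t.imp u, .imp h1 h2, fun M v => by rw [BoundedFormula.realize_imp, ht, hu]⟩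
theorem D0.not {m : ℕ} {P : UP m} (hP : D0 P) : D0 (fun M v => ¬ P M v) := hP.imp D0.false
theorem D0.or {m : ℕ} {P Q : UP m} (hP : D0 P) (hQ : D0 Q) : D0 (fun M v => P M v ∨ Q M v) := by
  have := hP.not.imp hQ
  simpa only [← or_iff_not_imp_left] using this
theorem D0.and {m : ℕ} {P Q : UP m} (hP : D0 P) (hQ : D0 Q) : D0 (fun M v => P M v ∧ Q M v) := by
  have := (hP.imp hQ.not).not
  simpa only [Classical.not_imp, not_not] using this
theorem D0.iff {m : ℕ} {P Q : UP m} (hP : D0 P) (hQ : D0 Q) : D0 (fun M v => P M v ↔ Q M v) := by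
  have := (hP.imp hQ).and (hQ.imp hP)
  simpa only [← iff_iff_implies_and_implies] using this
theorem D0.ball {m : ℕ} {t : ∀ M : PM, (Fin m → M) → M} {Q : ∀ M : PM, (Fin m → M) → M → Prop}
    (ht : Tmf t)
    (hQ : D0 (m := m + 1) (fun M w => Q M (fun i => w i.castSucc) (w (Fin.last m)))) :
    D0 (fun M v => ∀ x, x ≤ t M v → Q M v x) := by
  obtain ⟨a, h, ha⟩ := hQ
  obtain ⟨t', ht⟩ := ht
  refine ⟨_, .ball t' h, fun M v => ?_⟩
  rw [ball_realize, ht]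
  refine forall_congr' fun x => imp_congr_right fun _ => ?_
  rw [ha]
  beta_reduce
  rw [snoc_castSucc', Fin.snoc_last]
theorem D0.bex {m : ℕ} {t : ∀ M : PM, (Fin m → M) → M} {Q : ∀ M : PM, (Fin m → M) → M → Prop}
    (ht : Tmf t)
    (hQ : D0 (m := m + 1) (fun M w => Q M (fun i => w i.castSucc) (w (Fin.last m)))) :
    D0 (fun M v => ∃ x, x ≤ t M v ∧ Q M v x) := by
  obtain ⟨a, h, ha⟩ := hQ
  obtain ⟨t', ht⟩ := ht
  refine ⟨_, .bex t' h, fun M v => ?_⟩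
  rw [bex_realize, ht]
  refine exists_congr fun x => and_congr_right fun _ => ?_
  rw [ha]
  beta_reduce
  rw [snoc_castSucc', Fin.snoc_last]
theorem D0.lt {m : ℕ} {f g : ∀ M : PM, (Fin m → M) → M} (hf : Tmf f) (hg : Tmf g) :
    D0 (fun M v => f M v < g M v) := by
  simpa only [not_le] using (D0.le hg hf).not
theorem D0.subst {m k : ℕ} {P : UP m} (hP : D0 P) {s : Fin m → ∀ M : PM, (Fin k → M) → M}
    (hs : ∀ i, Tmf (s i)) : D0 (fun M v => P M (fun i => s i M v)) := by
  obtain ⟨φ, h, hφ⟩ := hP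
  choose u hu using hs
  obtain ⟨ψ, h', hψ⟩ := h.substE u
  refine ⟨ψ, h', fun M v => ?_⟩
  rw [hψ, hφ]
  simp only [hu]

/-- Classes of predicates with good closure properties. -/
structure Nice (C : ∀ {m : ℕ}, UP m → Prop) : Prop where
  df : ∀ {m : ℕ} {P : UP m}, C P → DF P
  d0 : ∀ {m : ℕ} {P : UP m}, D0 P → C P
  and : ∀ {m : ℕ} {P Q : UP m}, C P → C Q → C (fun M v => P M v ∧ Q M v)
  or : ∀ {m : ℕ} {P Q : UP m}, C P → C Q → C (fun M v => P M v ∨ Q M v)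
  ball : ∀ {m : ℕ} {t : ∀ M : PM, (Fin m → M) → M} {Q : ∀ M : PM, (Fin m → M) → M → Prop},
    Tmf t → C (m := m + 1) (fun M w => Q M (fun i => w i.castSucc) (w (Fin.last m))) →
    C (fun M v => ∀ x, x ≤ t M v → Q M v x)
  bex : ∀ {m : ℕ} {t : ∀ M : PM, (Fin m → M) → M} {Q : ∀ M : PM, (Fin m → M) → M → Prop},
    Tmf t → C (m := m + 1) (fun M w => Q M (fun i => w i.castSucc) (w (Fin.last m))) →
    C (fun M v => ∃ x, x ≤ t M v ∧ Q M v x)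
  subst : ∀ {m k : ℕ} {P : UP m}, C P → ∀ {s : Fin m → ∀ M : PM, (Fin k → M) → M},
    (∀ i, Tmf (s i)) → C (fun M v => P M (fun i => s i M v))

theorem nice_D0 : Nice D0 :=
  ⟨D0.df, id, D0.and, D0.or, D0.ball, D0.bex, D0.subst⟩

/-- Complements of the class. -/
def Dual (C : ∀ {m : ℕ}, UP m → Prop) {m : ℕ} (P : UP m) : Prop := C (fun M v => ¬ P M v)

theorem Nice.dual {C : ∀ {m : ℕ}, UP m → Prop} (h : Nice C) : Nice (Dual C) where
  df hP := by
    have := (h.df hP).not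
    simpa only [not_not] using this
  d0 hP := h.d0 hP.not
  and hP hQ := by
    have := h.or hP hQ
    simpa only [Dual, not_and_or] using this
  or hP hQ := by
    have := h.and hP hQ
    simpa only [Dual, not_or] using this
  ball {m t Q} ht hQ := by
    have := h.bex (Q := fun M v x => ¬ Q M v x) ht hQ
    simpa only [Dual, not_forall, exists_prop] using this
  bex {m t Q} ht hQ := by
    have := h.ball (Q := fun M v x => ¬ Q M v x) ht hQ
    simpa only [Dual, not_exists, not_and] using this
  subst hP := h.subst hP

theorem nice_DF : Nice DF where
  df := id
  d0 := D0.df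
  and := DF.and
  or := DF.or
  ball ht hQ := DF.all (DF.imp (DF.le (Tmf.var _) (ht.subst fun _ => Tmf.var _)) hQ)
  bex ht hQ := DF.ex (DF.and (DF.le (Tmf.var _) (ht.subst fun _ => Tmf.var _)) hQ)
  subst := DF.subst

section app
variable {C : ∀ {m : ℕ}, UP m → Prop}
theorem Nice.app1 (h : Nice C) {m k : ℕ} {Q : ∀ M : PM, (Fin m → M) → M → Prop}
    (hQ : C (m := m + 1) (fun M w => Q M (fun i => w i.castSucc) (w (Fin.last m))))
    {s : Fin m → ∀ M : PM, (Fin k → M) → M} (hs : ∀ i, Tmf (s i))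
    {f : ∀ M : PM, (Fin k → M) → M} (hf : Tmf f) :
    C (fun M v => Q M (fun i => s i M v) (f M v)) := by
  have := h.subst hQ (s := Fin.snoc (α := fun _ => ∀ M : PM, (Fin k → M) → M) s f) (fun i => by
    refine Fin.lastCases ?_ (fun j => ?_) i
    · simpa using hf
    · simpa using hs j)
  simpa only [Fin.snoc_castSucc, Fin.snoc_last] using this
theorem Nice.app2 (h : Nice C) {m k : ℕ} {Q : ∀ M : PM, (Fin m → M) → M → M → Prop}
    (hQ : C (m := m + 2) (fun M w => Q M (fun i => w i.castSucc.castSucc)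
      (w (Fin.last m).castSucc) (w (Fin.last (m + 1)))))
    {s : Fin m → ∀ M : PM, (Fin k → M) → M} (hs : ∀ i, Tmf (s i))
    {f g : ∀ M : PM, (Fin k → M) → M} (hf : Tmf f) (hg : Tmf g) :
    C (fun M v => Q M (fun i => s i M v) (f M v) (g M v)) := by
  have := h.subst hQ (s := Fin.snoc (α := fun _ => ∀ M : PM, (Fin k → M) → M)
    (Fin.snoc (α := fun _ => ∀ M : PM, (Fin k → M) → M) s f) g) (fun i => by
    refine Fin.lastCases ?_ (fun j => ?_) i
    · simpa using hg
    · refine Fin.lastCases ?_ (fun j => ?_) j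
      · simpa using hf
      · simpa using hs j)
  simpa only [Fin.snoc_castSucc, Fin.snoc_last] using this
end app

/-- Collection. -/
theorem collection {m : ℕ} {Q : ∀ M : PM, (Fin m → M) → M → M → Prop}
    (hQ : DF (m := m + 2) (fun M w => Q M (fun i => w i.castSucc.castSucc)
      (w (Fin.last m).castSucc) (w (Fin.last (m + 1))))) {M : PM} (v : Fin m → M) (t : M)
    (h : ∀ y, y ≤ t → ∃ x, Q M v y x) : ∃ b, ∀ y, y ≤ t → ∃ x, x ≤ b ∧ Q M v y x := by
  have hd : DF (m := m + 1) (fun M w => ((∀ y, y ≤ w (Fin.last m) →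
      ∃ x, Q M (fun i => w i.castSucc) y x) → ∃ b, ∀ y, y ≤ w (Fin.last m) →
      ∃ x, x ≤ b ∧ Q M (fun i => w i.castSucc) y x)) := by
    apply DF.imp
    · refine DF.all (DF.imp (DF.le (Tmf.var _) (Tmf.var _)) (DF.ex ?_))
      exact nice_DF.app2 hQ (fun i => Tmf.var _) (Tmf.var _) (Tmf.var _)
    · refine DF.ex (DF.all (DF.imp (DF.le (Tmf.var _) (Tmf.var _)) (DF.ex (DF.and ?_ ?_))))
      · exact DF.le (Tmf.var _) (Tmf.var _)
      · exact nice_DF.app2 hQ (fun i => Tmf.var _) (Tmf.var _) (Tmf.var _)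
  have := ind hd M v ?_ ?_ t
  · simp only [snoc_castSucc', Fin.snoc_last] at this
    exact this h
  · simp only [snoc_castSucc', Fin.snoc_last]
    intro h
    obtain ⟨x, hx⟩ := h 0 le_rfl
    refine ⟨x, fun y hy => ⟨x, le_rfl, ?_⟩⟩
    rwa [le_antisymm hy zero_le]
  · simp only [snoc_castSucc', Fin.snoc_last, msucc_eq]
    intro x ih h
    obtain ⟨b, hb⟩ := ih (fun y hy => h y (hy.trans le_self_add))
    obtain ⟨z, hz⟩ := h _ le_rfl
    refine ⟨max b z, fun y hy => ?_⟩
    rcases hy.lt_or_eq with hy | rfl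
    · obtain ⟨x', h1, h2⟩ := hb y ((lt_succ_iff' _ _).1 hy)
      exact ⟨x', h1.trans (le_max_left _ _), h2⟩
    · exact ⟨z, le_max_right _ _, hz⟩

/-- Projections of the class. -/
def Ex (C : ∀ {m : ℕ}, UP m → Prop) {m : ℕ} (P : UP m) : Prop :=
  ∃ Q : ∀ M : PM, (Fin m → M) → M → Prop,
    C (m := m + 1) (fun M w => Q M (fun i => w i.castSucc) (w (Fin.last m))) ∧
    ∀ M v, P M v ↔ ∃ x, Q M v x

section Ex
variable {C : ∀ {m : ℕ}, UP m → Prop}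
theorem Nice.of_C (h : Nice C) {m : ℕ} {P : UP m} (hP : C P) : Ex C P :=
  ⟨fun M v _ => P M v, h.subst hP (fun i => Tmf.var _), fun M v => by simp⟩
theorem Nice.ex_ex (h : Nice C) {m : ℕ} {Q : ∀ M : PM, (Fin m → M) → M → Prop}
    (hQ : Ex C (m := m + 1) (fun M w => Q M (fun i => w i.castSucc) (w (Fin.last m)))) :
    Ex C (fun M v => ∃ x, Q M v x) := by
  obtain ⟨R, hR, e⟩ := hQ
  refine ⟨fun M v z => ∃ x, x ≤ z ∧ ∃ y, y ≤ z ∧ R M (Fin.snoc v x) y, ?_, fun M v => ?_⟩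
  · refine h.bex (Tmf.var _) (h.bex (Tmf.var _) (h.app1 (Q := R) hR (s := fun i M w =>
      (Fin.snoc (fun i : Fin m => w i.castSucc.castSucc.castSucc)
        (w (Fin.last (m + 1)).castSucc) : Fin (m + 1) → M) i) (fun i => ?_) (Tmf.var _)))
    refine Fin.lastCases ?_ (fun j => ?_) i
    · simp only [Fin.snoc_last]
      exact Tmf.var _
    · simp only [Fin.snoc_castSucc]
      exact Tmf.var _
  · have e' : ∀ x, Q M v x ↔ ∃ y, R M (Fin.snoc v x) y := by
      intro x
      rw [← e]
      simp only [snoc_castSucc', Fin.snoc_last]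
    simp only [e']
    constructor
    · rintro ⟨x, y, hy⟩
      exact ⟨max x y, x, le_max_left _ _, y, le_max_right _ _, hy⟩
    · rintro ⟨_, x, _, y, _, hy⟩
      exact ⟨x, y, hy⟩
theorem Nice.ex_and (h : Nice C) : ∀ {m : ℕ} {P Q : UP m}, Ex C P → Ex C Q →
    Ex C (fun M v => P M v ∧ Q M v) := by
    rintro m P Q ⟨P', hP, eP⟩ ⟨Q', hQ, eQ⟩
    refine ⟨fun M v z => (∃ x, x ≤ z ∧ P' M v x) ∧ (∃ x, x ≤ z ∧ Q' M v x), ?_, fun M v => ?_⟩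
    · refine h.and (h.bex (Tmf.var _) ?_) (h.bex (Tmf.var _) ?_)
      · exact h.app1 hP (fun _ => Tmf.var _) (Tmf.var _)
      · exact h.app1 hQ (fun _ => Tmf.var _) (Tmf.var _)
    · beta_reduce
      rw [eP, eQ]
      constructor
      · rintro ⟨⟨x, hx⟩, ⟨y, hy⟩⟩
        exact ⟨max x y, ⟨x, le_max_left _ _, hx⟩, ⟨y, le_max_right _ _, hy⟩⟩
      · rintro ⟨_, ⟨x, _, hx⟩, ⟨y, _, hy⟩⟩
        exact ⟨⟨x, hx⟩, ⟨y, hy⟩⟩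
theorem Nice.ex_nice (h : Nice C) : Nice (Ex C) where
  df := by
    rintro m P ⟨Q, hQ, e⟩
    obtain ⟨φ, hφ⟩ := DF.ex (h.df hQ)
    exact ⟨φ, fun M v => by rw [hφ, e]⟩
  d0 hP := h.of_C (h.d0 hP)
  and := h.ex_and
  or := by
    rintro m P Q ⟨P', hP, eP⟩ ⟨Q', hQ, eQ⟩
    refine ⟨fun M v z => P' M v z ∨ Q' M v z, h.or hP hQ, fun M v => ?_⟩
    beta_reduce
    rw [eP, eQ, exists_or]
  ball := by
    rintro m t Q ht ⟨R, hR, e⟩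
    have hR2 : C (m := m + 2) (fun M w => R M (Fin.snoc (fun i => w i.castSucc.castSucc)
      (w (Fin.last m).castSucc)) (w (Fin.last (m + 1)))) := by
      refine h.app1 (Q := R) hR (s := fun i M w =>
        (Fin.snoc (fun i : Fin m => w i.castSucc.castSucc)
        (w (Fin.last m).castSucc) : Fin (m + 1) → M) i) (fun i => ?_) (Tmf.var _)
      refine Fin.lastCases ?_ (fun j => ?_) i
      · simp only [Fin.snoc_last]
        exact Tmf.var _
      · simp only [Fin.snoc_castSucc]
        exact Tmf.var _
    refine ⟨fun M v b => ∀ y, y ≤ t M v → ∃ x, x ≤ b ∧ R M (Fin.snoc v y) x, ?_, fun M v => ?_⟩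
    · refine h.ball (ht.subst fun _ => Tmf.var _) (h.bex (Tmf.var _) ?_)
      exact h.app2 (Q := fun M v y x => R M (Fin.snoc v y) x) hR2 (fun _ => Tmf.var _)
        (Tmf.var _) (Tmf.var _)
    · have e' : ∀ x, Q M v x ↔ ∃ y, R M (Fin.snoc v x) y := by
        intro x
        rw [← e]
        simp only [snoc_castSucc', Fin.snoc_last]
      simp only [e']
      constructor
      · exact collection (Q := fun M v y x => R M (Fin.snoc v y) x) (h.df hR2) v (t M v)
      · rintro ⟨b, hb⟩ y hy
        obtain ⟨x, _, hx⟩ := hb y hy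
        exact ⟨x, hx⟩
  bex {m t Q} ht hQ := by
    have hle : Ex C (m := m + 1) (fun M w => w (Fin.last m) ≤ t M (fun i => w i.castSucc)) :=
      h.of_C (h.d0 (D0.le (Tmf.var _) (ht.subst fun _ => Tmf.var _)))
    exact h.ex_ex (h.ex_and hle hQ)
  subst := by
    rintro m k P ⟨Q, hQ, e⟩ s hs
    refine ⟨fun M v x => Q M (fun i => s i M v) x, ?_, fun M v => e _ _⟩
    exact h.app1 hQ (s := fun i M w => s i M (fun j => w j.castSucc))
      (fun i => (hs i).subst (fun _ => Tmf.var _)) (Tmf.var _)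
end Ex

/-- The (uniform, semantic) arithmetical hierarchy. -/
def Sg : ℕ → ∀ {m : ℕ}, UP m → Prop
  | 0 => D0
  | k + 1 => Ex (Dual (Sg k))
abbrev Pp (k : ℕ) {m : ℕ} (P : UP m) : Prop := Dual (Sg k) P

theorem nice_Sg : ∀ k, Nice (Sg k)
  | 0 => nice_D0
  | k + 1 => (nice_Sg k).dual.ex_nice
theorem nice_Pp (k : ℕ) : Nice (Pp k) := (nice_Sg k).dual
theorem Sg.ex {k m : ℕ} {Q : ∀ M : PM, (Fin m → M) → M → Prop}
    (hQ : Sg (k + 1) (m := m + 1) (fun M w => Q M (fun i => w i.castSucc) (w (Fin.last m)))) :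
    Sg (k + 1) (fun M v => ∃ x, Q M v x) := (nice_Pp k).ex_ex hQ
theorem Pp.sg_succ {k m : ℕ} {P : UP m} (hP : Pp k P) : Sg (k + 1) P := (nice_Pp k).of_C hP
theorem Sg.pp_succ {k m : ℕ} {P : UP m} (hP : Sg k P) : Pp (k + 1) P := by
  apply Pp.sg_succ
  simpa only [Pp, Dual, not_not] using hP
theorem Pp.all {k m : ℕ} {Q : ∀ M : PM, (Fin m → M) → M → Prop}
    (hQ : Pp (k + 1) (m := m + 1) (fun M w => Q M (fun i => w i.castSucc) (w (Fin.last m)))) :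
    Pp (k + 1) (fun M v => ∀ x, Q M v x) := by
  have := Sg.ex (Q := fun M v x => ¬ Q M v x) hQ
  simpa only [Pp, Dual, not_forall] using this
theorem Sg.not {k m : ℕ} {P : UP m} (hP : Sg k P) : Pp k (fun M v => ¬ P M v) := by
  simpa only [Pp, Dual, not_not] using hP

mutual
theorem IsSigmaFml.sg : ∀ {k m : ℕ} {φ : LA.BoundedFormula Empty m}, IsSigmaFml k φ →
    Sg k (fun M v => φ.Realize default v)
  | _, _, _, .ofDelta0 h => ⟨_, h, fun _ _ => Iff.rfl⟩
  | _, _, _, .ofPi h => Pp.sg_succ (IsPiFml.pp h)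
  | _, _, _, .ex (k := k) (m := m) (φ := φ) h => by
    have := IsSigmaFml.sg h
    have := Sg.ex (k := k) (Q := fun M v x => φ.Realize default (Fin.snoc v x)) (by
      convert this using 4 with M w
      exact Fin.snoc_init_self w)
    simpa only [BoundedFormula.realize_ex] using this
theorem IsPiFml.pp : ∀ {k m : ℕ} {φ : LA.BoundedFormula Empty m}, IsPiFml k φ →
    Pp k (fun M v => φ.Realize default v)
  | _, _, _, .ofDelta0 h => D0.not ⟨_, h, fun _ _ => Iff.rfl⟩
  | _, _, _, .ofSigma h => Sg.pp_succ (IsSigmaFml.sg h)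
  | _, _, _, .all (k := k) (m := m) (φ := φ) h => by
    have := IsPiFml.pp h
    have := Pp.all (k := k) (Q := fun M v x => φ.Realize default (Fin.snoc v x)) (by
      convert this using 4 with M w
      exact Fin.snoc_init_self w)
    simpa only [BoundedFormula.realize_all] using this
end

theorem fml_of (k : ℕ) : ∀ {m : ℕ} {P : UP m},
    (Sg k P → ∃ φ : LA.BoundedFormula Empty m, IsSigmaFml k φ ∧ ∀ M v, φ.Realize default v ↔ P M v) ∧
    (Pp k P → ∃ φ : LA.BoundedFormula Empty m, IsPiFml k φ ∧ ∀ M v, φ.Realize default v ↔ P M v) := by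
  induction k with
  | zero =>
    intro m P
    refine ⟨fun ⟨φ, h, e⟩ => ⟨φ, .ofDelta0 h, e⟩, fun h => ?_⟩
    obtain ⟨φ, h, e⟩ := D0.not h
    simp only [not_not] at e
    exact ⟨φ, .ofDelta0 h, e⟩
  | succ k ih =>
    intro m P
    constructor
    · rintro ⟨Q, hQ, e⟩
      obtain ⟨φ, h, e'⟩ := ih.2 hQ
      refine ⟨∃' φ, .ex (.ofPi h), fun M v => ?_⟩
      rw [BoundedFormula.realize_ex, e]
      simp only [e', snoc_castSucc', Fin.snoc_last]
    · rintro ⟨Q, hQ, e⟩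
      obtain ⟨φ, h, e'⟩ := (ih (P := fun M w => ¬ Q M (fun i => w i.castSucc) (w (Fin.last m)))).1 hQ
      refine ⟨∀' φ, .all (.ofSigma h), fun M v => ?_⟩
      have e2 := not_congr (e M v)
      rw [not_not] at e2
      rw [BoundedFormula.realize_all, e2, not_exists]
      simp only [e', snoc_castSucc', Fin.snoc_last]


section pairing
variable {M : PM}
/-- Polynomial pairing. -/
def pr {R : Type} [Add R] [Mul R] (x y : R) : R := (x + y) * (x + y) + x

theorem Tmf.pr {m : ℕ} {f g : ∀ M : PM, (Fin m → M) → M} (hf : Tmf f) (hg : Tmf g) :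
    Tmf (fun M v => Guaspari.pr (f M v) (g M v)) :=
  Tmf.add (Tmf.mul (Tmf.add hf hg) (Tmf.add hf hg)) hf

theorem le_sq' (x : M) : x ≤ x * x := by
  rcases cases0 x with rfl | ⟨y, rfl⟩
  · simp
  · rw [msucc_eq]
    calc y + 1 ≤ (y + 1) + (y * y + y) := le_self_add
      _ = _ := by ring
theorem le_pr_left (x y : M) : x ≤ pr x y := le_add_self
theorem le_pr_right (x y : M) : y ≤ pr x y :=
  (le_add_self (a := y) (b := x)).trans ((le_sq' _).trans le_self_add)
theorem succ_le' {a b : M} (h : a < b) : a + 1 ≤ b := by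
  by_contra h'
  exact absurd ((lt_succ_iff' _ _).1 (not_le.1 h')) (not_le.2 h)
theorem pr_lt_aux {x y x' y' : M} (h : x + y < x' + y') : pr x y < pr x' y' := by
  unfold pr
  have h1 := succ_le' h
  calc (x + y) * (x + y) + x ≤ (x + y) * (x + y) + (x + y) := by gcongr; exact le_self_add
    _ < (x + y) * (x + y) + (x + y) + ((x + y) + 1) :=
      lt_add_of_pos_right _ ((lt_succ_iff' _ _).2 zero_le)
    _ = (x + y + 1) * (x + y + 1) := by ring
    _ ≤ (x' + y') * (x' + y') := by gcongr
    _ ≤ _ := le_self_add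
theorem pr_inj {x y x' y' : M} : pr x y = pr x' y' ↔ x = x' ∧ y = y' := by
  constructor
  · intro h
    rcases lt_trichotomy (x + y) (x' + y') with h1 | h1 | h1
    · exact absurd h (pr_lt_aux h1).ne
    · unfold pr at h
      rw [h1] at h
      have := add_left_cancel h
      subst this
      exact ⟨rfl, add_left_cancel h1⟩
    · exact absurd h.symm (pr_lt_aux h1).ne
  · rintro ⟨rfl, rfl⟩
    rfl
theorem cast_pr (x y : ℕ) : ((pr x y : ℕ) : M) = pr (x : M) (y : M) := by
  unfold pr
  push_cast
  rfl
end pairing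

section cast
variable {M : PM}
theorem cast_le_iff (a b : ℕ) : (a : M) ≤ b ↔ a ≤ b := Nat.cast_le
theorem of_le_cast (y : M) (n : ℕ) (h : y ≤ n) : ∃ i : ℕ, i ≤ n ∧ y = i := by
  induction n with
  | zero => exact ⟨0, le_rfl, le_antisymm h (by simp)⟩
  | succ n ih =>
    rcases h.lt_or_eq with h | rfl
    · push_cast at h
      obtain ⟨i, hi, e⟩ := ih ((lt_succ_iff' _ _).1 h)
      exact ⟨i, hi.trans (Nat.le_succ _), e⟩
    · exact ⟨n + 1, le_rfl, rfl⟩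

theorem Tmf.cast {m : ℕ} (n : ℕ) : Tmf (m := m) (fun M _ => (n : M)) := by
  induction n with
  | zero => simpa using Tmf.zero
  | succ n ih =>
    push_cast
    exact ih.add Tmf.one

theorem term_cast {m : ℕ} (t : LA.Term (Empty ⊕ Fin m)) : ∃ f : (Fin m → ℕ) → ℕ,
    ∀ (M : PM) (v : Fin m → ℕ), t.realize (Sum.elim default (fun i => (v i : M))) = f v := by
  induction t with
  | var i =>
    rcases i with i | i
    · exact i.elim
    · exact ⟨fun v => v i, fun M v => rfl⟩
  | @func l f ts ih =>
    choose g hg using ih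
    match l, f, ts, g, hg with
    | 0, f, ts, g, hg =>
      refine ⟨fun _ => 0, fun M v => ?_⟩
      rw [Nat.cast_zero, Term.realize]
      change _ = mzero M
      unfold mzero
      congr 1
      funext i
      exact i.elim0
    | 1, f, ts, g, hg =>
      refine ⟨fun v => g 0 v + 1, fun M v => ?_⟩
      rw [Nat.cast_add, Nat.cast_one, ← msucc_eq, ← hg, Term.realize]
      unfold msucc
      congr 1
      funext i
      fin_cases i
      rfl
    | 2, false, ts, g, hg =>
      refine ⟨fun v => g 0 v + g 1 v, fun M v => ?_⟩
      rw [Nat.cast_add, ← hg, ← hg]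
      change Structure.funMap _ _ = madd _ _
      unfold madd
      congr 1
      funext i
      fin_cases i <;> rfl
    | 2, true, ts, g, hg =>
      refine ⟨fun v => g 0 v * g 1 v, fun M v => ?_⟩
      rw [Nat.cast_mul, ← hg, ← hg]
      change Structure.funMap _ _ = mmul _ _
      unfold mmul
      congr 1
      funext i
      fin_cases i <;> rfl

theorem cast_snoc {m : ℕ} (v : Fin m → ℕ) (x : ℕ) :
    (Fin.snoc (fun i => (v i : M)) (x : M) : Fin (m + 1) → M) =
      fun i => (((Fin.snoc v x : Fin (m + 1) → ℕ) i : ℕ) : M) := by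
  funext i
  refine Fin.lastCases ?_ (fun j => ?_) i
  · simp
  · simp

theorem IsDelta0.abs {m : ℕ} {φ : LA.BoundedFormula Empty m} (h : IsDelta0 φ) :
    ∃ p : (Fin m → ℕ) → Prop, ∀ (M : PM) (v : Fin m → ℕ),
      φ.Realize default (fun i => (v i : M)) ↔ p v := by
  induction h with
  | falsum => exact ⟨fun _ => False, fun _ _ => Iff.rfl⟩
  | equal t u =>
    obtain ⟨f, hf⟩ := term_cast t
    obtain ⟨g, hg⟩ := term_cast u
    refine ⟨fun v => f v = g v, fun M v => ?_⟩
    rw [BoundedFormula.realize_bdEqual, hf, hg, Nat.cast_inj]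
  | le t u =>
    obtain ⟨f, hf⟩ := term_cast t
    obtain ⟨g, hg⟩ := term_cast u
    refine ⟨fun v => f v ≤ g v, fun M v => ?_⟩
    rw [r_leF, hf, hg]
    exact cast_le_iff (M := M) _ _
  | imp _ _ ih1 ih2 =>
    obtain ⟨p, hp⟩ := ih1
    obtain ⟨q, hq⟩ := ih2
    refine ⟨fun v => p v → q v, fun M v => ?_⟩
    rw [BoundedFormula.realize_imp, hp, hq]
  | ball t _ ih =>
    obtain ⟨f, hf⟩ := term_cast t
    obtain ⟨p, hp⟩ := ih
    refine ⟨fun v => ∀ x, x ≤ f v → p (Fin.snoc v x), fun M v => ?_⟩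
    rw [ball_realize, hf]
    constructor
    · intro h x hx
      have := h x (Nat.cast_le.2 hx)
      rwa [cast_snoc, hp] at this
    · intro h x hx
      obtain ⟨i, hi, rfl⟩ := of_le_cast _ _ hx
      rw [cast_snoc, hp]
      exact h i hi
  | bex t _ ih =>
    obtain ⟨f, hf⟩ := term_cast t
    obtain ⟨p, hp⟩ := ih
    refine ⟨fun v => ∃ x, x ≤ f v ∧ p (Fin.snoc v x), fun M v => ?_⟩
    rw [bex_realize, hf]
    constructor
    · rintro ⟨x, hx, h⟩
      obtain ⟨i, hi, rfl⟩ := of_le_cast _ _ hx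
      rw [cast_snoc, hp] at h
      exact ⟨i, hi, h⟩
    · rintro ⟨x, hx, h⟩
      refine ⟨x, Nat.cast_le.2 hx, ?_⟩
      rwa [cast_snoc, hp]
theorem D0.abs {m : ℕ} {P : UP m} (h : D0 P) (M N : PM) (v : Fin m → ℕ) :
    P M (fun i => (v i : M)) ↔ P N (fun i => (v i : N)) := by
  obtain ⟨φ, h, e⟩ := h
  obtain ⟨p, hp⟩ := h.abs
  rw [← e, ← e, hp, hp]
end cast

section coding
variable {M : PM}

theorem dvd_cancel {d a b : M} (hd : 0 < d) (h1 : d ∣ a) (h2 : d ∣ a + b) : d ∣ b := by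
  obtain ⟨x, rfl⟩ := h1
  obtain ⟨y, hy⟩ := h2
  have hxy : x ≤ y := by
    by_contra h
    have := mul_lt_mul_left' hd (not_le.1 h)
    rw [← hy] at this
    exact absurd this (not_lt.2 le_self_add)
  obtain ⟨z, rfl⟩ := (le_def' _ _).1 hxy
  refine ⟨z, ?_⟩
  have : d * x + b = d * x + d * z := by rw [hy]; ring
  exact add_left_cancel this

theorem cop1 {m i c : M} (h : (1 + (i + 1) * m) ∣ c * m) : (1 + (i + 1) * m) ∣ c := by
  have hd : 0 < 1 + (i + 1) * m := lt_of_lt_of_le zero_lt_one le_self_add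
  refine dvd_cancel (a := c * m * (i + 1)) hd (h.mul_right _) ?_
  have : c * m * (i + 1) + c = (1 + (i + 1) * m) * c := by ring
  rw [this]
  exact dvd_mul_right _ _
theorem cop2 {m i k c : M} (hk : k ∣ m) (h : (1 + (i + 1) * m) ∣ c * (k * m)) :
    (1 + (i + 1) * m) ∣ c := by
  rw [← mul_assoc] at h
  have h1 := cop1 h
  obtain ⟨r, hr⟩ := hk
  apply cop1
  have := h1.mul_right r
  rwa [mul_assoc, ← hr] at this
theorem cop3 {m b i j c : M} (hm : ∀ k, 0 < k → k < b → k ∣ m) (hi : i < b) (hj : j < b)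
    (hij : i ≠ j) (h : (1 + (i + 1) * m) ∣ c * (1 + (j + 1) * m)) : (1 + (i + 1) * m) ∣ c := by
  have hd : 0 < 1 + (i + 1) * m := lt_of_lt_of_le zero_lt_one le_self_add
  rcases lt_or_gt_of_ne hij with hlt | hlt
  · obtain ⟨k, rfl⟩ := (le_def' _ _).1 hlt.le
    have hk : 0 < k := by
      rcases (zero_le : (0 : M) ≤ k).lt_or_eq with h | rfl
      · exact h
      · simp at hlt
    refine cop2 (hm k hk (lt_of_le_of_lt le_self_add hj)) ?_
    refine dvd_cancel (a := c * (1 + (i + 1) * m)) hd (dvd_mul_left _ _) ?_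
    convert h using 1
    ring
  · obtain ⟨k, rfl⟩ := (le_def' _ _).1 hlt.le
    have hk : 0 < k := by
      rcases (zero_le : (0 : M) ≤ k).lt_or_eq with h | rfl
      · exact h
      · simp at hlt
    refine cop2 (hm k hk (lt_of_le_of_lt le_self_add hi)) ?_
    refine dvd_cancel hd h ?_
    have : c * (1 + (j + 1) * m) + c * (k * m) = (1 + (k + j + 1) * m) * c := by ring
    rw [this]
    exact dvd_mul_right _ _

theorem exists_mult (b : M) : ∃ m : M, 0 < m ∧ ∀ k, 0 < k → k < b → k ∣ m := by
  have := ind1 (P := fun M w => ∃ m : M, ¬ m ≤ 0 ∧ ∀ k, ¬ k ≤ 0 → ¬ w 0 ≤ k → ∃ q, m = k * q) ?_ M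
    ?_ ?_ b
  · obtain ⟨m, h1, h2⟩ := this
    exact ⟨m, not_le.1 h1, fun k h h' => h2 k (not_le.2 h) (not_le.2 h')⟩
  · repeat' first | apply Tmf.var | apply Tmf.zero | apply Tmf.mul | apply DF.eq | apply DF.le | apply DF.not | apply DF.and | apply DF.ex | apply DF.all | apply DF.imp
  · refine ⟨1, by simp, fun k _ h => absurd zero_le h⟩
  · rintro x ⟨m, hm, h⟩
    change ∃ m : M, ¬ m ≤ 0 ∧ ∀ k, ¬ k ≤ 0 → ¬ msucc x ≤ k → ∃ q, m = k * q
    rcases cases0 x with rfl | ⟨y, rfl⟩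
    · refine ⟨1, by simp, fun k h1 h => ?_⟩
      rw [msucc_eq, not_le, lt_succ_iff'] at h
      exact absurd h h1
    · refine ⟨m * msucc y, ?_, fun k h1 h2 => ?_⟩
      · rw [not_le] at *
        exact mul_pos' hm ((pos_iff_succ _).2 ⟨y, msucc_eq y⟩)
      · rw [msucc_eq (msucc y), not_le, lt_succ_iff'] at h2
        rcases h2.lt_or_eq with h2 | rfl
        · obtain ⟨q, rfl⟩ := h k h1 (not_le.2 h2)
          exact ⟨q * msucc y, by ring⟩
        · exact ⟨m, by ring⟩

/-- `i` belongs to the finite set coded by `c`. -/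
def mem (i c : M) : Prop := ∃ c0, c0 ≤ c ∧ ∃ m, m ≤ c ∧ ∃ l, l ≤ c ∧
  (c = pr (pr c0 m) l ∧ i < l ∧ ∃ q, q ≤ c0 ∧ c0 = (1 + (i + 1) * m) * q)

theorem mem_pr (i c0 m l : M) : mem i (pr (pr c0 m) l) ↔ i < l ∧ (1 + (i + 1) * m) ∣ c0 := by
  constructor
  · rintro ⟨a, _, b, _, c, _, h, hi, q, _, e⟩
    rw [pr_inj, pr_inj] at h
    obtain ⟨⟨rfl, rfl⟩, rfl⟩ := h
    exact ⟨hi, q, e⟩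
  · rintro ⟨hi, q, e⟩
    refine ⟨c0, (le_pr_left _ _).trans (le_pr_left _ _), m, (le_pr_right _ _).trans (le_pr_left _ _),
      l, le_pr_right _ _, rfl, hi, q, ?_, e⟩
    rw [e]
    exact le_mul_of_one_le_left zero_le le_self_add
theorem mem_lt {i c : M} (h : mem i c) : i < c := by
  obtain ⟨a, _, b, _, l, hl, h, hi, _⟩ := h
  exact hi.trans_le hl

theorem D0.mem {m : ℕ} {f g : ∀ M : PM, (Fin m → M) → M} (hf : Tmf f) (hg : Tmf g) :
    D0 (fun M v => Guaspari.mem (f M v) (g M v)) := by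
  have : D0 (m := 2) (fun M v => Guaspari.mem (v 0) (v 1)) := by
    unfold Guaspari.mem
    repeat' first | apply Tmf.var | apply Tmf.one | apply Tmf.mul | apply Tmf.add | apply Tmf.pr | apply D0.eq | apply D0.lt | apply D0.bex | apply D0.and
  have := this.subst (s := ![f, g]) (fun i => by fin_cases i; exacts [hf, hg])
  simpa using this

theorem comprehension {k : ℕ} {P : ∀ M : PM, (Fin k → M) → M → Prop}
    (hP : DF (m := k + 1) (fun M w => P M (fun i => w i.castSucc) (w (Fin.last k))))
    (v : Fin k → M) (b : M) : ∃ c, ∀ i, mem i c ↔ i < b ∧ P M v i := by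
  obtain ⟨m, hm, hmb⟩ := exists_mult b
  have hd : DF (m := k + 2 + 1) (fun M w => ∃ c0, ∀ i, i < w (Fin.last k).castSucc.castSucc →
      ((∃ q, c0 = (1 + (i + 1) * w (Fin.last (k + 1)).castSucc) * q) ↔
        (i < w (Fin.last (k + 2)) ∧ P M (fun i => w i.castSucc.castSucc.castSucc) i))) := by
    refine DF.ex (DF.all (DF.imp (D0.df (D0.lt (Tmf.var _) (Tmf.var _)))
      (DF.iff (DF.ex (DF.eq (Tmf.var _) ?_)) (DF.and (D0.df (D0.lt (Tmf.var _) (Tmf.var _))) ?_))))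
    · repeat' first | apply Tmf.var | apply Tmf.one | apply Tmf.mul | apply Tmf.add
    · exact nice_DF.app1 hP (fun _ => Tmf.var _) (Tmf.var _)
  have key := ind hd M (Fin.snoc (Fin.snoc v b : Fin (k + 1) → M) m) ?_ ?_ b
  · simp only [Fin.snoc_castSucc, Fin.snoc_last] at key
    obtain ⟨c0, hc⟩ := key
    refine ⟨pr (pr c0 m) b, fun i => ?_⟩
    rw [mem_pr]
    refine and_congr_right fun hi => ?_
    rw [show P M v i ↔ i < b ∧ P M v i from (and_iff_right hi).symm]
    exact hc i hi
  · simp only [Fin.snoc_castSucc, Fin.snoc_last]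
    refine ⟨1, fun i hi => ⟨?_, fun h => absurd h.1 (not_lt.2 zero_le)⟩⟩
    rintro ⟨q, hq⟩
    exfalso
    rcases cases0 q with rfl | ⟨q, rfl⟩
    · simp at hq
    · have h1 : (1 : M) < 1 + (i + 1) * m :=
        lt_add_of_pos_right _ (mul_pos' ((lt_succ_iff' _ _).2 zero_le) hm)
      have h2 : 1 + (i + 1) * m ≤ (1 + (i + 1) * m) * msucc q := by
        rw [msucc_eq, mul_add, mul_one]
        exact le_add_self
      exact absurd hq (h1.trans_le h2).ne
  · simp only [Fin.snoc_castSucc, Fin.snoc_last]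
    rintro x ⟨c0, hc⟩
    by_cases hx : x < b ∧ P M v x
    · refine ⟨c0 * (1 + (x + 1) * m), fun i hi => ?_⟩
      rw [msucc_eq, lt_succ_iff']
      by_cases hix : i = x
      · subst hix
        exact ⟨fun _ => ⟨le_rfl, hx.2⟩, fun _ => ⟨c0, by ring⟩⟩
      · rw [show i ≤ x ↔ i < x from ⟨fun h => lt_of_le_of_ne h hix, le_of_lt⟩, ← hc i hi]
        constructor
        · exact fun h => cop3 hmb hi hx.1 hix h
        · rintro ⟨q, rfl⟩
          exact ⟨q * (1 + (x + 1) * m), by ring⟩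
    · refine ⟨c0, fun i hi => ?_⟩
      rw [hc i hi, msucc_eq, lt_succ_iff']
      constructor
      · exact fun h => ⟨h.1.le, h.2⟩
      · rintro ⟨h1, h2⟩
        refine ⟨lt_of_le_of_ne h1 ?_, h2⟩
        rintro rfl
        exact hx ⟨hi, h2⟩
end coding


section sat
variable {M : PM}

/-- The basic relations. -/
def Bs (k a v : M) : Prop :=
  (k = (0 : ℕ) ∧ v = a) ∨ (k = (1 : ℕ) ∧ ∃ y, a = pr v y) ∨ (k = (2 : ℕ) ∧ ∃ x, a = pr x v) ∨
  (k = (3 : ℕ) ∧ v = 0) ∨ (k = (4 : ℕ) ∧ v = a + 1) ∨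
  (k = (5 : ℕ) ∧ ∃ x, ∃ y, a = pr x y ∧ v = x + y) ∨
  (k = (6 : ℕ) ∧ ∃ x, ∃ y, a = pr x y ∧ v = x * y) ∨
  (k = (7 : ℕ) ∧ ∃ x, a = pr x x) ∨
  (k = (8 : ℕ) ∧ ∃ x, ∃ y, a = pr x y ∧ x < y) ∨ (k = (9 : ℕ))

/-- The code of a fact. -/
def fct (e a v : M) : M := pr e (pr a v)

/-- The fact `(e, a, v)` is justified by the facts in `X`. -/
def Jst (X : M → Prop) (e a v : M) : Prop :=
  (∃ k, e = pr ((0 : ℕ) : M) k ∧ Bs k a v) ∨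
  (∃ f, ∃ g, e = pr ((1 : ℕ) : M) (pr f g) ∧ ∃ u, X (fct g a u) ∧ X (fct f u v)) ∨
  (∃ f, ∃ g, e = pr ((2 : ℕ) : M) (pr f g) ∧ ∃ x, ∃ y, v = pr x y ∧ X (fct f a x) ∧ X (fct g a y)) ∨
  (∃ f, ∃ g, e = pr ((3 : ℕ) : M) (pr f g) ∧ (X (fct f a v) ∨ X (fct g a v))) ∨
  (∃ f, e = pr ((4 : ℕ) : M) f ∧ ∃ b, ∃ z, a = pr b z ∧ ∀ y, y ≤ z → ∃ u, X (fct f (pr b y) u))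

theorem Jst.mono {X Y : M → Prop} (h : ∀ t, X t → Y t) {e a v : M} (hj : Jst X e a v) :
    Jst Y e a v := by
  rcases hj with h1 | ⟨f, g, e1, u, h1, h2⟩ | ⟨f, g, e1, x, y, e2, h1, h2⟩ | ⟨f, g, e1, h1⟩ |
    ⟨f, e1, b, z, e2, h1⟩
  · exact Or.inl h1
  · exact Or.inr (Or.inl ⟨f, g, e1, u, h _ h1, h _ h2⟩)
  · exact Or.inr (Or.inr (Or.inl ⟨f, g, e1, x, y, e2, h _ h1, h _ h2⟩))
  · exact Or.inr (Or.inr (Or.inr (Or.inl ⟨f, g, e1, h1.imp (h _) (h _)⟩)))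
  · exact Or.inr (Or.inr (Or.inr (Or.inr ⟨f, e1, b, z, e2, fun y hy =>
      (h1 y hy).imp fun u => h _⟩)))

theorem Jst_base (X : M → Prop) (k a v : M) : Jst X (pr ((0 : ℕ) : M) k) a v ↔ Bs k a v := by
  simp only [Jst, pr_inj, Nat.cast_inj]
  simp
theorem Jst_comp (X : M → Prop) (f g a v : M) : Jst X (pr ((1 : ℕ) : M) (pr f g)) a v ↔
    ∃ u, X (fct g a u) ∧ X (fct f u v) := by
  simp only [Jst, pr_inj, Nat.cast_inj]
  simp
theorem Jst_pair (X : M → Prop) (f g a v : M) : Jst X (pr ((2 : ℕ) : M) (pr f g)) a v ↔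
    ∃ x, ∃ y, v = pr x y ∧ X (fct f a x) ∧ X (fct g a y) := by
  simp only [Jst, pr_inj, Nat.cast_inj]
  simp
theorem Jst_or (X : M → Prop) (f g a v : M) : Jst X (pr ((3 : ℕ) : M) (pr f g)) a v ↔
    X (fct f a v) ∨ X (fct g a v) := by
  simp only [Jst, pr_inj, Nat.cast_inj]
  simp
theorem Jst_ball (X : M → Prop) (f b z v : M) : Jst X (pr ((4 : ℕ) : M) f) (pr b z) v ↔
    ∀ y, y ≤ z → ∃ u, X (fct f (pr b y) u) := by
  simp only [Jst, pr_inj, Nat.cast_inj]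
  simp
theorem Jst_ball' (X : M → Prop) (f a v : M) (h : Jst X (pr ((4 : ℕ) : M) f) a v) :
    ∃ b z, a = pr b z := by
  simp only [Jst, pr_inj, Nat.cast_inj] at h
  simp at h
  obtain ⟨b, z, e, _⟩ := h
  exact ⟨b, z, e⟩

/-- Self-justified sets of facts. -/
def SJ (s : M) : Prop := ∀ t, t ≤ s → (¬ mem t s ∨
  ∃ e, ∃ a, ∃ v, t = fct e a v ∧ Jst (fun t => mem t s) e a v)

/-- Derivable facts. -/
def Fc (t : M) : Prop := ∃ s, SJ s ∧ mem t s

theorem sg1_SJ {m : ℕ} {f : ∀ M : PM, (Fin m → M) → M} (hf : Tmf f) :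
    Sg 1 (fun M v => SJ (f M v)) := by
  have : Sg 1 (m := 1) (fun M v => SJ (v 0)) := by
    unfold SJ Jst Bs fct
    repeat' first | with_reducible apply (nice_Sg 1).and | with_reducible apply (nice_Sg 1).or | with_reducible apply Sg.ex | with_reducible apply (nice_Sg 1).ball | (apply (nice_Sg 1).d0; first | with_reducible apply D0.eq | with_reducible apply D0.lt | with_reducible apply D0.mem | (with_reducible apply D0.not; with_reducible apply D0.mem))
    all_goals repeat' first | with_reducible apply Tmf.pr | with_reducible apply Tmf.cast | with_reducible apply Tmf.add | with_reducible apply Tmf.mul | with_reducible apply Tmf.zero | with_reducible apply Tmf.one | apply Tmf.var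
  exact (nice_Sg 1).subst this (s := fun _ => f) (fun _ => hf)
theorem sg1_Fc {m : ℕ} {f : ∀ M : PM, (Fin m → M) → M} (hf : Tmf f) :
    Sg 1 (fun M v => Fc (f M v)) := by
  have : Sg 1 (m := 1) (fun M v => Fc (v 0)) := by
    unfold Fc
    exact Sg.ex ((nice_Sg 1).and (sg1_SJ (Tmf.var _)) ((nice_Sg 1).d0 (D0.mem (Tmf.var _) (Tmf.var _))))
  exact (nice_Sg 1).subst this (s := fun _ => f) (fun _ => hf)

theorem fct_inj {e a v e' a' v' : M} : fct e a v = fct e' a' v' ↔ e = e' ∧ a = a' ∧ v = v' := by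
  simp only [fct, pr_inj]

theorem SJ.jst {s e a v : M} (h : SJ s) (hm : mem (fct e a v) s) : Jst (fun t => mem t s) e a v := by
  rcases h _ (mem_lt hm).le with h | ⟨e', a', v', h1, h2⟩
  · exact absurd hm h
  · rw [fct_inj] at h1
    obtain ⟨rfl, rfl, rfl⟩ := h1
    exact h2

theorem grow (C e a v : M) (h : Jst (fun t => ∃ s, s ≤ C ∧ SJ s ∧ mem t s) e a v) :
    Fc (fct e a v) := by
  obtain ⟨c, hc⟩ := comprehension (k := 2) (P := fun M w t =>
    (∃ s, s ≤ w 0 ∧ SJ s ∧ mem t s) ∨ t = w 1) (by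
      refine DF.or (DF.ex (DF.and ?_ (DF.and ?_ ?_))) ?_
      · exact DF.le (Tmf.var _) (Tmf.var _)
      · exact (nice_Sg 1).df (sg1_SJ (Tmf.var _))
      · exact (D0.mem (Tmf.var _) (Tmf.var _)).df
      · exact DF.eq (Tmf.var _) (Tmf.var _)) ![C, fct e a v] (max C (fct e a v + 1))
  have hc' : ∀ i, mem i c ↔ (∃ s, s ≤ C ∧ SJ s ∧ mem i s) ∨ i = fct e a v := by
    intro i
    rw [hc]
    refine ⟨fun h => h.2, fun h => ⟨?_, h⟩⟩
    rcases h with ⟨s, hs, _, h⟩ | rfl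
    · exact (mem_lt h).trans_le (hs.trans (le_max_left _ _))
    · exact ((lt_succ_iff' _ _).2 le_rfl).trans_le (le_max_right _ _)
  refine ⟨c, ?_, (hc' _).2 (Or.inr rfl)⟩
  intro t _
  by_cases ht : mem t c
  · right
    rcases (hc' _).1 ht with ⟨s, hs, h1, h2⟩ | rfl
    · rcases h1 t (mem_lt h2).le with h | ⟨e', a', v', e1, h⟩
      · exact absurd h2 h
      · exact ⟨e', a', v', e1, h.mono fun t ht => (hc' _).2 (Or.inl ⟨s, hs, h1, ht⟩)⟩
    · exact ⟨e, a, v, rfl, h.mono fun t ht => (hc' _).2 (Or.inl ht)⟩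
  · exact Or.inl ht

theorem Fc_base {k a v : M} (h : Bs k a v) : Fc (fct (pr ((0 : ℕ) : M) k) a v) :=
  grow 0 _ _ _ ((Jst_base _ _ _ _).2 h)
theorem Fc_comp {f g a u v : M} (h1 : Fc (fct g a u)) (h2 : Fc (fct f u v)) :
    Fc (fct (pr ((1 : ℕ) : M) (pr f g)) a v) := by
  obtain ⟨s, h1⟩ := h1
  obtain ⟨s', h2⟩ := h2
  exact grow (max s s') _ _ _ ((Jst_comp _ _ _ _ _).2 ⟨u, ⟨s, le_max_left _ _, h1⟩,
    ⟨s', le_max_right _ _, h2⟩⟩)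
theorem Fc_pair {f g a x y : M} (h1 : Fc (fct f a x)) (h2 : Fc (fct g a y)) :
    Fc (fct (pr ((2 : ℕ) : M) (pr f g)) a (pr x y)) := by
  obtain ⟨s, h1⟩ := h1
  obtain ⟨s', h2⟩ := h2
  exact grow (max s s') _ _ _ ((Jst_pair _ _ _ _ _).2 ⟨x, y, rfl, ⟨s, le_max_left _ _, h1⟩,
    ⟨s', le_max_right _ _, h2⟩⟩)
theorem Fc_or {f g a v : M} (h : Fc (fct f a v) ∨ Fc (fct g a v)) :
    Fc (fct (pr ((3 : ℕ) : M) (pr f g)) a v) := by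
  rcases h with ⟨s, h⟩ | ⟨s, h⟩
  · exact grow s _ _ _ ((Jst_or _ _ _ _ _).2 (Or.inl ⟨s, le_rfl, h⟩))
  · exact grow s _ _ _ ((Jst_or _ _ _ _ _).2 (Or.inr ⟨s, le_rfl, h⟩))
theorem Fc_ball {f b z v : M} (h : ∀ y, y ≤ z → ∃ u, Fc (fct f (pr b y) u)) :
    Fc (fct (pr ((4 : ℕ) : M) f) (pr b z) v) := by
  obtain ⟨C, hC⟩ := collection (m := 2) (Q := fun M w y s =>
    ∃ u, SJ s ∧ mem (fct (w 0) (pr (w 1) y) u) s) (by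
      refine DF.ex (DF.and ((nice_Sg 1).df (sg1_SJ (Tmf.var _))) (D0.mem ?_ (Tmf.var _)).df)
      unfold fct
      repeat' first | apply Tmf.var | apply Tmf.pr) ![f, b] z (fun y hy => by
      obtain ⟨u, s, h⟩ := h y hy
      exact ⟨s, u, h⟩)
  refine grow C _ _ _ ((Jst_ball _ _ _ _ _).2 fun y hy => ?_)
  obtain ⟨s, hs, u, h⟩ := hC y hy
  exact ⟨u, s, hs, h⟩
end sat

/-- Programs. -/
inductive Pg : Type
  | base : ℕ → Pg
  | comp : Pg → Pg → Pg
  | pair : Pg → Pg → Pg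
  | or : Pg → Pg → Pg
  | ball : Pg → Pg

/-- Codes of programs. -/
def Pg.code : Pg → ℕ
  | .base k => pr 0 k
  | .comp f g => pr 1 (pr f.code g.code)
  | .pair f g => pr 2 (pr f.code g.code)
  | .or f g => pr 3 (pr f.code g.code)
  | .ball f => pr 4 f.code

/-- Denotations of programs. -/
def Pg.den {M : PM} : Pg → M → M → Prop
  | .base k => fun a v => Bs (k : M) a v
  | .comp f g => fun a v => ∃ u, g.den a u ∧ f.den u v
  | .pair f g => fun a v => ∃ x y, v = pr x y ∧ f.den a x ∧ g.den a y
  | .or f g => fun a v => f.den a v ∨ g.den a v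
  | .ball f => fun a _ => ∃ b z, a = pr b z ∧ ∀ y, y ≤ z → ∃ u, f.den (pr b y) u

theorem Pg.sound {M : PM} {s : M} (hs : SJ s) (p : Pg) : ∀ a v : M,
    mem (fct (p.code : M) a v) s → p.den a v := by
  induction p with
  | base k =>
    intro a v h
    have := hs.jst h
    rw [Pg.code, cast_pr, Jst_base] at this
    exact this
  | comp f g ih1 ih2 =>
    intro a v h
    have := hs.jst h
    rw [Pg.code, cast_pr, cast_pr, Jst_comp] at this
    obtain ⟨u, h1, h2⟩ := this
    exact ⟨u, ih2 _ _ h1, ih1 _ _ h2⟩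
  | pair f g ih1 ih2 =>
    intro a v h
    have := hs.jst h
    rw [Pg.code, cast_pr, cast_pr, Jst_pair] at this
    obtain ⟨x, y, e, h1, h2⟩ := this
    exact ⟨x, y, e, ih1 _ _ h1, ih2 _ _ h2⟩
  | or f g ih1 ih2 =>
    intro a v h
    have := hs.jst h
    rw [Pg.code, cast_pr, cast_pr, Jst_or] at this
    exact this.imp (ih1 _ _) (ih2 _ _)
  | ball f ih =>
    intro a v h
    have := hs.jst h
    rw [Pg.code, cast_pr] at this
    obtain ⟨b, z, rfl⟩ := Jst_ball' _ _ _ _ this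
    rw [Jst_ball] at this
    refine ⟨b, z, rfl, fun y hy => ?_⟩
    obtain ⟨u, hu⟩ := this y hy
    exact ⟨u, ih _ _ hu⟩
theorem Pg.complete {M : PM} (p : Pg) : ∀ a v : M, p.den a v → Fc (fct (p.code : M) a v) := by
  induction p with
  | base k =>
    intro a v h
    rw [Pg.code, cast_pr]
    exact Fc_base h
  | comp f g ih1 ih2 =>
    rintro a v ⟨u, h1, h2⟩
    rw [Pg.code, cast_pr, cast_pr]
    exact Fc_comp (ih2 _ _ h1) (ih1 _ _ h2)
  | pair f g ih1 ih2 =>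
    rintro a v ⟨x, y, rfl, h1, h2⟩
    rw [Pg.code, cast_pr, cast_pr]
    exact Fc_pair (ih1 _ _ h1) (ih2 _ _ h2)
  | or f g ih1 ih2 =>
    intro a v h
    rw [Pg.code, cast_pr, cast_pr]
    exact Fc_or (h.imp (ih1 _ _) (ih2 _ _))
  | ball f ih =>
    rintro a v ⟨b, z, rfl, h⟩
    rw [Pg.code, cast_pr]
    exact Fc_ball fun y hy => (h y hy).imp fun u hu => ih _ _ hu
theorem Pg.fc_iff {M : PM} (p : Pg) (a v : M) : Fc (fct (p.code : M) a v) ↔ p.den a v :=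
  ⟨fun ⟨_, hs, h⟩ => p.sound hs a v h, p.complete a v⟩

section den
variable {M : PM} (a v : M)
theorem den_id : (Pg.base 0).den a v ↔ v = a := by
  simp only [Pg.den, Bs, Nat.cast_inj]; simp
theorem den_fst (x y v : M) : (Pg.base 1).den (pr x y) v ↔ v = x := by
  simp only [Pg.den, Bs, Nat.cast_inj, pr_inj]; simp [eq_comm]
theorem den_snd (x y v : M) : (Pg.base 2).den (pr x y) v ↔ v = y := by
  simp only [Pg.den, Bs, Nat.cast_inj, pr_inj]; simp [eq_comm]
theorem den_zero : (Pg.base 3).den a v ↔ v = 0 := by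
  simp only [Pg.den, Bs, Nat.cast_inj]; simp
theorem den_succ : (Pg.base 4).den a v ↔ v = a + 1 := by
  simp only [Pg.den, Bs, Nat.cast_inj]; simp
theorem den_add (x y v : M) : (Pg.base 5).den (pr x y) v ↔ v = x + y := by
  simp only [Pg.den, Bs, Nat.cast_inj, pr_inj]; simp
theorem den_mul (x y v : M) : (Pg.base 6).den (pr x y) v ↔ v = x * y := by
  simp only [Pg.den, Bs, Nat.cast_inj, pr_inj]; simp
theorem den_eq (x y v : M) : (Pg.base 7).den (pr x y) v ↔ x = y := by
  simp only [Pg.den, Bs, Nat.cast_inj, pr_inj]; simp [eq_comm]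
theorem den_lt (x y v : M) : (Pg.base 8).den (pr x y) v ↔ x < y := by
  simp only [Pg.den, Bs, Nat.cast_inj, pr_inj]; simp
theorem den_any : (Pg.base 9).den a v := by
  simp only [Pg.den, Bs, Nat.cast_inj]; simp
end den

/-- Codes of tuples. -/
def tup {M : PM} : ∀ {m : ℕ}, (Fin m → M) → M
  | 0, _ => 0
  | m + 1, v => pr (tup (fun i : Fin m => v i.castSucc)) (v (Fin.last m))

theorem tup_snoc {M : PM} {m : ℕ} (v : Fin m → M) (x : M) :
    tup (Fin.snoc v x : Fin (m + 1) → M) = pr (tup v) x := by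
  simp only [tup, snoc_castSucc', Fin.snoc_last]

theorem prog_var : ∀ {m : ℕ} (i : Fin m), ∃ p : Pg, ∀ (M : PM) (v : Fin m → M) (u : M),
    p.den (tup v) u ↔ u = v i
  | 0, i => i.elim0
  | m + 1, i => by
    refine Fin.lastCases ?_ (fun j => ?_) i
    · exact ⟨.base 2, fun M v u => by rw [tup, den_snd]⟩
    · obtain ⟨p, hp⟩ := prog_var j
      refine ⟨.comp p (.base 1), fun M v u => ?_⟩
      simp only [Pg.den.eq_2, tup, den_fst, exists_eq_left, hp]

theorem prog_term {m : ℕ} (t : LA.Term (Empty ⊕ Fin m)) : ∃ p : Pg, ∀ (M : PM) (v : Fin m → M) (u : M),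
    p.den (tup v) u ↔ u = t.realize (Sum.elim default v) := by
  induction t with
  | var i =>
    rcases i with i | i
    · exact i.elim
    · exact prog_var i
  | @func l f ts ih =>
    choose g hg using ih
    match l, f, ts, g, hg with
    | 0, f, ts, g, hg =>
      refine ⟨.base 3, fun M v u => ?_⟩
      rw [den_zero]
      have : (Term.func f ts).realize (Sum.elim default v) = mzero M := by
        change Structure.funMap _ _ = mzero M
        unfold mzero
        congr 1
        funext i
        exact i.elim0
      rw [this]
      rfl
    | 1, f, ts, g, hg =>
      refine ⟨.comp (.base 4) (g 0), fun M v u => ?_⟩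
      have : (Term.func f ts).realize (Sum.elim default v) =
          msucc ((ts 0).realize (Sum.elim default v)) := by
        change Structure.funMap _ _ = msucc _
        unfold msucc
        congr 1
        funext i
        fin_cases i
        rfl
      rw [this, msucc_eq]
      simp only [Pg.den.eq_2, hg, den_succ, exists_eq_left]
    | 2, false, ts, g, hg =>
      refine ⟨.comp (.base 5) (.pair (g 0) (g 1)), fun M v u => ?_⟩
      have : (Term.func (L := LA) (l := 2) false ts).realize (Sum.elim default v) =
          (ts 0).realize (Sum.elim default v) + (ts 1).realize (Sum.elim default v) := by
        change Structure.funMap _ _ = madd _ _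
        unfold madd
        congr 1
        funext i
        fin_cases i <;> rfl
      rw [this]
      simp [Pg.den.eq_2, Pg.den.eq_3, hg, den_add]
    | 2, true, ts, g, hg =>
      refine ⟨.comp (.base 6) (.pair (g 0) (g 1)), fun M v u => ?_⟩
      have : (Term.func (L := LA) (l := 2) true ts).realize (Sum.elim default v) =
          (ts 0).realize (Sum.elim default v) * (ts 1).realize (Sum.elim default v) := by
        change Structure.funMap _ _ = mmul _ _
        unfold mmul
        congr 1
        funext i
        fin_cases i <;> rfl
      rw [this]
      simp [Pg.den.eq_2, Pg.den.eq_3, hg, den_mul]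

theorem IsDelta0.prog {m : ℕ} {φ : LA.BoundedFormula Empty m} (h : IsDelta0 φ) :
    ∃ p q : Pg, ∀ (M : PM) (v : Fin m → M), (φ.Realize default v ↔ ∃ u, p.den (tup v) u) ∧
      (¬ φ.Realize default v ↔ ∃ u, q.den (tup v) u) := by
  induction h with
  | falsum =>
    refine ⟨.comp (.base 8) (.pair (.base 3) (.base 3)), .base 9, fun M v => ⟨?_, ?_⟩⟩
    · simp [Pg.den.eq_2, Pg.den.eq_3, den_zero, den_lt]
    · simp [den_any]
  | equal t u =>
    obtain ⟨f, hf⟩ := prog_term t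
    obtain ⟨g, hg⟩ := prog_term u
    refine ⟨.comp (.base 7) (.pair f g), .or (.comp (.base 8) (.pair f g))
      (.comp (.base 8) (.pair g f)), fun M v => ⟨?_, ?_⟩⟩
    · rw [BoundedFormula.realize_bdEqual]
      simp [Pg.den.eq_2, Pg.den.eq_3, hf, hg, den_eq]
    · rw [BoundedFormula.realize_bdEqual]
      simp [Pg.den.eq_2, Pg.den.eq_3, Pg.den.eq_4, hf, hg, den_lt]
  | le t u =>
    obtain ⟨f, hf⟩ := prog_term t
    obtain ⟨g, hg⟩ := prog_term u
    refine ⟨.or (.comp (.base 8) (.pair f g)) (.comp (.base 7) (.pair f g)),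
      .comp (.base 8) (.pair g f), fun M v => ⟨?_, ?_⟩⟩
    · rw [r_leF]
      simp [Pg.den.eq_2, Pg.den.eq_3, Pg.den.eq_4, hf, hg, den_lt, den_eq]
      exact le_iff_lt_or_eq (a := (t.realize (Sum.elim default v) : M)) (b := u.realize (Sum.elim default v))
    · rw [r_leF]
      simp [Pg.den.eq_2, Pg.den.eq_3, hf, hg, den_lt]
      exact not_le (a := (t.realize (Sum.elim default v) : M)) (b := u.realize (Sum.elim default v))
  | imp _ _ ih1 ih2 =>
    obtain ⟨p1, q1, h1⟩ := ih1
    obtain ⟨p2, q2, h2⟩ := ih2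
    refine ⟨.or q1 p2, .pair p1 q2, fun M v => ⟨?_, ?_⟩⟩
    · rw [BoundedFormula.realize_imp, imp_iff_not_or, (h1 M v).2, (h2 M v).1]
      simp only [Pg.den.eq_4, exists_or]
    · rw [BoundedFormula.realize_imp, Classical.not_imp, (h1 M v).1, (h2 M v).2]
      simp only [Pg.den.eq_3]
      constructor
      · rintro ⟨⟨x, hx⟩, ⟨y, hy⟩⟩
        exact ⟨_, x, y, rfl, hx, hy⟩
      · rintro ⟨_, x, y, _, hx, hy⟩
        exact ⟨⟨x, hx⟩, ⟨y, hy⟩⟩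
  | @ball m t φ _ ih =>
    obtain ⟨f, hf⟩ := prog_term t
    obtain ⟨p, q, h⟩ := ih
    refine ⟨.comp (.ball p) (.pair (.base 0) f), .comp (.pair q (.comp (.base 8) (.pair (.base 2)
      (.comp (.base 4) (.comp f (.base 1)))))) (.pair (.base 0) (.base 9)), fun M v => ⟨?_, ?_⟩⟩
    · rw [ball_realize]
      simp only [(h M _).1, tup_snoc]
      simp [Pg.den.eq_2, Pg.den.eq_3, Pg.den.eq_5, hf, den_id, pr_inj]
    · rw [ball_realize]
      simp only [not_forall, (h M _).2, tup_snoc]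
      simp [Pg.den.eq_2, Pg.den.eq_3, hf, den_id, den_any, den_fst, den_snd, den_succ, den_lt, lt_succ_iff']
      exact exists_congr fun x => and_comm
  | @bex m t φ _ ih =>
    obtain ⟨f, hf⟩ := prog_term t
    obtain ⟨p, q, h⟩ := ih
    refine ⟨.comp (.pair p (.comp (.base 8) (.pair (.base 2)
      (.comp (.base 4) (.comp f (.base 1)))))) (.pair (.base 0) (.base 9)),
      .comp (.ball q) (.pair (.base 0) f), fun M v => ⟨?_, ?_⟩⟩
    · rw [bex_realize]
      simp only [(h M _).1, tup_snoc]
      simp [Pg.den.eq_2, Pg.den.eq_3, hf, den_id, den_any, den_fst, den_snd, den_succ, den_lt, lt_succ_iff']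
      exact exists_congr fun x => and_comm
    · rw [bex_realize]
      simp only [not_exists, not_and, (h M _).2, tup_snoc]
      simp [Pg.den.eq_2, Pg.den.eq_3, Pg.den.eq_5, hf, den_id, pr_inj]

theorem sg1_prog {P : UP 1} (h : Sg 1 P) : ∃ p : Pg, ∀ (M : PM) (a : M),
    P M (fun _ => a) ↔ ∃ u, p.den a u := by
  obtain ⟨Q, hQ, e⟩ := h
  obtain ⟨φ, hd, hφ⟩ := hQ
  obtain ⟨p, q, h⟩ := hd.prog
  refine ⟨.comp q (.pair (.pair (.base 3) (.base 0)) (.base 9)), fun M a => ?_⟩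
  rw [e]
  have : ∀ x, Q M (fun _ => a) x ↔ ∃ u, q.den (pr (pr 0 a) x) u := by
    intro x
    have h1 := (h M (Fin.snoc (fun _ : Fin 1 => a) x)).2
    rw [hφ, not_not, tup_snoc] at h1
    simp only [snoc_castSucc', Fin.snoc_last] at h1
    exact h1
  simp only [this]
  simp [Pg.den.eq_2, Pg.den.eq_3, den_id, den_any, den_zero]
  exact exists_comm

/-- Universal predicates. -/
def Un : ℕ → ∀ {M : PM}, M → Prop
  | 0, _ => fun x => ∃ e, ∃ a, x = pr e a ∧ ∃ v, Fc (fct e a v)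
  | k + 1, _ => fun x => ∃ e, ∃ a, x = pr e a ∧ ∃ u, ¬ Un k (pr e (pr a u))

theorem Un_sg : ∀ (k : ℕ) {m : ℕ} {f : ∀ M : PM, (Fin m → M) → M} (_ : Tmf f),
    Sg (k + 1) (fun M v => Un k (f M v))
  | 0, m, f, hf => by
    simp only [Un]
    refine Sg.ex (Sg.ex ((nice_Sg 1).and ((nice_Sg 1).d0 (D0.eq ?_ ?_)) (Sg.ex (sg1_Fc ?_))))
    · exact hf.subst (fun _ => Tmf.var _)
    · exact Tmf.pr (Tmf.var _) (Tmf.var _)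
    · unfold fct
      exact Tmf.pr (Tmf.var _) (Tmf.pr (Tmf.var _) (Tmf.var _))
  | k + 1, m, f, hf => by
    simp only [Un]
    refine Sg.ex (Sg.ex ((nice_Sg _).and ((nice_Sg _).d0 (D0.eq ?_ ?_)) (Sg.ex (Pp.sg_succ
      (Sg.not (Un_sg k ?_))))))
    · exact hf.subst (fun _ => Tmf.var _)
    · exact Tmf.pr (Tmf.var _) (Tmf.var _)
    · exact Tmf.pr (Tmf.var _) (Tmf.pr (Tmf.var _) (Tmf.var _))

theorem Un_univ : ∀ (k : ℕ) {P : UP 1} (_ : Sg (k + 1) P), ∃ e : ℕ, ∀ (M : PM) (a : M),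
    P M (fun _ => a) ↔ Un k (pr (e : M) a)
  | 0, P, h => by
    obtain ⟨p, hp⟩ := sg1_prog h
    refine ⟨p.code, fun M a => ?_⟩
    simp only [hp, Un, pr_inj]
    simp [← Pg.fc_iff]
  | k + 1, P, ⟨Q, hQ, e⟩ => by
    obtain ⟨c, hc⟩ := Un_univ k (P := fun M w => ∃ x, ∃ y, w 0 = pr x y ∧ ¬ Q M (fun _ => x) y) (by
      refine Sg.ex (Sg.ex ((nice_Sg _).and ((nice_Sg _).d0 (D0.eq ?_ ?_)) ?_))
      · exact Tmf.var _
      · exact Tmf.pr (Tmf.var _) (Tmf.var _)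
      · exact (nice_Sg (k + 1)).app1 (Q := fun M v x => ¬ Q M v x) hQ (fun _ => Tmf.var _) (Tmf.var _))
    refine ⟨c, fun M a => ?_⟩
    rw [e]
    simp only [Un, pr_inj]
    have h2 : ∀ u, ¬ Un k (pr (c : M) (pr a u)) ↔ Q M (fun _ => a) u := by
      intro u
      rw [← hc]
      simp [pr_inj]
    constructor
    · rintro ⟨x, hx⟩
      exact ⟨_, _, ⟨rfl, rfl⟩, x, (h2 x).2 hx⟩
    · rintro ⟨_, _, ⟨rfl, rfl⟩, x, hx⟩
      exact ⟨x, (h2 x).1 hx⟩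


/-- The standard structure. -/
@[reducible] def natStr : LA.Structure ℕ where
  funMap {n} f v := match n, f, v with
    | 0, _, _ => 0
    | 1, _, v => v 0 + 1
    | 2, false, v => v 0 + v 1
    | 2, true, v => v 0 * v 1
  RelMap {n} r v := match n, r, v with
    | 2, _, v => v 0 ≤ v 1

theorem nat_ind {k : ℕ} (φ : LA.BoundedFormula Empty (k + 1)) :
    @Sentence.Realize LA ℕ natStr (indAxiom φ) := by
  let _ := natStr
  have e := fun v0 => (BoundedFormula.realize_alls (L := LA) (M := ℕ) (v := (v0 : Empty → ℕ)) (φ :=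
    ((∀' ((vT (Fin.last k) =' zeroT) ⟹ φ)) ⊓ (∀' (φ ⟹
    ∀' ((vT (Fin.last (k + 1)) =' succT (vT (Fin.castSucc (Fin.last k)))) ⟹ φ.liftAt 1 k)))) ⟹ ∀' φ)).2
  refine e _ fun v => ?_
  rw [BoundedFormula.realize_imp, BoundedFormula.realize_inf]
  simp only [BoundedFormula.realize_all, BoundedFormula.realize_imp,
    BoundedFormula.realize_bdEqual, r_vT, r_zeroT, r_succT, Fin.snoc_last]
  rintro ⟨h0, hs⟩ x
  induction x with
  | zero => exact h0 0 rfl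
  | succ x ih =>
    have := hs x ih (x + 1) (by rw [Fin.snoc_castSucc, Fin.snoc_last]; rfl)
    rw [BoundedFormula.realize_liftAt_one (Nat.le_succ k)] at this
    convert this using 1
    funext i
    refine Fin.lastCases ?_ (fun j => ?_) i
    · simp
    · simp [Function.comp]

theorem nat_model : @Theory.Model LA ℕ natStr PAAx := by
  let _ := natStr
  refine ⟨fun φ hφ => ?_⟩
  rcases hφ with hφ | ⟨k, ψ, rfl⟩
  · simp only [Set.mem_insert_iff, Set.mem_singleton_iff] at hφ
    rcases hφ with rfl | rfl | rfl | rfl | rfl | rfl | rfl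
    · intro x
      rw [BoundedFormula.realize_not, BoundedFormula.realize_bdEqual, r_succT, r_zeroT]
      exact Nat.succ_ne_zero x
    · intro x y
      rw [BoundedFormula.realize_imp, BoundedFormula.realize_bdEqual, r_succT, r_succT]
      exact Nat.succ.inj
    · intro x
      rw [BoundedFormula.realize_bdEqual, r_addT, r_zeroT]
      exact Nat.add_zero x
    · intro x y
      rw [BoundedFormula.realize_bdEqual, r_addT, r_succT, r_succT, r_addT]
      exact Nat.add_succ x y
    · intro x
      rw [BoundedFormula.realize_bdEqual, r_mulT, r_zeroT]
      exact Nat.mul_zero x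
    · intro x y
      rw [BoundedFormula.realize_bdEqual, r_mulT, r_succT, r_addT, r_mulT]
      exact Nat.mul_succ x y
    · intro x y
      rw [BoundedFormula.realize_iff, BoundedFormula.realize_ex, r_leF]
      have : (∃ z, z + x = y) ↔ x ≤ y :=
        ⟨fun ⟨z, h⟩ => h ▸ Nat.le_add_left _ _, fun h => ⟨y - x, Nat.sub_add_cancel h⟩⟩
      refine Iff.trans this.symm (exists_congr fun z => ?_)
      rw [BoundedFormula.realize_bdEqual, r_addT]
      rfl
  · exact nat_ind ψ

theorem exists_NM : ∃ N : PM, ∀ x : N, ∃ n : ℕ, x = (n : N) := by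
  refine ⟨@Theory.ModelType.mk LA PAAx ℕ natStr nat_model ⟨0⟩, ?_⟩
  generalize hN : @Theory.ModelType.mk LA PAAx ℕ natStr nat_model ⟨0⟩ = N
  have key : ∀ p : N → Prop, p 0 → (∀ x, p x → p (msucc x)) → ∀ x, p x := by
    subst hN
    intro p h0 hs x
    exact Nat.rec (motive := fun n => p n) h0 (fun n ih => hs n ih) x
  refine key _ ⟨0, Nat.cast_zero.symm⟩ ?_
  rintro _ ⟨n, rfl⟩
  exact ⟨n + 1, by rw [Nat.cast_add, Nat.cast_one, msucc_eq]⟩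

/-- The standard model. -/
noncomputable def NM : PM := exists_NM.choose

theorem NM_surj (x : NM) : ∃ n : ℕ, x = n := exists_NM.choose_spec x
theorem ex_NM {p : NM → Prop} : (∃ x, p x) ↔ ∃ n : ℕ, p n :=
  ⟨fun ⟨x, h⟩ => by obtain ⟨n, rfl⟩ := NM_surj x; exact ⟨n, h⟩, fun ⟨n, h⟩ => ⟨n, h⟩⟩
theorem all_NM {p : NM → Prop} : (∀ x, p x) ↔ ∀ n : ℕ, p n :=
  ⟨fun h n => h n, fun h x => by obtain ⟨n, rfl⟩ := NM_surj x; exact h n⟩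

theorem mem_empty : ∃ c : NM, ∀ i, ¬ mem i c :=
  ⟨0, fun _ h => absurd (mem_lt h) (not_lt_of_ge (by simp))⟩
theorem mem_insert (c x : NM) : ∃ c' : NM, ∀ i, mem i c' ↔ mem i c ∨ i = x := by
  obtain ⟨c', h⟩ := comprehension (k := 2) (P := fun M w t => mem t (w 0) ∨ t = w 1)
    (DF.or (D0.mem (Tmf.var _) (Tmf.var _)).df (DF.eq (Tmf.var _) (Tmf.var _)))
    ![c, x] (max c (x + 1))
  refine ⟨c', fun i => ?_⟩
  rw [h]
  refine ⟨fun h => h.2, fun h => ⟨?_, h⟩⟩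
  rcases h with h | rfl
  · exact (mem_lt h).trans_le (le_max_left _ _)
  · exact ((lt_succ_iff' _ _).2 le_rfl).trans_le (le_max_right _ _)

/-- Binary uniform predicates. -/
theorem ap2 {m k : ℕ} {P : ∀ M : PM, M → M → Prop} (h : Sg k (m := 2) (fun M v => P M (v 0) (v 1)))
    {f g : ∀ M : PM, (Fin m → M) → M} (hf : Tmf f) (hg : Tmf g) :
    Sg k (fun M v => P M (f M v) (g M v)) :=
  (nice_Sg k).subst h (s := ![f, g]) (fun i => by fin_cases i; exacts [hf, hg])

/-- The graph of the pairing function. -/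
def Np {M : PM} (x y z : M) : Prop := (x < y ∧ z = y * y + x) ∨ (y ≤ x ∧ z = x * x + x + y)
theorem Np_iff (x y z : ℕ) : Np (x : NM) (y : NM) (z : NM) ↔ z = Nat.pair x y := by
  unfold Np Nat.pair
  have e1 : (z : NM) = y * y + x ↔ z = y * y + x := by
    rw [← Nat.cast_mul, ← Nat.cast_add, Nat.cast_inj]
  have e2 : (z : NM) = x * x + x + y ↔ z = x * x + x + y := by
    rw [← Nat.cast_mul, ← Nat.cast_add, ← Nat.cast_add, Nat.cast_inj]
  rw [e1, e2, Nat.cast_lt, Nat.cast_le]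
  split_ifs with h
  · simp [h]
  · simp [h, not_lt.1 h]
theorem Np_sg {m k : ℕ} {f g h : ∀ M : PM, (Fin m → M) → M} (hf : Tmf f) (hg : Tmf g) (hh : Tmf h) :
    Sg k (fun M v => Np (f M v) (g M v) (h M v)) := by
  apply (nice_Sg k).d0
  unfold Np
  exact D0.or (D0.and (D0.lt hf hg) (D0.eq hh ((hg.mul hg).add hf)))
    (D0.and (D0.le hg hf) (D0.eq hh (((hf.mul hf).add hf).add hg)))

/-- Functions with a `Σ₁` graph. -/
def GR (f : ℕ → ℕ) : Prop := ∃ P : ∀ M : PM, M → M → Prop,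
  Sg 1 (m := 2) (fun M v => P M (v 0) (v 1)) ∧ ∀ x y : ℕ, P NM x y ↔ y = f x

/-- One step of the recursion. -/
def Stp {M : PM} (Pf Pg : M → M → Prop) (z s t : M) : Prop :=
  (∃ u, t = pr ((0 : ℕ) : M) u ∧ Pf z u) ∨ (∃ i, ∃ u, ∃ u', ∃ q, ∃ q', t = pr (i + 1) u' ∧
    mem (pr i u) s ∧ Np i u q ∧ Np z q q' ∧ Pg q' u')
def Prc {M : PM} (Pf Pg : M → M → Prop) (n y : M) : Prop :=
  ∃ z, ∃ l, Np z l n ∧ ∃ s, mem (pr l y) s ∧ ∀ t, t ≤ s → (¬ mem t s ∨ Stp Pf Pg z s t)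

theorem GR.prec {f g : ℕ → ℕ} (hf : GR f) (hg : GR g) :
    GR (Nat.unpaired fun z n => n.rec (f z) fun y IH => g <| Nat.pair z <| Nat.pair y IH) := by
  obtain ⟨Pf, sf, ef⟩ := hf
  obtain ⟨Pg, sg, eg⟩ := hg
  refine ⟨fun M => Prc (Pf M) (Pg M), ?_, fun x y => ?_⟩
  · unfold Prc Stp
    repeat' first | with_reducible apply (nice_Sg 1).and | with_reducible apply (nice_Sg 1).or | with_reducible apply Sg.ex | with_reducible apply (nice_Sg 1).ball | with_reducible apply Np_sg | with_reducible apply ap2 sf | with_reducible apply ap2 sg | (apply (nice_Sg 1).d0; first | with_reducible apply D0.eq | with_reducible apply D0.mem | (with_reducible apply D0.not; with_reducible apply D0.mem))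
    all_goals repeat' first | with_reducible apply Tmf.pr | with_reducible apply Tmf.cast | with_reducible apply Tmf.add | with_reducible apply Tmf.one | apply Tmf.var
  · set F : ℕ → ℕ → ℕ := fun z n => n.rec (f z) fun y IH => g <| Nat.pair z <| Nat.pair y IH with hF
    change _ ↔ y = F x.unpair.1 x.unpair.2
    have hF0 : ∀ z, F z 0 = f z := fun z => rfl
    have hFs : ∀ z n, F z (n + 1) = g (Nat.pair z (Nat.pair n (F z n))) := fun z n => rfl
    clear_value F
    have key : ∀ (z l y : ℕ), (∃ s : NM, mem (pr (l : NM) (y : NM)) s ∧ ∀ t, t ≤ s →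
        (¬ mem t s ∨ Stp (Pf NM) (Pg NM) (z : NM) s t)) ↔ y = F z l := by
      intro z l y
      constructor
      · rintro ⟨s, h1, h2⟩
        induction l generalizing y with
        | zero =>
          rcases h2 _ (mem_lt h1).le with h | ⟨u, e, h⟩ | ⟨i, u, u', q, q', e, _⟩
          · exact absurd h1 h
          · obtain ⟨rfl⟩ := (pr_inj.1 e).2
            rw [ef] at h
            rw [h, hF0]
          · have := (pr_inj.1 e).1
            rw [Nat.cast_zero, ← msucc_eq] at this
            exact absurd this.symm (succ_ne _)
        | succ l ih =>
          rcases h2 _ (mem_lt h1).le with h | ⟨u, e, h⟩ | ⟨i, u, u', q, q', e, h3, h4, h5, h6⟩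
          · exact absurd h1 h
          · have := (pr_inj.1 e).1
            rw [Nat.cast_inj] at this
            omega
          · obtain ⟨i, rfl⟩ := NM_surj i
            obtain ⟨u, rfl⟩ := NM_surj u
            obtain ⟨q, rfl⟩ := NM_surj q
            obtain ⟨q', rfl⟩ := NM_surj q'
            obtain ⟨e1, e2⟩ := pr_inj.1 e
            subst e2
            have e3 : ((l + 1 : ℕ) : NM) = ((i + 1 : ℕ) : NM) := by
              rw [e1, Nat.cast_add, Nat.cast_one]
            rw [Nat.cast_inj] at e3
            obtain rfl : l = i := by omega
            have := ih u h3
            rw [Np_iff] at h4 h5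
            rw [eg] at h6
            rw [h6, h5, h4, this, hFs]
      · rintro rfl
        have : ∃ s : NM, ∀ t : NM, mem t s ↔ ∃ i : ℕ, i ≤ l ∧ t = pr (i : NM) ((F z i : ℕ) : NM) := by
          induction l with
          | zero =>
            obtain ⟨c, hc⟩ := mem_empty
            obtain ⟨c', hc'⟩ := mem_insert c (pr ((0 : ℕ) : NM) ((F z 0 : ℕ) : NM))
            refine ⟨c', fun t => ?_⟩
            rw [hc']
            constructor
            · rintro (h | h)
              · exact absurd h (hc _)
              · exact ⟨0, le_rfl, h⟩
            · rintro ⟨i, hi, h⟩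
              obtain rfl : i = 0 := by omega
              exact Or.inr h
          | succ l ih =>
            obtain ⟨c, hc⟩ := ih
            obtain ⟨c', hc'⟩ := mem_insert c (pr ((l + 1 : ℕ) : NM) ((F z (l + 1) : ℕ) : NM))
            refine ⟨c', fun t => ?_⟩
            rw [hc', hc]
            constructor
            · rintro (⟨i, hi, h⟩ | h)
              · exact ⟨i, by omega, h⟩
              · exact ⟨l + 1, le_rfl, h⟩
            · rintro ⟨i, hi, h⟩
              rcases Nat.lt_or_ge i (l + 1) with hi' | hi'
              · exact Or.inl ⟨i, by omega, h⟩
              · obtain rfl : i = l + 1 := by omega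
                exact Or.inr h
        obtain ⟨s, hs⟩ := this
        refine ⟨s, (hs _).2 ⟨l, le_rfl, rfl⟩, fun t _ => ?_⟩
        by_cases ht : mem t s
        · right
          obtain ⟨i, hi, rfl⟩ := (hs _).1 ht
          cases i with
          | zero => exact Or.inl ⟨_, rfl, by rw [ef, hF0]⟩
          | succ i =>
            refine Or.inr ⟨i, (F z i : ℕ), (F z (i + 1) : ℕ), (Nat.pair i (F z i) : ℕ),
              (Nat.pair z (Nat.pair i (F z i)) : ℕ), ?_, (hs _).2 ⟨i, by omega, rfl⟩,
              (Np_iff _ _ _).2 rfl, (Np_iff _ _ _).2 rfl, ?_⟩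
            · rw [Nat.cast_add, Nat.cast_one]
            · rw [eg, hFs]
        · exact Or.inl ht
    unfold Prc
    beta_reduce
    rw [ex_NM]
    simp only [ex_NM (p := fun l => Np _ l _ ∧ _), Np_iff, key]
    constructor
    · rintro ⟨z, l, rfl, h⟩
      simpa using h
    · intro h
      exact ⟨x.unpair.1, x.unpair.2, by simp, h⟩

theorem Primrec.gr {f : ℕ → ℕ} (hf : Nat.Primrec f) : GR f := by
  induction hf with
  | zero =>
    refine ⟨fun M x y => y = ((0 : ℕ) : M), (nice_Sg 1).d0 (D0.eq (Tmf.var _) (Tmf.cast 0)), fun x y => ?_⟩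
    beta_reduce
    rw [Nat.cast_inj]
  | succ =>
    refine ⟨fun M x y => y = x + 1, (nice_Sg 1).d0 (D0.eq (Tmf.var _) (Tmf.add (Tmf.var _) Tmf.one)), fun x y => ?_⟩
    beta_reduce
    rw [← Nat.cast_one, ← Nat.cast_add, Nat.cast_inj]
  | left =>
    refine ⟨fun M x y => ∃ z, Np y z x, Sg.ex (Np_sg (Tmf.var _) (Tmf.var _) (Tmf.var _)), fun x y => ?_⟩
    simp only [ex_NM, Np_iff]
    constructor
    · rintro ⟨z, rfl⟩; simp
    · rintro rfl; exact ⟨x.unpair.2, by simp⟩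
  | right =>
    refine ⟨fun M x y => ∃ z, Np z y x, Sg.ex (Np_sg (Tmf.var _) (Tmf.var _) (Tmf.var _)), fun x y => ?_⟩
    simp only [ex_NM, Np_iff]
    constructor
    · rintro ⟨z, rfl⟩; simp
    · rintro rfl; exact ⟨x.unpair.1, by simp⟩
  | pair _ _ ih1 ih2 =>
    obtain ⟨P, s1, e1⟩ := ih1
    obtain ⟨Q, s2, e2⟩ := ih2
    refine ⟨fun M x y => ∃ u, ∃ w, P M x u ∧ Q M x w ∧ Np u w y, Sg.ex (Sg.ex ((nice_Sg 1).and
      (ap2 s1 (Tmf.var _) (Tmf.var _)) ((nice_Sg 1).and (ap2 s2 (Tmf.var _) (Tmf.var _))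
      (Np_sg (Tmf.var _) (Tmf.var _) (Tmf.var _))))), fun x y => ?_⟩
    simp only [ex_NM, Np_iff, e1, e2]
    simp
  | comp _ _ ih1 ih2 =>
    obtain ⟨P, s1, e1⟩ := ih1
    obtain ⟨Q, s2, e2⟩ := ih2
    refine ⟨fun M x y => ∃ u, Q M x u ∧ P M u y, Sg.ex ((nice_Sg 1).and
      (ap2 s2 (Tmf.var _) (Tmf.var _)) (ap2 s1 (Tmf.var _) (Tmf.var _))), fun x y => ?_⟩
    simp only [ex_NM, e1, e2]
    simp
  | prec _ _ ih1 ih2 => exact GR.prec ih1 ih2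

/-- Projections of primitive recursive relations are represented by absolute formulas. -/
theorem repr_re {Q : ℕ → ℕ → ℕ → Prop} (h : PrimrecPred fun x : ℕ × ℕ × ℕ => Q x.1 x.2.1 x.2.2) :
    ∃ ρ : ∀ M : PM, M → M → M → Prop, D0 (m := 3) (fun M v => ρ M (v 0) (v 1) (v 2)) ∧
      ∀ d p : ℕ, (∃ n, Q d p n) ↔ ∃ w : ℕ, ∀ M : PM, ρ M (d : M) (p : M) (w : M) := by
  classical
  obtain ⟨f, hf, ef⟩ : ∃ f : ℕ → ℕ, Nat.Primrec f ∧ ∀ d p n,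
      f (Nat.pair d (Nat.pair p n)) = 1 ↔ Q d p n := by
    have := h.comp ((Primrec.fst.comp Primrec.unpair).pair ((Primrec.fst.comp (Primrec.unpair.comp
      (Primrec.snd.comp Primrec.unpair))).pair
      (Primrec.snd.comp (Primrec.unpair.comp (Primrec.snd.comp Primrec.unpair)))))
    refine ⟨fun n => if Q n.unpair.1 n.unpair.2.unpair.1 n.unpair.2.unpair.2 then 1 else 0, ?_, ?_⟩
    · exact Primrec.nat_iff.1 (Primrec.ite this (Primrec.const 1) (Primrec.const 0))
    · intro d p n
      simp
  obtain ⟨P, sP, eP⟩ := Primrec.gr hf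
  have h1 : Sg 1 (m := 2) (fun M v => ∃ n, ∃ q, ∃ r, Np (v 1) n q ∧ Np (v 0) q r ∧
      P M r ((1 : ℕ) : M)) := Sg.ex (Sg.ex (Sg.ex ((nice_Sg 1).and (Np_sg (Tmf.var _) (Tmf.var _) (Tmf.var _))
      ((nice_Sg 1).and (Np_sg (Tmf.var _) (Tmf.var _) (Tmf.var _)) (ap2 sP (Tmf.var _) (Tmf.cast 1))))))
  obtain ⟨R, hR, eR⟩ := h1
  have hR' : D0 (m := 3) (fun M v => R M (fun i => ![v 0, v 1] i) (v 2)) := by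
    have := nice_D0.dual.app1 (Q := R) hR (k := 3) (s := ![fun _ v => v 0, fun _ v => v 1])
      (fun i => by fin_cases i <;> exact Tmf.var _) (f := fun _ v => v 2) (Tmf.var _)
    have h2 : D0 (m := 3) _ := D0.not this
    simp only [not_not] at h2
    have e : (fun (M : PM) (v : Fin 3 → M) => R M (fun i => ![v 0, v 1] i) (v 2)) =
        fun (M : PM) (v : Fin 3 → M) => R M (fun i : Fin 2 => (![fun _ v => v 0, fun _ v => v 1] :
          Fin 2 → ∀ M : PM, (Fin 3 → M) → M) i M v) (v 2) := by
      funext M v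
      have : (fun i => ![v 0, v 1] i) = fun i : Fin 2 => (![fun _ v => v 0, fun _ v => v 1] :
          Fin 2 → ∀ M : PM, (Fin 3 → M) → M) i M v := by
        funext i
        fin_cases i <;> rfl
      rw [this]
    rw [e]
    exact h2
  refine ⟨fun M x y z => R M (fun i => ![x, y] i) z, hR', fun d p => ?_⟩
  have e1 : (∃ n, Q d p n) ↔ ∃ w : ℕ, R NM (fun i => ![(d : NM), (p : NM)] i) (w : NM) := by
    rw [← ex_NM (p := fun w => R NM (fun i => ![(d : NM), (p : NM)] i) w), ← eR]
    simp only [ex_NM]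
    change _ ↔ ∃ n q r : ℕ, Np (p : NM) (n : NM) (q : NM) ∧ Np (d : NM) (q : NM) (r : NM) ∧ _
    simp only [Np_iff, eP]
    refine exists_congr fun n => ?_
    rw [← ef]
    constructor
    · intro h
      exact ⟨_, _, rfl, rfl, h.symm⟩
    · rintro ⟨_, _, rfl, rfl, h⟩
      exact h.symm
  rw [e1]
  refine exists_congr fun w => ⟨fun h M => ?_, fun h => h NM⟩
  have a := hR'.abs NM M ![d, p, w]
  exact a.1 h


/-- Satisfaction of a clause. -/
def Cls (τ : ℕ → Bool) (c : List (ℕ × Bool)) : Prop := ∃ l ∈ c, τ l.1 = l.2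

/-- Primitive recursive clause sets with two parameters. -/
def PC (S : ℕ → ℕ → (ℕ → Bool) → Prop) : Prop :=
  ∃ F : ℕ × ℕ × ℕ → List (ℕ × Bool), Primrec F ∧ ∀ d p τ, S d p τ ↔ ∀ w, Cls τ (F (d, p, w))

theorem PC.of {α : Type} [Primcodable α] {S : ℕ → ℕ → (ℕ → Bool) → Prop}
    (f : ℕ × ℕ × α → List (ℕ × Bool)) (hf : Primrec f)
    (h : ∀ d p τ, S d p τ ↔ ∀ x : α, Cls τ (f (d, p, x))) : PC S := by
  refine ⟨fun q => Option.casesOn (Encodable.decode (α := α) q.2.2) [(0, true), (0, false)]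
    fun x => f (q.1, q.2.1, x), ?_, fun d p τ => ?_⟩
  · refine Primrec.option_casesOn (Primrec.decode.comp (Primrec.snd.comp Primrec.snd))
      (Primrec.const _) ?_
    exact (hf.comp (Primrec.pair (Primrec.fst.comp Primrec.fst) (Primrec.pair
      (Primrec.fst.comp (Primrec.snd.comp Primrec.fst)) Primrec.snd)))
  · rw [h]
    constructor
    · intro h w
      beta_reduce
      cases Encodable.decode (α := α) w with
      | none =>
        cases e : τ 0
        · exact ⟨(0, false), by simp, e⟩
        · exact ⟨(0, true), by simp, e⟩
      | some x => exact h x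
    · intro h x
      have := h (Encodable.encode x)
      simpa using this

theorem PC.and {S S' : ℕ → ℕ → (ℕ → Bool) → Prop} (h : PC S) (h' : PC S') :
    PC (fun d p τ => S d p τ ∧ S' d p τ) := by
  obtain ⟨F, hF, e⟩ := h
  obtain ⟨F', hF', e'⟩ := h'
  refine PC.of (α := Bool × ℕ) (fun q => cond q.2.2.1 (F (q.1, q.2.1, q.2.2.2)) (F' (q.1, q.2.1, q.2.2.2))) ?_ ?_
  · have h1 : Primrec fun q : ℕ × ℕ × Bool × ℕ => (q.1, q.2.1, q.2.2.2) :=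
      Primrec.pair Primrec.fst (Primrec.pair (Primrec.fst.comp Primrec.snd)
        (Primrec.snd.comp (Primrec.snd.comp Primrec.snd)))
    exact Primrec.cond (Primrec.fst.comp (Primrec.snd.comp Primrec.snd)) (hF.comp h1) (hF'.comp h1)
  · intro d p τ
    rw [e, e']
    constructor
    · rintro ⟨h1, h2⟩ ⟨b, w⟩
      cases b
      · exact h2 w
      · exact h1 w
    · intro h
      exact ⟨fun w => h (true, w), fun w => h (false, w)⟩

/-- Truth of a bit. -/
def bit (c i : ℕ) : Bool := decide (c / 2 ^ i % 2 = 1)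

theorem bit_eq (c i : ℕ) : bit c i = c.testBit i := by
  rw [bit, Nat.testBit_eq_decide_div_mod_eq]

theorem primrec_pow2 : Primrec (fun n : ℕ => 2 ^ n) := by
  have : Primrec (fun n : ℕ => Nat.rec (motive := fun _ => ℕ) 1 (fun _ r => 2 * r) n) :=
    Primrec.nat_rec' Primrec.id (Primrec.const 1)
      ((Primrec.nat_mul.comp (Primrec.const 2) (Primrec.snd.comp Primrec.snd)).to₂)
  refine this.of_eq fun n => ?_
  induction n with
  | zero => rfl
  | succ n ih => rw [pow_succ, ← ih, mul_comm]

theorem primrec_bit : Primrec₂ bit := by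
  unfold bit
  refine PrimrecPred.decide ?_
  exact PrimrecRel.comp Primrec.eq (Primrec.nat_mod.comp (Primrec.nat_div.comp Primrec.fst (primrec_pow2.comp Primrec.snd))
    (Primrec.const 2)) (Primrec.const 1)

/-- The finite unsatisfiability test. -/
def Tst (F : ℕ × ℕ × ℕ → List (ℕ × Bool)) (d p n : ℕ) : Prop :=
  ∀ c < 2 ^ n, ∃ w < n, ∀ l ∈ F (d, p, w), l.1 < n ∧ bit c l.1 ≠ l.2

theorem Tst_primrec {F : ℕ × ℕ × ℕ → List (ℕ × Bool)} (hF : Primrec F) :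
    PrimrecPred fun x : ℕ × ℕ × ℕ => Tst F x.1 x.2.1 x.2.2 := by
  classical
  unfold Tst
  have h1 : PrimrecRel fun (l : ℕ × Bool) (q : ℕ × ℕ) => l.1 < q.1 ∧ bit q.2 l.1 ≠ l.2 := by
    refine PrimrecPred.and ?_ ?_
    · exact Primrec.nat_lt.comp (Primrec.fst.comp Primrec.fst) (Primrec.fst.comp Primrec.snd)
    · exact PrimrecPred.not (Primrec.eq.comp (primrec_bit.comp (Primrec.snd.comp Primrec.snd)
        (Primrec.fst.comp Primrec.fst)) (Primrec.snd.comp Primrec.fst))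
  have h2 := PrimrecRel.forall_mem_list h1
  have h3 : PrimrecRel fun (w : ℕ) (q : (ℕ × ℕ × ℕ) × ℕ) =>
      ∀ l ∈ F (q.1.1, q.1.2.1, w), l.1 < q.1.2.2 ∧ bit q.2 l.1 ≠ l.2 := by
    refine h2.comp (f := fun x : ℕ × (ℕ × ℕ × ℕ) × ℕ => F (x.2.1.1, x.2.1.2.1, x.1))
      (g := fun x => (x.2.1.2.2, x.2.2)) ?_ ?_
    · exact hF.comp (Primrec.pair (Primrec.fst.comp (Primrec.fst.comp Primrec.snd)) (Primrec.pair
        (Primrec.fst.comp (Primrec.snd.comp (Primrec.fst.comp Primrec.snd))) Primrec.fst))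
    · exact Primrec.pair (Primrec.snd.comp (Primrec.snd.comp (Primrec.fst.comp Primrec.snd)))
        (Primrec.snd.comp Primrec.snd)
  have h4' := PrimrecRel.exists_mem_list h3
  have h4 := h4'.comp (f := fun y : ℕ × ((ℕ × ℕ × ℕ) × ℕ) => List.range y.1) (g := fun y => y.2)
    (Primrec.list_range.comp Primrec.fst) Primrec.snd
  simp only [List.mem_range] at h4
  have h5 : PrimrecRel fun (c : ℕ) (x : ℕ × ℕ × ℕ) => ∃ w < x.2.2,
      ∀ l ∈ F (x.1, x.2.1, w), l.1 < x.2.2 ∧ bit c l.1 ≠ l.2 := by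
    exact h4.comp (f := fun y : ℕ × (ℕ × ℕ × ℕ) => (y.2.2.2, (y.2, y.1))) (Primrec.pair
      (Primrec.snd.comp (Primrec.snd.comp Primrec.snd)) (Primrec.pair Primrec.snd Primrec.fst))
  have h6' := PrimrecRel.forall_mem_list h5
  have h6 := h6'.comp (f := fun y : ℕ × (ℕ × ℕ × ℕ) => List.range y.1) (g := fun y => y.2)
    (Primrec.list_range.comp Primrec.fst) Primrec.snd
  simp only [List.mem_range] at h6
  exact h6.comp (f := fun x : ℕ × ℕ × ℕ => (2 ^ x.2.2, x))
    (Primrec.pair (primrec_pow2.comp (Primrec.snd.comp Primrec.snd)) Primrec.id)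

theorem exists_bits (τ : ℕ → Bool) (n : ℕ) : ∃ c < 2 ^ n, ∀ i < n, bit c i = τ i := by
  refine ⟨Nat.ofBits (fun i : Fin n => τ i), Nat.ofBits_lt_two_pow _, fun i hi => ?_⟩
  rw [bit_eq, Nat.testBit_ofBits_lt _ _ hi]

theorem Tst_iff (F : ℕ × ℕ × ℕ → List (ℕ × Bool)) (d p : ℕ) :
    (∃ n, Tst F d p n) ↔ ¬ ∃ τ, ∀ w, Cls τ (F (d, p, w)) := by
  constructor
  · rintro ⟨n, hn⟩ ⟨τ, hτ⟩
    obtain ⟨c, hc, h⟩ := exists_bits τ n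
    obtain ⟨w, _, hw⟩ := hn c hc
    obtain ⟨l, hl, e⟩ := hτ w
    obtain ⟨h1, h2⟩ := hw l hl
    exact h2 (by rw [h _ h1, e])
  · intro hu
    by_contra hn
    apply hu
    simp only [not_exists, Tst, not_forall, not_and] at hn
    let K : ℕ → Set (ℕ → Bool) := fun n => {τ | ∀ w, w < n → ∃ l ∈ F (d, p, w), n ≤ l.1 ∨ τ l.1 = l.2}
    have hK : (⋂ n, K n).Nonempty := by
      have hcl : ∀ n, IsClosed (K n) := by
        intro n
        have : K n = ⋂ w, ⋂ (_ : w < n), ⋃ l ∈ {l | l ∈ F (d, p, w)}, {τ | n ≤ l.1 ∨ τ l.1 = l.2} := by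
          ext τ
          simp [K]
        rw [this]
        refine isClosed_iInter fun w => isClosed_iInter fun _ => ?_
        refine Set.Finite.isClosed_biUnion (List.finite_toSet _) fun l _ => ?_
        by_cases h : n ≤ l.1
        · simp [h]
        · simp only [h, false_or]
          exact isClosed_eq (continuous_apply _) continuous_const
      refine IsCompact.nonempty_iInter_of_sequence_nonempty_isCompact_isClosed K ?_ ?_ ?_ hcl
      · intro n τ hτ w hw
        obtain ⟨l, hl, h⟩ := hτ w (by omega)
        exact ⟨l, hl, h.imp (by omega) id⟩
      · intro n
        obtain ⟨c, hc, h⟩ := hn n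
        refine ⟨bit c, fun w hw => ?_⟩
        obtain ⟨l, hl, h'⟩ := h w hw
        refine ⟨l, hl, ?_⟩
        by_cases h1 : l.1 < n
        · exact Or.inr (by simpa using h' h1)
        · exact Or.inl (by omega)
      · exact (hcl 0).isCompact
    obtain ⟨τ, hτ⟩ := hK
    refine ⟨τ, fun w => ?_⟩
    have hb : ∃ b, ∀ l ∈ F (d, p, w), l.1 < b := by
      generalize F (d, p, w) = L
      induction L with
      | nil => exact ⟨0, by simp⟩
      | cons a L ih =>
        obtain ⟨b, hb⟩ := ih
        refine ⟨max b (a.1 + 1), fun l hl => ?_⟩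
        rcases List.mem_cons.1 hl with rfl | hl
        · omega
        · have := hb l hl
          omega
    obtain ⟨b, hb⟩ := hb
    obtain ⟨l, hl, h⟩ := Set.mem_iInter.1 hτ (max b (w + 1)) w (by omega)
    have := hb l hl
    exact ⟨l, hl, h.resolve_left (by omega)⟩

theorem PC.repr {S : ℕ → ℕ → (ℕ → Bool) → Prop} (h : PC S) :
    ∃ ρ : ∀ M : PM, M → M → M → Prop, D0 (m := 3) (fun M v => ρ M (v 0) (v 1) (v 2)) ∧
      ∀ d p : ℕ, (¬ ∃ τ, S d p τ) ↔ ∃ w : ℕ, ∀ M : PM, ρ M (d : M) (p : M) (w : M) := by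
  obtain ⟨F, hF, e⟩ := h
  obtain ⟨ρ, h1, h2⟩ := repr_re (Tst_primrec hF)
  refine ⟨ρ, h1, fun d p => ?_⟩
  rw [← h2, Tst_iff]
  simp only [e]


/-- Code of a term. -/
def ttree {n : ℕ} : LA.Term (Empty ⊕ Fin n) → ℕ
  | Term.var (Sum.inr i) => Nat.pair 0 i
  | @Term.func _ _ 0 _ _ => Nat.pair 1 0
  | @Term.func _ _ 1 _ ts => Nat.pair 2 (ttree (ts 0))
  | @Term.func _ _ 2 f ts => Nat.pair (cond f 4 3) (Nat.pair (ttree (ts 0)) (ttree (ts 1)))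

/-- Code of a formula. -/
def ftree : ∀ {n : ℕ}, LA.BoundedFormula Empty n → ℕ
  | _, BoundedFormula.falsum => Nat.pair 0 0
  | _, BoundedFormula.equal t u => Nat.pair 1 (Nat.pair (ttree t) (ttree u))
  | _, @BoundedFormula.rel _ _ _ 2 _ ts => Nat.pair 2 (Nat.pair (ttree (ts 0)) (ttree (ts 1)))
  | _, BoundedFormula.imp a b => Nat.pair 3 (Nat.pair (ftree a) (ftree b))
  | _, BoundedFormula.all a => Nat.pair 4 (ftree a)

theorem term_ind {n : ℕ} {P : LA.Term (Empty ⊕ Fin n) → Prop} (hv : ∀ i, P (vT i))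
    (hz : P zeroT) (hs : ∀ t, P t → P (succT t)) (ha : ∀ t u, P t → P u → P (addT t u))
    (hm : ∀ t u, P t → P u → P (mulT t u)) (t : LA.Term (Empty ⊕ Fin n)) : P t := by
  induction t with
  | var i =>
    rcases i with i | i
    · exact i.elim
    · exact hv i
  | @func l f ts ih =>
    match l, f, ts, ih with
    | 0, f, ts, ih =>
      have : (Term.func f ts : LA.Term (Empty ⊕ Fin n)) = zeroT := by
        cases f
        exact congrArg _ (funext fun i => i.elim0)
      rw [this]; exact hz
    | 1, f, ts, ih =>
      have : (Term.func f ts : LA.Term (Empty ⊕ Fin n)) = succT (ts 0) := by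
        cases f
        refine congrArg (Term.func _) (funext fun i => ?_)
        fin_cases i; rfl
      rw [this]; exact hs _ (ih 0)
    | 2, false, ts, ih =>
      have : (Term.func (l := 2) (show LA.Functions 2 from false) ts : LA.Term (Empty ⊕ Fin n)) = addT (ts 0) (ts 1) := by
        refine congrArg (Term.func _) (funext fun i => ?_)
        fin_cases i <;> rfl
      exact this ▸ ha _ _ (ih 0) (ih 1)
    | 2, true, ts, ih =>
      have : (Term.func (l := 2) (show LA.Functions 2 from true) ts : LA.Term (Empty ⊕ Fin n)) = mulT (ts 0) (ts 1) := by
        refine congrArg (Term.func _) (funext fun i => ?_)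
        fin_cases i <;> rfl
      exact this ▸ hm _ _ (ih 0) (ih 1)

theorem ttree_v {n : ℕ} (i : Fin n) : ttree (vT i) = Nat.pair 0 i := rfl
theorem ttree_z {n : ℕ} : ttree (n := n) zeroT = Nat.pair 1 0 := rfl
theorem ttree_s {n : ℕ} (t : LA.Term (Empty ⊕ Fin n)) : ttree (succT t) = Nat.pair 2 (ttree t) := rfl
theorem ttree_a {n : ℕ} (t u : LA.Term (Empty ⊕ Fin n)) :
    ttree (addT t u) = Nat.pair 3 (Nat.pair (ttree t) (ttree u)) := rfl
theorem ttree_m {n : ℕ} (t u : LA.Term (Empty ⊕ Fin n)) :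
    ttree (mulT t u) = Nat.pair 4 (Nat.pair (ttree t) (ttree u)) := rfl

theorem fml_ind {P : ∀ n : ℕ, LA.BoundedFormula Empty n → Prop} (hf : ∀ n, P n ⊥)
    (he : ∀ n (t u : LA.Term (Empty ⊕ Fin n)), P n (Term.bdEqual t u))
    (hl : ∀ n (t u : LA.Term (Empty ⊕ Fin n)), P n (leF t u))
    (hi : ∀ n (a b : LA.BoundedFormula Empty n), P n a → P n b → P n (a.imp b))
    (ha : ∀ n (a : LA.BoundedFormula Empty (n + 1)), P (n + 1) a → P n a.all)
    (n : ℕ) (a : LA.BoundedFormula Empty n) : P n a := by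
  induction a with
  | falsum => exact hf _
  | equal t u => exact he _ t u
  | @rel n l R ts =>
    match l, R, ts with
    | 2, R, ts =>
      have : (BoundedFormula.rel R ts : LA.BoundedFormula Empty n) = leF (ts 0) (ts 1) := by
        refine congrArg (BoundedFormula.rel _) (funext fun i => ?_)
        fin_cases i <;> rfl
      rw [this]; exact hl _ _ _
  | imp a b iha ihb => exact hi _ _ _ iha ihb
  | all a ih => exact ha _ _ ih

theorem ftree_f {n : ℕ} : ftree (⊥ : LA.BoundedFormula Empty n) = Nat.pair 0 0 := rfl
theorem ftree_e {n : ℕ} (t u : LA.Term (Empty ⊕ Fin n)) :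
    ftree (Term.bdEqual t u) = Nat.pair 1 (Nat.pair (ttree t) (ttree u)) := rfl
theorem ftree_l {n : ℕ} (t u : LA.Term (Empty ⊕ Fin n)) :
    ftree (leF t u) = Nat.pair 2 (Nat.pair (ttree t) (ttree u)) := rfl
theorem ftree_i {n : ℕ} (a b : LA.BoundedFormula Empty n) :
    ftree (a.imp b) = Nat.pair 3 (Nat.pair (ftree a) (ftree b)) := rfl
theorem ftree_a {n : ℕ} (a : LA.BoundedFormula Empty (n + 1)) :
    ftree a.all = Nat.pair 4 (ftree a) := rfl

/-- Domain codes. -/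
def dS (i : ℕ) : ℕ := Nat.pair 1 i
def dA (i j : ℕ) : ℕ := Nat.pair 2 (Nat.pair i j)
def dM (i j : ℕ) : ℕ := Nat.pair 3 (Nat.pair i j)
def dW (t : ℕ) (a : List ℕ) : ℕ := Nat.pair 4 (Nat.pair t (Encodable.encode a))
def dV (t : ℕ) (a : List ℕ) : ℕ := Nat.pair 5 (Nat.pair t (Encodable.encode a))
def eqA (i j : ℕ) : ℕ := Nat.pair 0 (Nat.pair i j)
def leA (i j : ℕ) : ℕ := Nat.pair 1 (Nat.pair i j)
def trA (t : ℕ) (a : List ℕ) : ℕ := Nat.pair 2 (Nat.pair t (Encodable.encode a))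

/-- The Henkin clauses. -/
def hcl (i j k l : ℕ) (a : List ℕ) : List (List (ℕ × Bool)) :=
  [ [(eqA i i, true)],
   [(eqA i j, false), (eqA j i, true)],
   [(eqA i j, false), (eqA j k, false), (eqA i k, true)],
   [(eqA i j, false), (eqA (dS i) (dS j), true)],
   [(eqA i j, false), (eqA k l, false), (eqA (dA i k) (dA j l), true)],
   [(eqA i j, false), (eqA k l, false), (eqA (dM i k) (dM j l), true)],
   [(eqA i j, false), (eqA k l, false), (leA i k, false), (leA j l, true)],
   [(eqA (dV (Nat.pair 0 i) a) (a.getD i 0), true)],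
   [(eqA (dV (Nat.pair 1 0) a) 0, true)],
   [(eqA (dV (Nat.pair 2 i) a) (dS (dV i a)), true)],
   [(eqA (dV (Nat.pair 3 (Nat.pair i j)) a) (dA (dV i a) (dV j a)), true)],
   [(eqA (dV (Nat.pair 4 (Nat.pair i j)) a) (dM (dV i a) (dV j a)), true)],
   [(trA (Nat.pair 0 0) a, false)],
   [(trA (Nat.pair 1 (Nat.pair i j)) a, false), (eqA (dV i a) (dV j a), true)],
   [(trA (Nat.pair 1 (Nat.pair i j)) a, true), (eqA (dV i a) (dV j a), false)],
   [(trA (Nat.pair 2 (Nat.pair i j)) a, false), (leA (dV i a) (dV j a), true)],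
   [(trA (Nat.pair 2 (Nat.pair i j)) a, true), (leA (dV i a) (dV j a), false)],
   [(trA (Nat.pair 3 (Nat.pair i j)) a, false), (trA i a, false), (trA j a, true)],
   [(trA (Nat.pair 3 (Nat.pair i j)) a, true), (trA i a, true)],
   [(trA (Nat.pair 3 (Nat.pair i j)) a, true), (trA j a, false)],
   [(trA (Nat.pair 4 i) a, false), (trA i (a ++ [j]), true)],
   [(trA (Nat.pair 4 i) a, true), (trA i (a ++ [dW i a]), false)] ]

theorem p_pair {α : Type} [Primcodable α] {f g : α → ℕ} (hf : Primrec f) (hg : Primrec g) :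
    Primrec (fun x => Nat.pair (f x) (g x)) := Primrec₂.natPair.comp hf hg
theorem p_enc {α : Type} [Primcodable α] {f : α → List ℕ} (hf : Primrec f) :
    Primrec (fun x => Encodable.encode (f x)) := Primrec.encode.comp hf
theorem p_cons {α β : Type} [Primcodable α] [Primcodable β] {f : α → β} {g : α → List β}
    (hf : Primrec f) (hg : Primrec g) : Primrec (fun x => f x :: g x) := Primrec.list_cons.comp hf hg
theorem p_app {α β : Type} [Primcodable α] [Primcodable β] {f g : α → List β}
    (hf : Primrec f) (hg : Primrec g) : Primrec (fun x => f x ++ g x) := Primrec.list_append.comp hf hg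
theorem p_getD {α : Type} [Primcodable α] {f : α → List ℕ} {g : α → ℕ}
    (hf : Primrec f) (hg : Primrec g) : Primrec (fun x => (f x).getD (g x) 0) :=
  (Primrec.list_getD 0).comp hf hg

theorem hcl_primrec : Primrec (fun x : ℕ × ℕ × ℕ × ℕ × List ℕ =>
    hcl x.1 x.2.1 x.2.2.1 x.2.2.2.1 x.2.2.2.2) := by
  have h2 : Primrec (fun x : ℕ × ℕ × ℕ × ℕ × List ℕ => x.2) := Primrec.snd
  have h22 : Primrec (fun x : ℕ × ℕ × ℕ × ℕ × List ℕ => x.2.2) := Primrec.snd.comp h2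
  have h222 : Primrec (fun x : ℕ × ℕ × ℕ × ℕ × List ℕ => x.2.2.2) := Primrec.snd.comp h22
  have p0 : Primrec (fun x : ℕ × ℕ × ℕ × ℕ × List ℕ => x.1) := Primrec.fst
  have p1 : Primrec (fun x : ℕ × ℕ × ℕ × ℕ × List ℕ => x.2.1) := Primrec.fst.comp h2
  have p2 : Primrec (fun x : ℕ × ℕ × ℕ × ℕ × List ℕ => x.2.2.1) := Primrec.fst.comp h22
  have p3 : Primrec (fun x : ℕ × ℕ × ℕ × ℕ × List ℕ => x.2.2.2.1) := Primrec.fst.comp h222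
  have p4 : Primrec (fun x : ℕ × ℕ × ℕ × ℕ × List ℕ => x.2.2.2.2) := Primrec.snd.comp h222
  unfold hcl eqA leA trA dS dA dM dV dW
  repeat' first
    | with_reducible exact Primrec.const _
    | with_reducible exact p0
    | with_reducible exact p1
    | with_reducible exact p2
    | with_reducible exact p3
    | with_reducible exact p4
    | with_reducible apply p_pair
    | with_reducible apply p_enc
    | with_reducible apply p_getD
    | with_reducible apply p_cons
    | with_reducible apply p_app
    | with_reducible apply Primrec.pair

/-- All Henkin clauses hold. -/
def Hk (τ : ℕ → Bool) : Prop := ∀ i j k l a, ∀ c ∈ hcl i j k l a, Cls τ c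

theorem PC.hk : PC (fun _ _ τ => Hk τ) := by
  refine PC.of (α := ℕ × ℕ × ℕ × ℕ × ℕ × List ℕ) (fun q =>
    (hcl q.2.2.2.1 q.2.2.2.2.1 q.2.2.2.2.2.1 q.2.2.2.2.2.2.1 q.2.2.2.2.2.2.2).getD q.2.2.1 [(0, true), (0, false)]) ?_ ?_
  · refine (Primrec.list_getD _).comp (hcl_primrec.comp ?_) ?_
    · exact Primrec.snd.comp (Primrec.snd.comp Primrec.snd)
    · exact Primrec.fst.comp (Primrec.snd.comp Primrec.snd)
  · intro d p τ
    constructor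
    · rintro h ⟨n, i, j, k, l, a⟩
      beta_reduce
      rcases lt_or_ge n (hcl i j k l a).length with hn | hn
      · simp only
        rw [List.getD_eq_getElem _ _ hn]
        exact h i j k l a _ (List.getElem_mem _)
      · simp only
        rw [List.getD_eq_default _ _ hn]
        cases e : τ 0
        · exact ⟨(0, false), by simp, e⟩
        · exact ⟨(0, true), by simp, e⟩
    · intro h i j k l a c hc
      obtain ⟨n, hn, rfl⟩ := List.getElem_of_mem hc
      have := h (n, i, j, k, l, a)
      simp only at this
      rwa [List.getD_eq_getElem _ _ hn] at this

/-- Numerals. -/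
def numD (d : ℕ) : ℕ := dS^[d] 0

theorem numD_primrec : Primrec numD := by
  have : Primrec (fun n : ℕ => (Nat.rec 0 (fun _ y => dS y) n : ℕ)) :=
    Primrec.nat_rec₁ 0 ((p_pair (Primrec.const 1) Primrec.snd : Primrec fun x : ℕ × ℕ => Nat.pair 1 x.2))
  refine this.of_eq fun n => ?_
  induction n with
  | zero => rfl
  | succ n ih => simp only [numD, Function.iterate_succ', Function.comp] at ih ⊢; rw [← ih]

/-- The clause set whose satisfiability expresses consistency of `T + A(d) + B(p)`. -/
def Sat (h : ℕ → Option ℕ) (A B : ℕ) (d p : ℕ) (τ : ℕ → Bool) : Prop :=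
  Hk τ ∧ (∀ x t, h x = some t → τ (trA t []) = true) ∧
    τ (trA A [numD d]) = true ∧ τ (trA B [numD p]) = true

theorem PC.sat {h : ℕ → Option ℕ} (hh : Primrec h) (A B : ℕ) : PC (Sat h A B) := by
  refine PC.hk.and (PC.and ?_ (PC.and ?_ ?_))
  · refine PC.of (α := ℕ) (fun q => Option.casesOn (h q.2.2) [(0, true), (0, false)]
      fun t => [(trA t [], true)]) ?_ ?_
    · refine Primrec.option_casesOn (hh.comp (Primrec.snd.comp Primrec.snd)) (Primrec.const _) ?_
      unfold trA
      exact p_cons (Primrec.pair (p_pair (Primrec.const _) (p_pair Primrec.snd (Primrec.const _)))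
        (Primrec.const _)) (Primrec.const _)
    · intro d p τ
      refine forall_congr' fun x => ?_
      simp only
      cases h x with
      | none =>
        simp only [reduceCtorEq, false_imp_iff, implies_true, true_iff]
        cases e : τ 0
        · exact ⟨(0, false), by simp, e⟩
        · exact ⟨(0, true), by simp, e⟩
      | some t => simp [Cls]
  · refine PC.of (α := Unit) (fun q => [(trA A [numD q.1], true)]) ?_ ?_
    · unfold trA
      exact p_cons (Primrec.pair (p_pair (Primrec.const _) (p_pair (Primrec.const _) (p_enc
        (p_cons (numD_primrec.comp Primrec.fst) (Primrec.const _)))))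
        (Primrec.const _)) (Primrec.const _)
    · intro d p τ
      simp [Cls]
  · refine PC.of (α := Unit) (fun q => [(trA B [numD q.2.1], true)]) ?_ ?_
    · unfold trA
      exact p_cons (Primrec.pair (p_pair (Primrec.const _) (p_pair (Primrec.const _) (p_enc
        (p_cons (numD_primrec.comp (Primrec.fst.comp Primrec.snd)) (Primrec.const _)))))
        (Primrec.const _)) (Primrec.const _)
    · intro d p τ
      simp [Cls]


theorem Hk.facts {τ : ℕ → Bool} (h : Hk τ) (i j k l : ℕ) (a : List ℕ) :
    τ (eqA i i) = true ∧ (τ (eqA i j) = true → τ (eqA j i) = true) ∧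
    (τ (eqA i j) = true → τ (eqA j k) = true → τ (eqA i k) = true) ∧
    (τ (eqA i j) = true → τ (eqA (dS i) (dS j)) = true) ∧
    (τ (eqA i j) = true → τ (eqA k l) = true → τ (eqA (dA i k) (dA j l)) = true) ∧
    (τ (eqA i j) = true → τ (eqA k l) = true → τ (eqA (dM i k) (dM j l)) = true) ∧
    (τ (eqA i j) = true → τ (eqA k l) = true → τ (leA i k) = true → τ (leA j l) = true) ∧
    τ (eqA (dV (Nat.pair 0 i) a) (a.getD i 0)) = true ∧
    τ (eqA (dV (Nat.pair 1 0) a) 0) = true ∧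
    τ (eqA (dV (Nat.pair 2 i) a) (dS (dV i a))) = true ∧
    τ (eqA (dV (Nat.pair 3 (Nat.pair i j)) a) (dA (dV i a) (dV j a))) = true ∧
    τ (eqA (dV (Nat.pair 4 (Nat.pair i j)) a) (dM (dV i a) (dV j a))) = true ∧
    τ (trA (Nat.pair 0 0) a) = false ∧
    (τ (trA (Nat.pair 1 (Nat.pair i j)) a) = true ↔ τ (eqA (dV i a) (dV j a)) = true) ∧
    (τ (trA (Nat.pair 2 (Nat.pair i j)) a) = true ↔ τ (leA (dV i a) (dV j a)) = true) ∧
    (τ (trA (Nat.pair 3 (Nat.pair i j)) a) = true ↔ (τ (trA i a) = true → τ (trA j a) = true)) ∧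
    (τ (trA (Nat.pair 4 i) a) = true → τ (trA i (a ++ [j])) = true) ∧
    (τ (trA i (a ++ [dW i a])) = true → τ (trA (Nat.pair 4 i) a) = true) := by
  have := h i j k l a
  simp only [hcl, List.forall_mem_cons, Cls, List.exists_mem_cons_iff, List.not_mem_nil, false_and,
    exists_false, or_false, false_imp_iff, implies_true, and_true] at this
  generalize τ (eqA i i) = b1 at *
  obtain ⟨h1, h2, h3, h4, h5, h6, h7, h8, h9, h10, h11, h12, h13, h14, h15, h16, h17, h18, h19, h20, h21, h22⟩ := this
  refine ⟨h1, ?_, ?_, ?_, ?_, ?_, ?_, h8, h9, h10, h11, h12, h13, ?_, ?_, ?_, ?_, ?_⟩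
  all_goals clear h1 h8 h9 h10 h11 h12 h13
  · clear h3 h4 h5 h6 h7 h14 h15 h16 h17 h18 h19 h20 h21 h22; grind
  · clear h2 h4 h5 h6 h7 h14 h15 h16 h17 h18 h19 h20 h21 h22; grind
  · clear h2 h3 h5 h6 h7 h14 h15 h16 h17 h18 h19 h20 h21 h22; grind
  · clear h2 h3 h4 h6 h7 h14 h15 h16 h17 h18 h19 h20 h21 h22; grind
  · clear h2 h3 h4 h5 h7 h14 h15 h16 h17 h18 h19 h20 h21 h22; grind
  · clear h2 h3 h4 h5 h6 h14 h15 h16 h17 h18 h19 h20 h21 h22; grind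
  · clear h2 h3 h4 h5 h6 h7 h16 h17 h18 h19 h20 h21 h22; grind
  · clear h2 h3 h4 h5 h6 h7 h14 h15 h18 h19 h20 h21 h22; grind
  · clear h2 h3 h4 h5 h6 h7 h14 h15 h16 h17 h21 h22; grind
  · clear h2 h3 h4 h5 h6 h7 h14 h15 h16 h17 h18 h19 h20 h22; grind
  · clear h2 h3 h4 h5 h6 h7 h14 h15 h16 h17 h18 h19 h20 h21; grind

/-- Equality of domain codes. -/
def hset {τ : ℕ → Bool} (h : Hk τ) : Setoid ℕ where
  r i j := τ (eqA i j) = true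
  iseqv := ⟨fun i => (h.facts i i i i []).1, fun {i j} => (h.facts i j i i []).2.1,
    fun {i j k} => (h.facts i j k i []).2.2.1⟩

/-- The Henkin structure. -/
@[reducible] def hstr {τ : ℕ → Bool} (h : Hk τ) : LA.Structure (Quotient (hset h)) where
  funMap {n} f v := match n, f, v with
    | 0, _, _ => Quotient.mk _ 0
    | 1, _, v => Quotient.map dS (fun i j e => (h.facts i j i i []).2.2.2.1 e) (v 0)
    | 2, false, v => Quotient.map₂ dA (fun i j e k l e' => (h.facts i j k l []).2.2.2.2.1 e e') (v 0) (v 1)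
    | 2, true, v => Quotient.map₂ dM (fun i j e k l e' => (h.facts i j k l []).2.2.2.2.2.1 e e') (v 0) (v 1)
  RelMap {n} r v := match n, r, v with
    | 2, _, v => Quotient.liftOn₂ (v 0) (v 1) (fun i j => τ (leA i j) = true) (fun i k j l e e' => by
        have e1 := (h.facts i j k l []).2.2.2.2.2.2.1 e e'
        have e2 := (h.facts j i l k []).2.2.2.2.2.2.1 ((hset h).symm e) ((hset h).symm e')
        exact propext ⟨e1, e2⟩)

section
variable {τ : ℕ → Bool} (h : Hk τ)

theorem hk_term {n : ℕ} (a : List ℕ) (t : LA.Term (Empty ⊕ Fin n)) :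
    @Term.realize LA (Quotient (hset h)) (hstr h) _
      (Sum.elim (default : Empty → _) (fun i : Fin n => Quotient.mk _ (a.getD i 0))) t =
    Quotient.mk _ (dV (ttree t) a) := by
  let _ := hstr h
  refine term_ind (P := fun t => @Term.realize LA (Quotient (hset h)) (hstr h) _
      (Sum.elim (default : Empty → _) (fun i : Fin n => Quotient.mk _ (a.getD i 0))) t =
    Quotient.mk _ (dV (ttree t) a)) ?_ ?_ ?_ ?_ ?_ t
  · intro i
    rw [r_vT]
    exact Quotient.sound ((hset h).symm (h.facts i i i i a).2.2.2.2.2.2.2.1)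
  · rw [r_zeroT]
    exact Quotient.sound ((hset h).symm (h.facts 0 0 0 0 a).2.2.2.2.2.2.2.2.1)
  · intro t ih
    rw [r_succT, ih]
    exact Quotient.sound ((hset h).symm (h.facts _ 0 0 0 a).2.2.2.2.2.2.2.2.2.1)
  · intro t u ih ih'
    rw [r_addT, ih, ih']
    exact Quotient.sound ((hset h).symm (h.facts _ _ 0 0 a).2.2.2.2.2.2.2.2.2.2.1)
  · intro t u ih ih'
    rw [r_mulT, ih, ih']
    exact Quotient.sound ((hset h).symm (h.facts _ _ 0 0 a).2.2.2.2.2.2.2.2.2.2.2.1)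

theorem hk_truth (n : ℕ) (φ : LA.BoundedFormula Empty n) : ∀ (a : List ℕ), a.length = n →
    (@BoundedFormula.Realize LA (Quotient (hset h)) (hstr h) _ _ φ
      (default : Empty → _) (fun i : Fin n => Quotient.mk _ (a.getD i 0)) ↔
    τ (trA (ftree φ) a) = true) := by
  let _ := hstr h
  refine fml_ind (P := fun n φ => ∀ (a : List ℕ), a.length = n →
    (@BoundedFormula.Realize LA (Quotient (hset h)) (hstr h) _ _ φ
      (default : Empty → _) (fun i : Fin n => Quotient.mk _ (a.getD i 0)) ↔
    τ (trA (ftree φ) a) = true)) ?_ ?_ ?_ ?_ ?_ n φ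
  · intro n a _
    have := (h.facts 0 0 0 0 a).2.2.2.2.2.2.2.2.2.2.2.2.1
    rw [ftree_f, this]
    simp
  · intro n t u a _
    have := (h.facts (ttree t) (ttree u) 0 0 a).2.2.2.2.2.2.2.2.2.2.2.2.2.1
    rw [ftree_e, this, BoundedFormula.realize_bdEqual, hk_term, hk_term]
    exact ⟨fun e => Quotient.exact e, fun e => Quotient.sound e⟩
  · intro n t u a _
    have := (h.facts (ttree t) (ttree u) 0 0 a).2.2.2.2.2.2.2.2.2.2.2.2.2.2.1
    rw [ftree_l, this, r_leF, hk_term, hk_term]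
    exact Iff.rfl
  · intro n b c ih ih' a ha
    have := (h.facts (ftree b) (ftree c) 0 0 a).2.2.2.2.2.2.2.2.2.2.2.2.2.2.2.1
    rw [ftree_i, this, BoundedFormula.realize_imp, ih a ha, ih' a ha]
  · intro n b ih a ha
    have h1 := fun j => (h.facts (ftree b) j 0 0 a).2.2.2.2.2.2.2.2.2.2.2.2.2.2.2.2.1
    have h2 := (h.facts (ftree b) 0 0 0 a).2.2.2.2.2.2.2.2.2.2.2.2.2.2.2.2.2
    have key : ∀ j : ℕ, (BoundedFormula.Realize (L := LA) b (default : Empty → _)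
        (Fin.snoc (fun i : Fin n => Quotient.mk (hset h) (a.getD i 0)) (Quotient.mk (hset h) j)) ↔
        τ (trA (ftree b) (a ++ [j])) = true) := by
      intro j
      rw [← ih (a ++ [j]) (by simp [ha])]
      refine iff_of_eq (congrArg _ (funext fun i => ?_))
      refine Fin.lastCases ?_ (fun i => ?_) i
      · rw [Fin.snoc_last, Fin.val_last, ← ha]
        simp
      · rw [Fin.snoc_castSucc, Fin.val_castSucc, List.getD_append _ _ _ _ (by omega)]
    rw [ftree_a, BoundedFormula.realize_all]
    constructor
    · intro hx
      exact h2 ((key _).1 (hx _))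
    · intro ht x
      obtain ⟨j, rfl⟩ := Quotient.exists_rep x
      exact (key j).2 (h1 j ht)

end

/-- Numerals in arbitrary structures. -/
def numM (M : Type) [LA.Structure M] (d : ℕ) : M := msucc^[d] (mzero M)

theorem hk_num {τ : ℕ → Bool} (h : Hk τ) (d : ℕ) :
    @numM (Quotient (hset h)) (hstr h) d = Quotient.mk _ (numD d) := by
  let _ := hstr h
  induction d with
  | zero => rfl
  | succ d ih =>
    simp only [numM, numD, Function.iterate_succ', Function.comp] at ih ⊢
    rw [ih]; rfl

theorem sat_model {T : Thy} {g : ℕ → Option ℕ} (hg : ∀ t, (∃ x, g x = some t) ↔ ∃ φ ∈ T, ftree φ = t)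
    {A B : LA.BoundedFormula Empty 1} {d p : ℕ} {τ : ℕ → Bool} (hs : Sat g (ftree A) (ftree B) d p τ) :
    ∃ M : Theory.ModelType.{0, 0, 0} T, A.Realize (default : Empty → M) (fun _ => numM M d) ∧
      B.Realize (default : Empty → M) (fun _ => numM M p) := by
  obtain ⟨h, h1, h2, h3⟩ := hs
  let _ := hstr h
  have hne : Nonempty (Quotient (hset h)) := ⟨Quotient.mk _ 0⟩
  have hm : (Quotient (hset h)) ⊨ T := by
    refine ⟨fun φ hφ => ?_⟩
    obtain ⟨x, hx⟩ := (hg (ftree φ)).2 ⟨φ, hφ, rfl⟩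
    have := (hk_truth h 0 φ [] rfl).2 (h1 x _ hx)
    rw [Sentence.Realize, Formula.Realize]
    convert this
  refine ⟨Theory.ModelType.of T (Quotient (hset h)), ?_, ?_⟩
  · have := (hk_truth h 1 A [numD d] rfl).2 h2
    have e : (fun i : Fin 1 => Quotient.mk (hset h) ([numD d].getD i 0)) =
        fun _ => numM (Quotient (hset h)) d := by
      funext i
      obtain rfl : i = 0 := Subsingleton.elim _ _
      exact (hk_num h d).symm
    rw [e] at this
    exact (congrArg (fun v => A.Realize (M := Quotient (hset h)) v (fun _ => numM (Quotient (hset h)) d))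
      (Subsingleton.elim (α := Empty → Quotient (hset h)) _ _)).mp this
  · have := (hk_truth h 1 B [numD p] rfl).2 h3
    have e : (fun i : Fin 1 => Quotient.mk (hset h) ([numD p].getD i 0)) =
        fun _ => numM (Quotient (hset h)) p := by
      funext i
      obtain rfl : i = 0 := Subsingleton.elim _ _
      exact (hk_num h p).symm
    rw [e] at this
    exact (congrArg (fun v => B.Realize (M := Quotient (hset h)) v (fun _ => numM (Quotient (hset h)) p))
      (Subsingleton.elim (α := Empty → Quotient (hset h)) _ _)).mp this


theorem exists_rec {X : Type} [Inhabited X] (G : ℕ → (ℕ → X) → X) :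
    ∃ g : ℕ → X, ∀ n, g n = G n (fun m => if m < n then g m else default) := by
  classical
  let F : ∀ n : ℕ, (∀ m, m < n → X) → X := fun n ih => G n (fun m => if h : m < n then ih m h else default)
  have wf : WellFounded (fun a b : ℕ => a < b) := wellFounded_lt
  refine ⟨fun n => wf.fix (C := fun _ => X) F n, fun n => ?_⟩
  refine (wf.fix_eq (C := fun _ => X) F n).trans ?_
  show G n _ = G n _
  congr 1

theorem pair_l (k i : ℕ) (hk : 0 < k) : i < Nat.pair k i := by
  have := Nat.add_le_pair k i; omega

theorem le_pair_l (i j : ℕ) : i ≤ Nat.pair i j := Nat.left_le_pair i j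
theorem le_pair_r (i j : ℕ) : j ≤ Nat.pair i j := Nat.right_le_pair i j

theorem mem_lt_encode (a : List ℕ) : ∀ x ∈ a, x < Encodable.encode a := by
  induction a with
  | nil => simp
  | cons y a ih =>
    intro x hx
    rw [Encodable.encode_list_cons]
    have h1 := Nat.left_le_pair (Encodable.encode y) (Encodable.encode a)
    have h2 := Nat.right_le_pair (Encodable.encode y) (Encodable.encode a)
    rcases List.mem_cons.1 hx with rfl | hx
    · simp only [Encodable.encode_nat] at h1 ⊢; omega
    · have := ih x hx
      omega

section
variable (M : Type) [LA.Structure M] [Inhabited M]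

theorem exists_tval : ∃ g : ℕ → List M → M,
    (∀ i a, g (Nat.pair 0 i) a = a.getD i (mzero M)) ∧
    (∀ a, g (Nat.pair 1 0) a = mzero M) ∧
    (∀ i a, g (Nat.pair 2 i) a = msucc (g i a)) ∧
    (∀ i j a, g (Nat.pair 3 (Nat.pair i j)) a = madd (g i a) (g j a)) ∧
    (∀ i j a, g (Nat.pair 4 (Nat.pair i j)) a = mmul (g i a) (g j a)) := by
  obtain ⟨g, hg⟩ := exists_rec (X := List M → M) (fun n r a =>
    match n.unpair.1 with
    | 0 => a.getD n.unpair.2 (mzero M)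
    | 1 => mzero M
    | 2 => msucc (r n.unpair.2 a)
    | 3 => madd (r n.unpair.2.unpair.1 a) (r n.unpair.2.unpair.2 a)
    | _ => mmul (r n.unpair.2.unpair.1 a) (r n.unpair.2.unpair.2 a))
  refine ⟨g, fun i a => ?_, fun a => ?_, fun i a => ?_, fun i j a => ?_, fun i j a => ?_⟩
  · rw [hg]; simp
  · rw [hg]; simp
  · have := pair_l 2 i (by omega)
    rw [hg]; simp [this]
  all_goals
    have h1 := le_pair_l i j
    have h2 := le_pair_r i j
    rw [hg]
  · have := pair_l 3 (Nat.pair i j) (by omega)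
    simp [show i < Nat.pair 3 (Nat.pair i j) by omega, show j < Nat.pair 3 (Nat.pair i j) by omega]
  · have := pair_l 4 (Nat.pair i j) (by omega)
    simp [show i < Nat.pair 4 (Nat.pair i j) by omega, show j < Nat.pair 4 (Nat.pair i j) by omega]

theorem exists_tru (tv : ℕ → List M → M) : ∃ g : ℕ → List M → Prop,
    (∀ a, g (Nat.pair 0 0) a ↔ False) ∧
    (∀ i j a, g (Nat.pair 1 (Nat.pair i j)) a ↔ tv i a = tv j a) ∧
    (∀ i j a, g (Nat.pair 2 (Nat.pair i j)) a ↔ mle (tv i a) (tv j a)) ∧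
    (∀ i j a, g (Nat.pair 3 (Nat.pair i j)) a ↔ (g i a → g j a)) ∧
    (∀ i a, g (Nat.pair 4 i) a ↔ ∀ x, g i (a ++ [x])) := by
  obtain ⟨g, hg⟩ := exists_rec (X := List M → Prop) (fun n r a =>
    match n.unpair.1 with
    | 0 => False
    | 1 => tv n.unpair.2.unpair.1 a = tv n.unpair.2.unpair.2 a
    | 2 => mle (tv n.unpair.2.unpair.1 a) (tv n.unpair.2.unpair.2 a)
    | 3 => (r n.unpair.2.unpair.1 a → r n.unpair.2.unpair.2 a)
    | _ => ∀ x, r n.unpair.2 (a ++ [x]))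
  refine ⟨g, fun a => ?_, fun i j a => ?_, fun i j a => ?_, fun i j a => ?_, fun i a => ?_⟩
  · rw [hg]; simp
  · rw [hg]; simp
  · rw [hg]; simp
  · have h1 := le_pair_l i j
    have h2 := le_pair_r i j
    rw [hg]
    have := pair_l 3 (Nat.pair i j) (by omega)
    simp [show i < Nat.pair 3 (Nat.pair i j) by omega, show j < Nat.pair 3 (Nat.pair i j) by omega]
  · have := pair_l 4 i (by omega)
    rw [hg]; simp [this]

theorem exists_dom (tv : ℕ → List M → M) (tr : ℕ → List M → Prop) : ∃ h : ℕ → M,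
    h 0 = mzero M ∧ (∀ i, h (dS i) = msucc (h i)) ∧
    (∀ i j, h (dA i j) = madd (h i) (h j)) ∧ (∀ i j, h (dM i j) = mmul (h i) (h j)) ∧
    (∀ t a, h (dV t a) = tv t (a.map h)) ∧
    (∀ t a, tr t (a.map h ++ [h (dW t a)]) → ∀ x, tr t (a.map h ++ [x])) := by
  classical
  obtain ⟨h, hh⟩ := exists_rec (X := M) (fun n r =>
    match n.unpair.1 with
    | 0 => mzero M
    | 1 => msucc (r n.unpair.2)
    | 2 => madd (r n.unpair.2.unpair.1) (r n.unpair.2.unpair.2)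
    | 3 => mmul (r n.unpair.2.unpair.1) (r n.unpair.2.unpair.2)
    | 4 => Classical.epsilon fun x => ¬ tr n.unpair.2.unpair.1
        ((((Encodable.decode n.unpair.2.unpair.2 : Option (List ℕ)).getD []).map r) ++ [x])
    | _ => tv n.unpair.2.unpair.1 (((Encodable.decode n.unpair.2.unpair.2 : Option (List ℕ)).getD []).map r))
  have hm : ∀ (k t : ℕ) (a : List ℕ), 0 < k → a.map (fun m => if m < Nat.pair k (Nat.pair t (Encodable.encode a)) then h m else default) = a.map h := by
    intro k t a hk
    refine List.map_congr_left fun x hx => ?_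
    have h1 := mem_lt_encode a x hx
    have h2 := le_pair_r t (Encodable.encode a)
    have h3 := pair_l k (Nat.pair t (Encodable.encode a)) hk
    rw [if_pos (by omega)]
  refine ⟨h, ?_, fun i => ?_, fun i j => ?_, fun i j => ?_, fun t a => ?_, fun t a => ?_⟩
  · rw [hh]; simp
  · have := pair_l 1 i (by omega)
    rw [dS, hh]; simp [this]
  · have h1 := le_pair_l i j
    have h2 := le_pair_r i j
    rw [dA, hh]
    have := pair_l 2 (Nat.pair i j) (by omega)
    simp [show i < Nat.pair 2 (Nat.pair i j) by omega, show j < Nat.pair 2 (Nat.pair i j) by omega]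
  · have h1 := le_pair_l i j
    have h2 := le_pair_r i j
    rw [dM, hh]
    have := pair_l 3 (Nat.pair i j) (by omega)
    simp [show i < Nat.pair 3 (Nat.pair i j) by omega, show j < Nat.pair 3 (Nat.pair i j) by omega]
  · have e := hh (Nat.pair 5 (Nat.pair t (Encodable.encode a)))
    simp only [dV, Nat.unpair_pair, Encodable.encodek, Option.getD_some] at e ⊢
    rw [hm _ _ _ (by decide)] at e
    exact e
  · have e := hh (Nat.pair 4 (Nat.pair t (Encodable.encode a)))
    simp only [dW, Nat.unpair_pair, Encodable.encodek, Option.getD_some] at e ⊢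
    rw [hm _ _ _ (by decide)] at e
    rw [e]
    intro h1 x
    by_contra hx
    have h2 : ∃ x, ¬ tr t (a.map h ++ [x]) := ⟨x, hx⟩
    exact Classical.epsilon_spec h2 h1

end

theorem model_sat {T : Thy} {g : ℕ → Option ℕ} (hg : ∀ t, (∃ x, g x = some t) ↔ ∃ φ ∈ T, ftree φ = t)
    {A B : LA.BoundedFormula Empty 1} {d p : ℕ} (M : Theory.ModelType.{0, 0, 0} T)
    (hA : A.Realize (default : Empty → M) (fun _ => numM M d))
    (hB : B.Realize (default : Empty → M) (fun _ => numM M p)) :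
    ∃ τ, Sat g (ftree A) (ftree B) d p τ := by
  classical
  have : Inhabited M := Classical.inhabited_of_nonempty inferInstance
  obtain ⟨tv, v0, v1, v2, v3, v4⟩ := exists_tval M
  obtain ⟨tr, r0, r1, r2, r3, r4⟩ := exists_tru M tv
  obtain ⟨h, h0, hS, hA', hM, hV, hW⟩ := exists_dom M tv tr
  let τ : ℕ → Bool := fun n => decide (match n.unpair.1 with
    | 0 => h n.unpair.2.unpair.1 = h n.unpair.2.unpair.2
    | 1 => mle (h n.unpair.2.unpair.1) (h n.unpair.2.unpair.2)
    | _ => tr n.unpair.2.unpair.1 (((Encodable.decode n.unpair.2.unpair.2 : Option (List ℕ)).getD []).map h))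
  have te : ∀ i j, τ (eqA i j) = decide (h i = h j) := fun i j => by simp [τ, eqA]
  have tl : ∀ i j, τ (leA i j) = decide (mle (h i) (h j)) := fun i j => by simp [τ, leA]
  have tt : ∀ t a, τ (trA t a) = decide (tr t (a.map h)) := fun t a => by simp [τ, trA]
  have term : ∀ n (t : LA.Term (Empty ⊕ Fin n)) (a : List M) (ha : a.length = n),
      t.realize (Sum.elim (default : Empty → M) (fun i : Fin n => a.getD i (mzero M))) = tv (ttree t) a := by
    intro n t a ha
    refine term_ind (P := fun t => t.realize (Sum.elim (default : Empty → M) (fun i : Fin n => a.getD i (mzero M))) = tv (ttree t) a)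
      ?_ ?_ ?_ ?_ ?_ t
    · intro i
      rw [r_vT, ttree_v, v0]
    · rw [r_zeroT, ttree_z, v1]
    · intro t ih
      rw [r_succT, ttree_s, v2, ih]
    · intro t u ih ih'
      rw [r_addT, ttree_a, v3, ih, ih']
    · intro t u ih ih'
      rw [r_mulT, ttree_m, v4, ih, ih']
  have fml : ∀ n (φ : LA.BoundedFormula Empty n) (a : List M) (ha : a.length = n),
      φ.Realize (default : Empty → M) (fun i : Fin n => a.getD i (mzero M)) ↔ tr (ftree φ) a := by
    intro n φ
    refine fml_ind (P := fun n φ => ∀ (a : List M) (ha : a.length = n),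
      φ.Realize (default : Empty → M) (fun i : Fin n => a.getD i (mzero M)) ↔ tr (ftree φ) a) ?_ ?_ ?_ ?_ ?_ n φ
    · intro n a _
      rw [ftree_f, r0]
      exact Iff.rfl
    · intro n t u a ha
      rw [ftree_e, r1, BoundedFormula.realize_bdEqual, term _ _ _ ha, term _ _ _ ha]
    · intro n t u a ha
      rw [ftree_l, r2, r_leF, term _ _ _ ha, term _ _ _ ha]
    · intro n b c ih ih' a ha
      rw [ftree_i, r3, BoundedFormula.realize_imp, ih a ha, ih' a ha]
    · intro n b ih a ha
      rw [ftree_a, r4, BoundedFormula.realize_all]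
      refine forall_congr' fun x => ?_
      rw [← ih (a ++ [x]) (by simp [ha])]
      refine iff_of_eq (congrArg _ (funext fun i => ?_))
      refine Fin.lastCases ?_ (fun i => ?_) i
      · rw [Fin.snoc_last, Fin.val_last, ← ha]
        simp
      · rw [Fin.snoc_castSucc, Fin.val_castSucc, List.getD_append _ _ _ _ (by omega)]
  have num : ∀ d, h (numD d) = numM M d := by
    intro d
    induction d with
    | zero => exact h0
    | succ d ih =>
      simp only [numM, numD, Function.iterate_succ', Function.comp] at ih ⊢
      rw [← ih, hS]
  refine ⟨τ, ?_, ?_, ?_, ?_⟩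
  · intro i j k l a
    have hget : h (a.getD i 0) = (a.map h).getD i (mzero M) := by
      rw [← h0, List.getD_map]
    simp only [hcl, List.forall_mem_cons, Cls, List.exists_mem_cons_iff, List.not_mem_nil, false_and,
      exists_false, or_false, false_imp_iff, implies_true, and_true, te, tl, tt, decide_eq_true_eq,
      decide_eq_false_iff_not, hS, hA', hM, hV, v0, v1, v2, v3, v4, r0, r1, r2, r3, r4, h0, hget,
      List.map_append, List.map_cons, List.map_nil, not_false_eq_true, true_and]
    have hW1 := hW i a
    refine ⟨?_, ?_, ?_, ?_, ?_, ?_, ?_, ?_, ?_, ?_, ?_, ?_, ?_, ?_⟩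
    · by_cases e : h i = h j <;> simp [e]
    · by_cases e : h i = h j <;> simp [e, em']
    · by_cases e : h i = h j <;> simp [e]
    · by_cases e : h i = h j <;> by_cases e' : h k = h l <;> simp [e, e']
    · by_cases e : h i = h j <;> by_cases e' : h k = h l <;> simp [e, e']
    · by_cases e : h i = h j <;> by_cases e' : h k = h l <;> simp [e, e', em']
    · tauto
    · tauto
    · tauto
    · tauto
    · tauto
    · tauto
    · tauto
    · by_cases e : ∀ x, tr i (a.map h ++ [x])
      · exact ⟨Or.inr (e _), Or.inl e⟩
      · exact ⟨Or.inl e, Or.inr fun h' => e (hW1 h')⟩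
  · intro x t hx
    obtain ⟨φ, hφ, rfl⟩ := (hg t).1 ⟨x, hx⟩
    rw [tt, decide_eq_true_eq, List.map_nil, ← fml 0 φ [] rfl]
    have := M.is_model.realize_of_mem φ hφ
    rw [Sentence.Realize, Formula.Realize] at this
    convert this
  · rw [tt, decide_eq_true_eq, List.map_cons, List.map_nil, ← fml 1 A _ rfl, num]
    convert hA using 1
    funext i
    obtain rfl : i = 0 := Subsingleton.elim _ _
    rfl
  · rw [tt, decide_eq_true_eq, List.map_cons, List.map_nil, ← fml 1 B _ rfl, num]
    convert hB using 1
    funext i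
    obtain rfl : i = 0 := Subsingleton.elim _ _
    rfl


theorem encode_map {β : Type} [Encodable β] (l : List β) :
    Encodable.encode l = Encodable.encode (l.map Encodable.encode) := by
  induction l with
  | nil => rfl
  | cons a l ih => rw [List.map_cons, Encodable.encode_list_cons, Encodable.encode_list_cons, ih]; rfl

/-- One step of parsing a term. -/
def tstep (x : ℕ) (s : List ℕ) : List ℕ :=
  if x % 2 = 0 then Nat.pair 0 (x / 4) :: s
  else if (x / 2).unpair.1 = 0 then Nat.pair 1 0 :: s
  else if (x / 2).unpair.1 = 1 then Nat.pair 2 (s.getD 0 0) :: s.tail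
  else Nat.pair (if (x / 2).unpair.2 = 0 then 3 else 4) (Nat.pair (s.getD 0 0) (s.getD 1 0)) :: s.tail.tail

/-- Parsing terms. -/
def tparse (c : ℕ) : ℕ := ((Denumerable.ofNat (List ℕ) c).foldr tstep []).getD 0 0

/-- One step of parsing a formula. -/
def fstep (x : ℕ) (s : List ℕ × List ℕ) : List ℕ × List ℕ :=
  (if x % 2 = 0 then
    if (s.1.getD 0 0).unpair.1 = 9 then
      Nat.pair 1 (Nat.pair (tparse (x / 2).unpair.2) (s.1.getD 0 0).unpair.2) :: s.1.tail
    else Nat.pair 9 (tparse (x / 2).unpair.2) :: s.1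
  else if x % 4 = 3 then
    if x / 4 = 0 then Nat.pair 3 (Nat.pair (s.1.getD 0 0) (s.1.getD 1 0)) :: s.1.tail.tail
    else if x / 4 = 1 then Nat.pair 4 (s.1.getD 0 0) :: s.1.tail
    else Nat.pair 0 0 :: s.1
  else Nat.pair 2 (s.2.getD 0 0).unpair.2 :: s.2.tail, s.1)

/-- Parsing formulas. -/
def fparse (c : ℕ) : ℕ := ((Denumerable.ofNat (List ℕ) c).foldr fstep ([], [])).1.getD 0 0

section
variable {α : Type} [Primcodable α]
theorem p_tail {f : α → List ℕ} (hf : Primrec f) : Primrec (fun x => (f x).tail) :=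
  Primrec.list_tail.comp hf
theorem p_div {f : α → ℕ} (hf : Primrec f) (k : ℕ) : Primrec (fun x => f x / k) :=
  Primrec.nat_div.comp hf (Primrec.const k)
theorem p_mod {f : α → ℕ} (hf : Primrec f) (k : ℕ) : Primrec (fun x => f x % k) :=
  Primrec.nat_mod.comp hf (Primrec.const k)
theorem p_un1 {f : α → ℕ} (hf : Primrec f) : Primrec (fun x => (f x).unpair.1) :=
  Primrec.fst.comp (Primrec.unpair.comp hf)
theorem p_un2 {f : α → ℕ} (hf : Primrec f) : Primrec (fun x => (f x).unpair.2) :=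
  Primrec.snd.comp (Primrec.unpair.comp hf)
theorem p_ite {β : Type} [Primcodable β] {f : α → ℕ} (hf : Primrec f) {k : ℕ} {g h : α → β} (hg : Primrec g)
    (hh : Primrec h) : Primrec (fun x => if f x = k then g x else h x) :=
  Primrec.ite (Primrec.eq.comp hf (Primrec.const k)) hg hh
end

theorem tstep_primrec : Primrec₂ tstep := by
  have p0 : Primrec (fun x : ℕ × List ℕ => x.1) := Primrec.fst
  have p1 : Primrec (fun x : ℕ × List ℕ => x.2) := Primrec.snd
  show Primrec (fun x : ℕ × List ℕ => tstep x.1 x.2)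
  unfold tstep
  repeat' first
    | with_reducible exact Primrec.const _
    | with_reducible exact p0
    | with_reducible exact p1
    | with_reducible apply p_ite
    | with_reducible apply p_cons
    | with_reducible apply p_pair
    | with_reducible apply p_getD
    | with_reducible apply p_tail
    | with_reducible apply p_mod
    | with_reducible apply p_div
    | with_reducible apply p_un1
    | with_reducible apply p_un2

theorem tparse_primrec : Primrec tparse := by
  have : Primrec (fun c : ℕ => (Denumerable.ofNat (List ℕ) c).foldr (fun b s => tstep b s) []) :=
    Primrec.list_foldr (h := fun _ bs => tstep bs.1 bs.2) (Primrec.ofNat _) (Primrec.const [])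
      (tstep_primrec.comp (Primrec.fst.comp Primrec.snd) (Primrec.snd.comp Primrec.snd))
  exact p_getD this (Primrec.const 0)

theorem fstep_primrec : Primrec₂ fstep := by
  have p0 : Primrec (fun x : ℕ × List ℕ × List ℕ => x.1) := Primrec.fst
  have p1 : Primrec (fun x : ℕ × List ℕ × List ℕ => x.2.1) := Primrec.fst.comp Primrec.snd
  have p2 : Primrec (fun x : ℕ × List ℕ × List ℕ => x.2.2) := Primrec.snd.comp Primrec.snd
  have pt : ∀ {f : ℕ × List ℕ × List ℕ → ℕ}, Primrec f → Primrec (fun x => tparse (f x)) :=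
    fun hf => tparse_primrec.comp hf
  show Primrec (fun x : ℕ × List ℕ × List ℕ => fstep x.1 x.2)
  unfold fstep
  repeat' first
    | with_reducible exact Primrec.const _
    | with_reducible exact p0
    | with_reducible exact p1
    | with_reducible exact p2
    | with_reducible apply Primrec.pair
    | with_reducible apply pt
    | with_reducible apply p_ite
    | with_reducible apply p_cons
    | with_reducible apply p_pair
    | with_reducible apply p_getD
    | with_reducible apply p_tail
    | with_reducible apply p_mod
    | with_reducible apply p_div
    | with_reducible apply p_un1
    | with_reducible apply p_un2

theorem fparse_primrec : Primrec fparse := by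
  have : Primrec (fun c : ℕ => (Denumerable.ofNat (List ℕ) c).foldr (fun b s => fstep b s) ([], [])) :=
    Primrec.list_foldr (h := fun _ bs => fstep bs.1 bs.2) (Primrec.ofNat _) (Primrec.const ([], []))
      (fstep_primrec.comp (Primrec.fst.comp Primrec.snd) (Primrec.snd.comp Primrec.snd))
  exact p_getD (Primrec.fst.comp this) (Primrec.const 0)

theorem tparse_list {n : ℕ} (t : LA.Term (Empty ⊕ Fin n)) : ∀ s : List ℕ,
    (t.listEncode.map Encodable.encode).foldr tstep s = ttree t :: s := by
  refine term_ind (P := fun t => ∀ s : List ℕ,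
    (t.listEncode.map Encodable.encode).foldr tstep s = ttree t :: s) ?_ ?_ ?_ ?_ ?_ t
  · intro i s
    have e : (vT i).listEncode = [Sum.inl (Sum.inr i)] := rfl
    have e2 : Encodable.encode (Sum.inl (Sum.inr i) : (Empty ⊕ Fin n) ⊕ (Σ i, LA.Functions i)) = 4 * i.val + 2 := by
      rw [Encodable.encode_inl, Encodable.encode_inr]
      have : Encodable.encode i = i.val := rfl
      omega
    rw [e, List.map_cons, e2]
    simp only [List.map_nil, List.foldr_cons, List.foldr_nil, tstep, ttree_v]
    rw [if_pos (by omega), show (4 * i.val + 2) / 4 = i.val by omega]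
  · intro s
    have e : (zeroT : LA.Term (Empty ⊕ Fin n)).listEncode = [Sum.inr ⟨0, ()⟩] := rfl
    have e2 : Encodable.encode (Sum.inr ⟨0, ()⟩ : (Empty ⊕ Fin n) ⊕ (Σ i, LA.Functions i)) = 2 * Nat.pair 0 0 + 1 := rfl
    rw [e, List.map_cons, e2]
    have e3 : (2 * Nat.pair 0 0 + 1) / 2 = Nat.pair 0 0 := by omega
    simp [tstep, ttree_z, e3]
  · intro t ih s
    have e : (succT t).listEncode = Sum.inr ⟨1, ()⟩ :: t.listEncode := by
      show _ :: _ = _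
      simp [List.finRange_succ]
    have e2 : Encodable.encode (Sum.inr ⟨1, ()⟩ : (Empty ⊕ Fin n) ⊕ (Σ i, LA.Functions i)) = 2 * Nat.pair 1 0 + 1 := rfl
    rw [e, List.map_cons, e2, List.foldr_cons, ih]
    have e3 : (2 * Nat.pair 1 0 + 1) / 2 = Nat.pair 1 0 := by omega
    have e4 : ¬ (2 * Nat.pair 1 0 + 1) % 2 = 0 := by omega
    simp [tstep, ttree_s, e3, e4]
  · intro t u ih ih' s
    have e : (addT t u).listEncode = Sum.inr ⟨2, false⟩ :: (t.listEncode ++ u.listEncode) := by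
      show _ :: _ = _
      simp [List.finRange_succ]
    have e2 : Encodable.encode (Sum.inr ⟨2, false⟩ : (Empty ⊕ Fin n) ⊕ (Σ i, LA.Functions i)) = 2 * Nat.pair 2 0 + 1 := rfl
    rw [e, List.map_cons, e2, List.foldr_cons, List.map_append, List.foldr_append, ih', ih]
    have e3 : (2 * Nat.pair 2 0 + 1) / 2 = Nat.pair 2 0 := by omega
    have e4 : ¬ (2 * Nat.pair 2 0 + 1) % 2 = 0 := by omega
    simp [tstep, ttree_a, e3, e4]
  · intro t u ih ih' s
    have e : (mulT t u).listEncode = Sum.inr ⟨2, true⟩ :: (t.listEncode ++ u.listEncode) := by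
      show _ :: _ = _
      simp [List.finRange_succ]
    have e2 : Encodable.encode (Sum.inr ⟨2, true⟩ : (Empty ⊕ Fin n) ⊕ (Σ i, LA.Functions i)) = 2 * Nat.pair 2 1 + 1 := rfl
    rw [e, List.map_cons, e2, List.foldr_cons, List.map_append, List.foldr_append, ih', ih]
    have e3 : (2 * Nat.pair 2 1 + 1) / 2 = Nat.pair 2 1 := by omega
    have e4 : ¬ (2 * Nat.pair 2 1 + 1) % 2 = 0 := by omega
    simp [tstep, ttree_m, e3, e4]

theorem tparse_eq {n : ℕ} (t : LA.Term (Empty ⊕ Fin n)) : tparse (Encodable.encode t) = ttree t := by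
  have e : Encodable.encode t = Encodable.encode t.listEncode := rfl
  rw [e, encode_map, tparse, Denumerable.ofNat_encode, tparse_list]
  rfl

/-- Symbols occurring in encodings of formulas. -/
abbrev FS := (Σ k, LA.Term (Empty ⊕ Fin k)) ⊕ ((Σ n, LA.Relations n) ⊕ ℕ)

theorem ftree_ne {n : ℕ} (φ : LA.BoundedFormula Empty n) : (ftree φ).unpair.1 ≠ 9 := by
  refine fml_ind (P := fun n φ => (ftree φ).unpair.1 ≠ 9) ?_ ?_ ?_ ?_ ?_ n φ
  · intros; rw [ftree_f]; simp
  · intros; rw [ftree_e]; simp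
  · intros; rw [ftree_l]; simp
  · intros; rw [ftree_i]; simp
  · intros; rw [ftree_a]; simp

theorem fstep_t {n : ℕ} (t : LA.Term (Empty ⊕ Fin n)) (s : List ℕ × List ℕ) :
    fstep (Encodable.encode (Sum.inl ⟨n, t⟩ : FS)) s =
      (if (s.1.getD 0 0).unpair.1 = 9 then
      Nat.pair 1 (Nat.pair (ttree t) (s.1.getD 0 0).unpair.2) :: s.1.tail
    else Nat.pair 9 (ttree t) :: s.1, s.1) := by
  rw [Encodable.encode_inl, Encodable.encode_sigma_val]
  generalize hx : 2 * Nat.pair (Encodable.encode n) (Encodable.encode t) = x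
  have e3 : x / 2 = Nat.pair (Encodable.encode n) (Encodable.encode t) := by omega
  have e4 : x % 2 = 0 := by omega
  rw [fstep, if_pos e4, e3, Nat.unpair_pair, tparse_eq]

theorem fstep_n (k : ℕ) (s : List ℕ × List ℕ) :
    fstep (Encodable.encode (Sum.inr (Sum.inr k) : FS)) s =
    (if k = 0 then Nat.pair 3 (Nat.pair (s.1.getD 0 0) (s.1.getD 1 0)) :: s.1.tail.tail
    else if k = 1 then Nat.pair 4 (s.1.getD 0 0) :: s.1.tail
    else Nat.pair 0 0 :: s.1, s.1) := by
  rw [Encodable.encode_inr, Encodable.encode_inr, Encodable.encode_nat]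
  rw [fstep, if_neg (by omega), if_pos (by omega), show (2 * (2 * k + 1) + 1) / 4 = k by omega]

theorem fstep_r (R : LA.Relations 2) (s : List ℕ × List ℕ) :
    fstep (Encodable.encode (Sum.inr (Sum.inl ⟨2, R⟩) : FS)) s =
    (Nat.pair 2 (s.2.getD 0 0).unpair.2 :: s.2.tail, s.1) := by
  rw [Encodable.encode_inr, Encodable.encode_inl]
  rw [fstep, if_neg (by omega), if_neg (by omega)]

theorem fparse_list (n : ℕ) (φ : LA.BoundedFormula Empty n) : ∀ s : List ℕ × List ℕ,
    (s.1.getD 0 0).unpair.1 ≠ 9 →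
    ((φ.listEncode.map (Encodable.encode (α := FS))).foldr fstep s).1 = ftree φ :: s.1 := by
  refine fml_ind (P := fun n φ => ∀ s : List ℕ × List ℕ,
    (s.1.getD 0 0).unpair.1 ≠ 9 →
    ((φ.listEncode.map (Encodable.encode (α := FS))).foldr fstep s).1 = ftree φ :: s.1) ?_ ?_ ?_ ?_ ?_ n φ
  · intro n s hs
    have e : (⊥ : LA.BoundedFormula Empty n).listEncode = [Sum.inr (Sum.inr (n + 2))] := rfl
    rw [e, List.map_cons, List.foldr_cons, fstep_n, if_neg (by omega), if_neg (by omega)]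
    rfl
  · intro n t u s hs
    have e : (Term.bdEqual t u).listEncode = [Sum.inl ⟨n, t⟩, Sum.inl ⟨n, u⟩] := rfl
    rw [e, List.map_cons, List.foldr_cons, List.map_cons, List.foldr_cons, List.map_nil, List.foldr_nil,
      fstep_t u, if_neg hs, fstep_t t, ftree_e]
    simp
  · intro n t u s hs
    have e : (leF t u).listEncode = [Sum.inr (Sum.inl ⟨2, (show LA.Relations 2 from ())⟩), Sum.inr (Sum.inr n), Sum.inl ⟨n, t⟩, Sum.inl ⟨n, u⟩] := rfl
    rw [e, List.map_cons, List.foldr_cons, List.map_cons, List.foldr_cons, List.map_cons, List.foldr_cons,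
      List.map_cons, List.foldr_cons, List.map_nil, List.foldr_nil,
      fstep_t u, if_neg hs, fstep_t t, fstep_n, fstep_r, ftree_l]
    simp
  · intro n a b ih ih' s hs
    have e : (a.imp b).listEncode = Sum.inr (Sum.inr 0) :: (a.listEncode ++ b.listEncode) := rfl
    rw [e, List.map_cons, List.foldr_cons, List.map_append, List.foldr_append, fstep_n, if_pos rfl]
    have h1 := ih' s hs
    have h2 := ih _ (by rw [h1]; exact ftree_ne b)
    rw [h2, h1, ftree_i]
    rfl
  · intro n a ih s hs
    have e : a.all.listEncode = Sum.inr (Sum.inr 1) :: a.listEncode := rfl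
    rw [e, List.map_cons, List.foldr_cons, fstep_n, if_neg (by omega), if_pos rfl, ih s hs, ftree_a]
    rfl

theorem fparse_gnum (φ : Snt) : fparse (gnum φ) = ftree φ := by
  have e : gnum φ = Encodable.encode (α := List FS) (BoundedFormula.listEncode φ) := rfl
  rw [e, encode_map, fparse, Denumerable.ofNat_encode, fparse_list]
  · rfl
  · simp

theorem CompThy.enum {T : Thy} (h : CompThy T) : ∃ g : ℕ → Option ℕ, Primrec g ∧
    ∀ t, (∃ x, g x = some t) ↔ ∃ φ ∈ T, ftree φ = t := by
  obtain ⟨dec, hc⟩ := h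
  obtain ⟨c, hc⟩ := Nat.Partrec.Code.exists_code.1 hc
  have hc' : ∀ n, c.eval n = Part.some (Encodable.encode (decide (∃ φ ∈ T, gnum φ = n))) := by
    intro n
    rw [hc]
    simp
  refine ⟨fun x => if Encodable.encode (Nat.Partrec.Code.evaln x.unpair.2 c x.unpair.1) = 2 then
    some (fparse x.unpair.1) else none, ?_, fun t => ?_⟩
  · refine p_ite ?_ ?_ (Primrec.const _)
    · refine Primrec.encode.comp ?_
      exact Nat.Partrec.Code.primrec_evaln.comp (Primrec.pair (Primrec.pair (p_un2 Primrec.id) (Primrec.const c))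
        (p_un1 Primrec.id))
    · exact Primrec.option_some.comp (fparse_primrec.comp (p_un1 Primrec.id))
  · have key : ∀ n, (∃ s, Encodable.encode (Nat.Partrec.Code.evaln s c n) = 2) ↔ ∃ φ ∈ T, gnum φ = n := by
      intro n
      have h1 : (∃ s, Encodable.encode (Nat.Partrec.Code.evaln s c n) = 2) ↔ 1 ∈ c.eval n := by
        rw [Nat.Partrec.Code.evaln_complete]
        refine exists_congr fun s => ?_
        cases Nat.Partrec.Code.evaln s c n <;> simp
      rw [h1, hc']
      by_cases e : ∃ φ ∈ T, gnum φ = n <;> simp [e]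
    constructor
    · rintro ⟨x, hx⟩
      beta_reduce at hx
      by_cases h1 : Encodable.encode (Nat.Partrec.Code.evaln x.unpair.2 c x.unpair.1) = 2
      swap
      · rw [if_neg h1] at hx
        cases hx
      rw [if_pos h1] at hx
      obtain ⟨φ, hφ, e⟩ := (key _).1 ⟨_, h1⟩
      refine ⟨φ, hφ, ?_⟩
      rw [← fparse_gnum, e]
      exact Option.some.inj hx
    · rintro ⟨φ, hφ, rfl⟩
      obtain ⟨s, hs⟩ := (key (gnum φ)).2 ⟨φ, hφ, rfl⟩
      refine ⟨Nat.pair (gnum φ) s, ?_⟩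
      simp only [Nat.unpair_pair, hs, if_true, fparse_gnum]

/-- Representation of inconsistency. -/
theorem CompThy.repr {T : Thy} (h : CompThy T) (A B : LA.BoundedFormula Empty 1) :
    ∃ ρ : ∀ M : PM, M → M → M → Prop, D0 (m := 3) (fun M v => ρ M (v 0) (v 1) (v 2)) ∧
      ∀ d p : ℕ, (∀ M : Theory.ModelType.{0, 0, 0} T,
        ¬ (A.Realize (default : Empty → M) (fun _ => numM M d) ∧
          B.Realize (default : Empty → M) (fun _ => numM M p))) ↔
        ∃ w : ℕ, ∀ M : PM, ρ M (d : M) (p : M) (w : M) := by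
  obtain ⟨g, hg, e⟩ := h.enum
  obtain ⟨ρ, h1, h2⟩ := (PC.sat hg (ftree A) (ftree B)).repr
  refine ⟨ρ, h1, fun d p => ?_⟩
  rw [← h2, ← not_exists, not_iff_not]
  constructor
  · rintro ⟨M, hA, hB⟩
    exact model_sat e M hA hB
  · rintro ⟨τ, hτ⟩
    exact sat_model e hτ


/-- `M` is a model of `V`. -/
def Md (V : Thy) (M : PM) : Prop := ∀ ψ ∈ V, Sentence.Realize M ψ

theorem prv_iff {V : Thy} (hV : ExtPA V) (φ : Snt) :
    Prv V φ ↔ ∀ M : PM, Md V M → Sentence.Realize M φ := by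
  constructor
  · intro h M hM
    haveI : M ⊨ V := ⟨fun ψ hψ => hM ψ hψ⟩
    have := Theory.models_sentence_iff.1 h (Theory.ModelType.of V M)
    exact this
  · intro h
    refine Theory.models_sentence_iff.2 fun M => ?_
    haveI : M ⊨ PAAx := ⟨fun ψ hψ => Theory.models_sentence_iff.1 (hV ψ hψ) M⟩
    exact h (Theory.ModelType.of PAAx M) (fun ψ hψ => Theory.realize_sentence_of_mem (M := M) V hψ)

theorem prv_mem {V : Thy} {ψ : Snt} (h : ψ ∈ V) : Prv V ψ :=
  Theory.models_sentence_iff.2 fun _ => Theory.realize_sentence_of_mem V h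

theorem ExtPA.add {V : Thy} (hV : ExtPA V) (φ : Snt) : ExtPA (add V φ) := by
  intro ψ hψ
  refine Theory.models_sentence_iff.2 fun M => ?_
  have : M ⊨ V := ⟨fun χ hχ => Theory.realize_sentence_of_mem (M := M) (Guaspari.add V φ) (Or.inr hχ)⟩
  exact Theory.models_sentence_iff.1 (hV ψ hψ) (Theory.ModelType.of V M)

theorem md_add {V : Thy} {φ : Snt} {M : PM} :
    Md (add V φ) M ↔ Sentence.Realize M φ ∧ Md V M := by
  unfold Md add
  simp only [Set.mem_insert_iff, forall_eq_or_imp]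

theorem md_pa (M : PM) : Md PAAx M := fun _ h => Theory.realize_sentence_of_mem (M := M) PAAx h

theorem ext_pa : ExtPA PAAx := fun _ h => prv_mem h

theorem r_imp (M : PM) (a b : Snt) : Sentence.Realize M (a ⟹ b : Snt) ↔
    (Sentence.Realize M a → Sentence.Realize M b) := Iff.rfl
theorem r_not (M : PM) (a : Snt) : Sentence.Realize M (∼a : Snt) ↔ ¬ Sentence.Realize M a := Iff.rfl

theorem tr_iff (M : PM) (φ : Snt) (e : Empty → M) (v : Fin 0 → M) :
    BoundedFormula.Realize φ e v ↔ Sentence.Realize M φ := by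
  rw [Subsingleton.elim e default, Subsingleton.elim v default]
  rfl

theorem numM_eq (M : PM) (d : ℕ) : numM M d = (d : M) := by
  induction d with
  | zero => simp [numM]; rfl
  | succ d ih =>
    rw [numM] at *
    rw [Function.iterate_succ_apply', ih, msucc_eq]
    push_cast
    rfl

theorem hcons_iff {Γ : Set Snt} {T : Thy} (hT : ExtPA T) (φ : Snt) :
    HConsIn Γ T φ ↔ ∀ γ ∈ Γ, (∀ M : PM, Md T M → Sentence.Realize M φ → Sentence.Realize M γ) →
      ∀ M : PM, ¬ Sentence.Realize M φ → Sentence.Realize M γ := by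
  constructor
  · intro h γ hγ h1 M hM
    have hV : ExtPA (add PAAx (φ ⟹ γ)) := ext_pa.add _
    have h2 := h (add PAAx (φ ⟹ γ)) ⟨hV, fun ψ hψ => ?_⟩ γ hγ ?_
    · rw [prv_iff hV] at h2
      refine h2 M (md_add.2 ⟨?_, md_pa M⟩)
      rw [r_imp]
      exact fun h => absurd h hM
    · rw [prv_iff hV] at hψ
      rw [prv_iff hT]
      exact fun M hM => hψ M (md_add.2 ⟨(r_imp _ _ _).2 (h1 M hM), md_pa M⟩)
    · rw [prv_iff (hV.add _)]
      intro M hM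
      obtain ⟨h3, h4⟩ := md_add.1 hM
      exact (r_imp _ _ _).1 (md_add.1 h4).1 h3
  · intro h V hV γ hγ h1
    rw [prv_iff (hV.1.add _)] at h1
    rw [prv_iff hV.1]
    intro M hM
    by_cases c : Sentence.Realize M φ
    · exact h1 M (md_add.2 ⟨c, hM⟩)
    · refine h γ hγ (fun N hN hφ => h1 N (md_add.2 ⟨hφ, fun ψ hψ => ?_⟩)) M c
      exact (prv_iff hT _).1 (hV.2 ψ (prv_mem hψ)) N hN

theorem CompThy.repr' {T : Thy} (h : CompThy T) (hT : ExtPA T) (A : UP 1) (hA : DF A) :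
    ∃ ρ : ∀ M : PM, M → M → M → Prop, D0 (m := 3) (fun M v => ρ M (v 0) (v 1) (v 2)) ∧
      ∀ d p : ℕ, (∀ M : PM, Md T M → ¬ (A M (fun _ => (d : M)) ∧ A M (fun _ => (p : M)))) ↔
        ∃ w : ℕ, ∀ M : PM, ρ M (d : M) (p : M) (w : M) := by
  obtain ⟨φ, hφ⟩ := hA
  obtain ⟨ρ, h1, h2⟩ := h.repr φ φ
  refine ⟨ρ, h1, fun d p => ?_⟩
  rw [← h2]
  constructor
  · intro H M hM
    have : M ⊨ PAAx := ⟨fun ψ hψ => Theory.models_sentence_iff.1 (hT ψ hψ) M⟩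
    refine H (Theory.ModelType.of PAAx M) (fun ψ hψ => Theory.realize_sentence_of_mem (M := M) T hψ) ?_
    rw [← hφ, ← hφ, ← numM_eq, ← numM_eq]
    exact hM
  · intro H M hM hA
    have : M ⊨ T := ⟨fun ψ hψ => hM ψ hψ⟩
    refine H (Theory.ModelType.of T M) ?_
    rw [← hφ, ← hφ, ← numM_eq, ← numM_eq] at hA
    exact hA

theorem abs3 {ρ : ∀ M : PM, M → M → M → Prop} (h : D0 (m := 3) (fun M v => ρ M (v 0) (v 1) (v 2)))
    (M N : PM) (a b c : ℕ) (H : ρ M (a : M) (b : M) (c : M)) : ρ N (a : N) (b : N) (c : N) :=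
  (h.abs M N ![a, b, c]).1 H

/-- The body of the fixed point. -/
def Body (k : ℕ) (ρ ρ' : ∀ M : PM, M → M → M → Prop) (M : PM) (x : M) : Prop :=
  ∃ z, (∃ p, p ≤ z ∧ ∃ w, w ≤ z ∧ (ρ M x p w ∧ Un k p)) ∧
    ∀ q, q ≤ z → ∀ w, w ≤ z → (¬ ρ' M x q w ∨ Un k q)

theorem D0.app3 {ρ : ∀ M : PM, M → M → M → Prop} (h : D0 (m := 3) (fun M v => ρ M (v 0) (v 1) (v 2)))
    {m : ℕ} {f g e : ∀ M : PM, (Fin m → M) → M} (hf : Tmf f) (hg : Tmf g) (he : Tmf e) :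
    D0 (fun M v => ρ M (f M v) (g M v) (e M v)) :=
  h.subst (s := ![f, g, e]) (fun i => by fin_cases i <;> assumption)

theorem body_sg (k : ℕ) {ρ ρ' : ∀ M : PM, M → M → M → Prop}
    (h : D0 (m := 3) (fun M v => ρ M (v 0) (v 1) (v 2)))
    (h' : D0 (m := 3) (fun M v => ρ' M (v 0) (v 1) (v 2)))
    {m : ℕ} {f : ∀ M : PM, (Fin m → M) → M} (hf : Tmf f) :
    Sg (k + 1) (fun M v => Body k ρ ρ' M (f M v)) := by
  unfold Body
  refine Sg.ex ((nice_Sg _).and ((nice_Sg _).bex (Tmf.var _) ((nice_Sg _).bex (Tmf.var _)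
    ((nice_Sg _).and ((nice_Sg _).d0 (h.app3 ?_ (Tmf.var _) (Tmf.var _))) (Un_sg k (Tmf.var _)))))
    ((nice_Sg _).ball (Tmf.var _) ((nice_Sg _).ball (Tmf.var _)
    ((nice_Sg _).or ((nice_Sg _).d0 (h'.app3 ?_ (Tmf.var _) (Tmf.var _)).not) (Un_sg k (Tmf.var _))))))
  all_goals exact hf.subst (fun _ => Tmf.var _)

theorem fixed_point (k : ℕ) {ρ ρ' : ∀ M : PM, M → M → M → Prop}
    (h : D0 (m := 3) (fun M v => ρ M (v 0) (v 1) (v 2)))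
    (h' : D0 (m := 3) (fun M v => ρ' M (v 0) (v 1) (v 2))) :
    ∃ d : ℕ, ∀ M : PM, Un k (d : M) ↔ Body k ρ ρ' M (d : M) := by
  obtain ⟨e, he⟩ := Un_univ k (body_sg k h h' (m := 1) (Tmf.pr (Tmf.var 0) (Tmf.var 0)))
  refine ⟨pr e e, fun M => ?_⟩
  have := he M (e : M)
  rw [cast_pr, ← this]

theorem exists_sigma (k : ℕ) {P : ∀ M : PM, Prop} (h : Sg k (m := 0) (fun M _ => P M)) :
    ∃ φ ∈ SigmaS k, ∀ M : PM, Sentence.Realize M φ ↔ P M := by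
  obtain ⟨φ, h1, h2⟩ := (fml_of k).1 h
  refine ⟨φ, h1, fun M => ?_⟩
  rw [← tr_iff M φ default default]
  exact h2 M _

theorem exists_pi (k : ℕ) {P : ∀ M : PM, Prop} (h : Pp k (m := 0) (fun M _ => P M)) :
    ∃ φ ∈ PiS k, ∀ M : PM, Sentence.Realize M φ ↔ P M := by
  obtain ⟨φ, h1, h2⟩ := (fml_of k).2 h
  refine ⟨φ, h1, fun M => ?_⟩
  rw [← tr_iff M φ default default]
  exact h2 M _

theorem sigma_code (k : ℕ) {φ : Snt} (h : φ ∈ SigmaS (k + 1)) :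
    ∃ p : ℕ, ∀ M : PM, Sentence.Realize M φ ↔ Un k (p : M) := by
  have h1 : Sg (k + 1) (m := 1) (fun M _ => Sentence.Realize M φ) := by
    have := (nice_Sg (k + 1)).subst (IsSigmaFml.sg h) (k := 1) (s := Fin.elim0) (fun i => i.elim0)
    simpa only [tr_iff] using this
  obtain ⟨e, he⟩ := Un_univ k h1
  refine ⟨pr e 0, fun M => ?_⟩
  rw [cast_pr, he M ((0 : ℕ) : M)]

theorem pi_code (k : ℕ) {φ : Snt} (h : φ ∈ PiS (k + 1)) :
    ∃ p : ℕ, ∀ M : PM, Sentence.Realize M φ ↔ ¬ Un k (p : M) := by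
  have h1 : Sg (k + 1) (m := 1) (fun M _ => ¬ Sentence.Realize M φ) := by
    have := (nice_Sg (k + 1)).subst (IsPiFml.pp h) (k := 1) (s := Fin.elim0) (fun i => i.elim0)
    simpa only [tr_iff] using this
  obtain ⟨e, he⟩ := Un_univ k h1
  refine ⟨pr e 0, fun M => ?_⟩
  rw [cast_pr, ← he M ((0 : ℕ) : M), not_not]

theorem main_dir (k : ℕ) (T U : Thy) (hT : GoodThy T) (hU : GoodThy U)
    (H1 : ∀ π ∈ PiS (k + 1), ∀ σ ∈ SigmaS (k + 1), (∀ M : PM, Md T M → Sentence.Realize M π) →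
      (∀ M : PM, Md U M → Sentence.Realize M π → Sentence.Realize M σ) →
      ∀ M : PM, ¬ Sentence.Realize M π → Sentence.Realize M σ)
    (H2 : ∀ π ∈ PiS (k + 1), ∀ σ ∈ SigmaS (k + 1), (∀ M : PM, Md U M → Sentence.Realize M σ) →
      (∀ M : PM, Md T M → Sentence.Realize M σ → Sentence.Realize M π) →
      ∀ M : PM, ¬ Sentence.Realize M σ → Sentence.Realize M π) :
    ∃ φ ∈ SigmaS (k + 1),
      (∀ π ∈ PiS (k + 1), (∀ M : PM, Md T M → Sentence.Realize M φ → Sentence.Realize M π) →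
        ∀ M : PM, ¬ Sentence.Realize M φ → Sentence.Realize M π) ∧
      (∀ σ ∈ SigmaS (k + 1), (∀ M : PM, Md U M → ¬ Sentence.Realize M φ → Sentence.Realize M σ) →
        ∀ M : PM, Sentence.Realize M φ → Sentence.Realize M σ) := by
  have hUn : Sg (k + 1) (m := 1) (fun M v => Un k (v 0)) := Un_sg k (Tmf.var 0)
  have hA := (nice_Sg _).df hUn
  obtain ⟨ρ, hρ, eρ⟩ := hT.1.repr' hT.2.2 _ hA
  obtain ⟨ρ', hρ', eρ'⟩ := hU.1.repr' hU.2.2 _ hA.not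
  obtain ⟨d, hd⟩ := fixed_point k hρ hρ'
  let Pb : ℕ → PM → Prop := fun b M => ∀ p, p ≤ (b : M) → ∀ w, w ≤ (b : M) →
    (¬ ρ M (d : M) p w ∨ ¬ Un k p)
  let Sb : ℕ → PM → Prop := fun b M => ∀ q, q ≤ (b : M) → ∀ w, w ≤ (b : M) →
    (¬ ρ' M (d : M) q w ∨ Un k q)
  have hd0 : Sg (k + 1) (m := 0) (fun M _ => Un k (d : M)) := Un_sg k (Tmf.cast d)
  have hPb : ∀ b, Pp (k + 1) (m := 0) (fun M _ => Pb b M) := fun b =>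
    (nice_Pp _).ball (Tmf.cast _) ((nice_Pp _).ball (Tmf.cast _) ((nice_Pp _).or
      ((nice_Pp _).d0 (hρ.app3 (Tmf.cast _) (Tmf.var _) (Tmf.var _)).not) (Un_sg k (Tmf.var _)).not))
  have hSb : ∀ b, Sg (k + 1) (m := 0) (fun M _ => Sb b M) := fun b =>
    (nice_Sg _).ball (Tmf.cast _) ((nice_Sg _).ball (Tmf.cast _) ((nice_Sg _).or
      ((nice_Sg _).d0 (hρ'.app3 (Tmf.cast _) (Tmf.var _) (Tmf.var _)).not) (Un_sg k (Tmf.var _))))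
  have a1 : ∀ b (M : PM), Sb b M → ¬ Un k (d : M) → Pb b M := by
    intro b M hs hn p hp w hw
    by_contra! hc
    exact hn ((hd M).2 ⟨b, ⟨p, hp, w, hw, hc.1, hc.2⟩, hs⟩)
  have a2 : ∀ b (M : PM), Pb b M → Un k (d : M) → Sb b M := by
    intro b M hs hn q hq w hw
    obtain ⟨z, ⟨p, hp, w', hw', h1, h2⟩, h3⟩ := (hd M).1 hn
    rcases le_total z (b : M) with hz | hz
    · rcases hs p (hp.trans hz) w' (hw'.trans hz) with h | h
      · exact absurd h1 h
      · exact absurd h2 h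
    · exact h3 q (hq.trans hz) w (hw.trans hz)
  have a3 : ∀ b (M : PM), Md T M → Un k (d : M) → Pb b M := by
    intro b M hM hn p hp w hw
    by_contra! hc
    obtain ⟨i, -, rfl⟩ := of_le_cast p b hp
    obtain ⟨j, -, rfl⟩ := of_le_cast w b hw
    exact (eρ d i).2 ⟨j, fun N => abs3 hρ M N _ _ _ hc.1⟩ M hM ⟨hn, hc.2⟩
  have a4 : ∀ b (M : PM), Md U M → ¬ Un k (d : M) → Sb b M := by
    intro b M hM hn p hp w hw
    by_contra! hc
    obtain ⟨i, -, rfl⟩ := of_le_cast p b hp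
    obtain ⟨j, -, rfl⟩ := of_le_cast w b hw
    exact (eρ' d i).2 ⟨j, fun N => abs3 hρ' M N _ _ _ hc.1⟩ M hM ⟨hn, hc.2⟩
  have b1 : ∀ b (M : PM), Un k (d : M) → Sb b M := by
    intro b M hM
    obtain ⟨θ, hθ, eθ⟩ := exists_pi (k + 1) (P := fun M => ¬ Un k (d : M) ∨ Pb b M) ((nice_Pp (k + 1)).or hd0.not (hPb b))
    obtain ⟨σ, hσ, eσ⟩ := exists_sigma (k + 1) (hSb b)
    by_cases c : Pb b M
    · exact a2 b M c hM
    · refine (eσ M).1 (H1 θ hθ σ hσ (fun N hN => ?_) (fun N hN h => ?_) M ?_)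
      · rw [eθ]
        by_cases c : Un k (d : N)
        · exact Or.inr (a3 b N hN c)
        · exact Or.inl c
      · rw [eσ]
        rw [eθ] at h
        by_cases c : Un k (d : N)
        · exact a2 b N (h.resolve_left (not_not.2 c)) c
        · exact a4 b N hN c
      · rw [eθ]
        exact fun h => h.elim (fun h => h hM) c
  have b2 : ∀ b (M : PM), ¬ Un k (d : M) → Pb b M := by
    intro b M hM
    obtain ⟨θ, hθ, eθ⟩ := exists_sigma (k + 1) (P := fun M => Un k (d : M) ∨ Sb b M) ((nice_Sg (k + 1)).or hd0 (hSb b))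
    obtain ⟨π, hπ, eπ⟩ := exists_pi (k + 1) (hPb b)
    by_cases c : Sb b M
    · exact a1 b M c hM
    · refine (eπ M).1 (H2 π hπ θ hθ (fun N hN => ?_) (fun N hN h => ?_) M ?_)
      · rw [eθ]
        by_cases c : Un k (d : N)
        · exact Or.inl c
        · exact Or.inr (a4 b N hN c)
      · rw [eπ]
        rw [eθ] at h
        by_cases c : Un k (d : N)
        · exact a3 b N hN c
        · exact a1 b N (h.resolve_left c) c
      · rw [eθ]
        exact fun h => h.elim (fun h => hM h) c
  obtain ⟨φ, hφ, eφ⟩ := exists_sigma (k + 1) hd0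
  refine ⟨φ, hφ, fun π hπ h M hM => ?_, fun σ hσ h M hM => ?_⟩
  · obtain ⟨p, hp⟩ := pi_code k hπ
    simp only [eφ, hp] at h hM ⊢
    obtain ⟨w, hw⟩ := (eρ d p).1 (fun N hN hc => h N hN hc.1 hc.2)
    exact (b2 (max p w) M hM p (by simp) w (by simp)).resolve_left (not_not.2 (hw M))
  · obtain ⟨p, hp⟩ := sigma_code k hσ
    simp only [eφ, hp] at h hM ⊢
    obtain ⟨w, hw⟩ := (eρ' d p).1 (fun N hN hc => hc.2 (h N hN hc.1))
    exact (b1 (max p w) M hM p (by simp) w (by simp)).resolve_left (not_not.2 (hw M))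

/-- Theorem 5.8. -/
theorem stmt_7 (T U : Thy) (hT : GoodThy T) (hU : GoodThy U) (n : ℕ) (hn : 1 ≤ n) :
    (∃ φ ∈ SigmaS n, HConsIn (PiS n) T φ ∧ HConsIn (SigmaS n) U (∼φ)) ↔
      (ThIn (PiS n) T ⊆ {φ | HConsIn (SigmaS n) U φ} ∧
        ThIn (SigmaS n) U ⊆ {φ | HConsIn (PiS n) T φ}) := by
  obtain ⟨k, rfl⟩ : ∃ k, n = k + 1 := ⟨n - 1, by omega⟩
  constructor
  · rintro ⟨φ, hφ, h1, h2⟩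
    rw [hcons_iff hT.2.2] at h1
    rw [hcons_iff hU.2.2] at h2
    simp only [r_not, not_not] at h2
    refine ⟨fun π hπ => ?_, fun σ hσ => ?_⟩
    · refine (hcons_iff hU.2.2 _).2 fun σ hσ h M hM => ?_
      have e1 := h1 π hπ.1 (fun N hN _ => (prv_iff hT.2.2 _).1 hπ.2 N hN)
      refine h2 σ hσ (fun N hN hc => h N hN (e1 N hc)) M ?_
      by_contra hc
      exact hM (e1 M hc)
    · refine (hcons_iff hT.2.2 _).2 fun π hπ h M hM => ?_
      have e1 := h2 σ hσ.1 (fun N hN _ => (prv_iff hU.2.2 _).1 hσ.2 N hN)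
      exact h1 π hπ (fun N hN hc => h N hN (e1 N hc)) M (fun hc => hM (e1 M hc))
  · rintro ⟨h1, h2⟩
    obtain ⟨φ, hφ, h3, h4⟩ := main_dir k T U hT hU
      (fun π hπ σ hσ ha hb => (hcons_iff hU.2.2 _).1 (h1 ⟨hπ, (prv_iff hT.2.2 _).2 ha⟩) σ hσ hb)
      (fun π hπ σ hσ ha hb => (hcons_iff hT.2.2 _).1 (h2 ⟨hσ, (prv_iff hU.2.2 _).2 ha⟩) π hπ hb)
    refine ⟨φ, hφ, (hcons_iff hT.2.2 _).2 h3, (hcons_iff hU.2.2 _).2 ?_⟩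
    simpa only [r_not, not_not] using h4

end Guaspari
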